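/- arXiv:1104.2450 — 3 statements merged into one kernel-verified Lean document; each statement's English description precedes it below -/
import Mathlib

section
/- Let m ≥ 2, let PSp(2m, ℤ) denote the quotient of Sp(2m, ℤ) by its center, let Γ be a finitely generated group, and let ρ : Γ → PSp(2m, ℤ) be a group homomorphism whose image is a finite-index subgroup of PSp(2m, ℤ). Then the set {γ ∈ Γ : some matrix A ∈ Sp(2m, ℤ) mapping to ρ(γ) in PSp(2m, ℤ) has characteristic polynomial reducible over ℚ} is exponentially small in Γ. -/
/-- The probability that the `k`-th step of the random walk driven by the uniform measure on
the finite set `S` lies in the set `Z`. -/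
noncomputable def walkProb {G : Type*} [Group G] (S : Finset G) (k : ℕ) (Z : Set G) : ℝ :=
  (Nat.card {w : Fin k → S // (List.ofFn fun i => ((w i : G))).prod ∈ Z} : ℝ) /
    (S.card : ℝ) ^ k

/-- `Z` is exponentially small with respect to `S`. -/
def ExpSmallWrt {G : Type*} [Group G] (S : Finset G) (Z : Set G) : Prop :=
  ∃ c α : ℝ, 0 < c ∧ 0 < α ∧ ∀ k : ℕ, walkProb S k Z ≤ c * Real.exp (-α * k)

/-- `S` is an admissible subset: symmetric, generating, and satisfying an odd relation. -/
def Admissible {G : Type*} [Group G] (S : Finset G) : Prop :=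
  (∀ x : G, x ∈ S ↔ x⁻¹ ∈ S) ∧ Subgroup.closure (S : Set G) = ⊤ ∧
    ∃ k : ℕ, Odd k ∧ ∃ w : Fin k → S, (List.ofFn fun i => ((w i : G))).prod = 1

/-- `Z` is exponentially small: exponentially small with respect to every admissible set. -/
def ExpSmall {G : Type*} [Group G] (Z : Set G) : Prop :=
  ∀ S : Finset G, Admissible S → ExpSmallWrt S Z

/-- The `μ`-mass of a subset of a finite type. -/
noncomputable def mass {X : Type*} [Fintype X] (μ : X → ℝ) (A : Set X) : ℝ :=
  ∑ x, A.indicator μ x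

section Mass

variable {X : Type*} [Fintype X] {μ : X → ℝ}

theorem mass_mono (h0 : ∀ x, 0 ≤ μ x) {A B : Set X} (h : A ⊆ B) : mass μ A ≤ mass μ B :=
  Finset.sum_le_sum fun x _ => Set.indicator_le_indicator_of_subset h h0 x

theorem mass_union_le (h0 : ∀ x, 0 ≤ μ x) (A B : Set X) :
    mass μ (A ∪ B) ≤ mass μ A + mass μ B := by
  rw [mass, mass, mass, ← Finset.sum_add_distrib]
  refine Finset.sum_le_sum fun x _ => ?_
  have := h0 x
  by_cases hA : x ∈ A <;> by_cases hB : x ∈ B <;> simp [hA, hB, this]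

theorem mass_le_mass_preimage_add {u : Equiv.Perm X} {δ : ℝ} (hδ : ∑ x, |μ (u x) - μ x| ≤ δ)
    (A : Set X) : mass μ A ≤ mass μ (u ⁻¹' A) + δ := by
  have h1 : mass μ A = ∑ x, A.indicator μ (u x) := (Equiv.sum_comp u _).symm
  rw [h1, mass]
  refine le_trans ?_ (add_le_add_right hδ _)
  rw [← Finset.sum_add_distrib]
  refine Finset.sum_le_sum fun x _ => ?_
  have := le_abs_self (μ (u x) - μ x)
  by_cases hA : u x ∈ A
  · simp [Set.indicator, hA]; linarith
  · simp [Set.indicator, hA]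

theorem mass_le_mass_preimage_pow_add {u : Equiv.Perm X} {δ : ℝ}
    (hδ : ∑ x, |μ (u x) - μ x| ≤ δ) (A : Set X) (k : ℕ) :
    mass μ A ≤ mass μ (⇑(u ^ k) ⁻¹' A) + k * δ := by
  induction k with
  | zero => simp
  | succ k ih =>
    have := mass_le_mass_preimage_add hδ (⇑(u ^ k) ⁻¹' A)
    have h2 : ⇑u ⁻¹' (⇑(u ^ k) ⁻¹' A) = ⇑(u ^ (k + 1)) ⁻¹' A := by
      rw [pow_succ]; rfl
    rw [h2] at this
    rw [Nat.cast_add, Nat.cast_one]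
    linarith

open Classical in
/-- A set which most orbit segments of an almost measure-preserving permutation meet at most twice
has small mass. -/
theorem mul_mass_le_of_card_le_two (h0 : ∀ x, 0 ≤ μ x) {u : Equiv.Perm X} {δ : ℝ}
    (hδ : ∑ x, |μ (u x) - μ x| ≤ δ) (A D : Set X) (K : ℕ)
    (h : ∀ x ∈ D, ((Finset.range K).filter fun k => (u ^ k) x ∈ A).card ≤ 2) :
    K * mass μ A ≤ 2 * ∑ x, μ x + K * mass μ Dᶜ + K * (K * δ) := by
  have hδ0 : 0 ≤ δ := le_trans (Finset.sum_nonneg fun _ _ => abs_nonneg _) hδ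
  have h1 : K * mass μ A ≤ ∑ k ∈ Finset.range K, (mass μ (⇑(u ^ k) ⁻¹' A) + K * δ) := by
    calc K * mass μ A = ∑ k ∈ Finset.range K, mass μ A := by simp
      _ ≤ _ := by
        refine Finset.sum_le_sum fun k hk => ?_
        have := mass_le_mass_preimage_pow_add hδ A k
        have hk : (k : ℝ) ≤ K := by exact_mod_cast (Finset.mem_range.1 hk).le
        have := mul_le_mul_of_nonneg_right hk hδ0
        linarith
  rw [Finset.sum_add_distrib] at h1
  have h2 : ∑ k ∈ Finset.range K, mass μ (⇑(u ^ k) ⁻¹' A) ≤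
      2 * ∑ x, μ x + K * mass μ Dᶜ := by
    simp only [mass]
    rw [Finset.sum_comm, Finset.mul_sum, Finset.mul_sum, ← Finset.sum_add_distrib]
    refine Finset.sum_le_sum fun x _ => ?_
    have e : ∑ k ∈ Finset.range K, (⇑(u ^ k) ⁻¹' A).indicator μ x =
        ((Finset.range K).filter fun k => (u ^ k) x ∈ A).card * μ x := by
      rw [Finset.card_filter]
      push_cast
      rw [Finset.sum_mul]
      refine Finset.sum_congr rfl fun k _ => ?_
      by_cases hA : (u ^ k) x ∈ A <;> simp [Set.indicator, hA]
    rw [e]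
    by_cases hx : x ∈ D
    · have : (((Finset.range K).filter fun k => (u ^ k) x ∈ A).card : ℝ) ≤ 2 := by
        exact_mod_cast h x hx
      simpa [hx] using mul_le_mul_of_nonneg_right this (h0 x)
    · have : (((Finset.range K).filter fun k => (u ^ k) x ∈ A).card : ℝ) ≤ K := by
        exact_mod_cast (Finset.card_filter_le _ _).trans (by simp)
      have := mul_le_mul_of_nonneg_right this (h0 x)
      have h3 := h0 x
      simp only [Set.mem_compl_iff, hx, not_false_eq_true, Set.indicator_of_mem]
      linarith
  simp only [Finset.sum_const, Finset.card_range, nsmul_eq_mul] at h1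
  linarith

end Mass

section Shear

variable {R : Type*} [CommRing R]

/-- The action of a unipotent matrix on binary quadratic forms. -/
@[simps]
def shear (n : R) : Equiv.Perm (R × R × R) where
  toFun x := (x.1, x.2.1 + 2 * n * x.1, x.2.2 + n * x.2.1 + n ^ 2 * x.1)
  invFun x := (x.1, x.2.1 - 2 * n * x.1, x.2.2 - n * x.2.1 + n ^ 2 * x.1)
  left_inv x := by ext <;> simp <;> ring
  right_inv x := by ext <;> simp <;> ring

/-- Exchange of the two variables of a binary quadratic form. -/
@[simps]
def flipForm : Equiv.Perm (R × R × R) where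
  toFun x := (x.2.2, x.2.1, x.1)
  invFun x := (x.2.2, x.2.1, x.1)
  left_inv _ := rfl
  right_inv _ := rfl

theorem shear_pow (n : R) (k : ℕ) : shear n ^ k = shear (n * k) := by
  induction k with
  | zero => ext x <;> simp
  | succ k ih => rw [pow_succ', ih]; ext x <;> simp <;> ring

end Shear

/-- An integer quadratic polynomial with leading coefficient at least four times a bound takes
values within that bound at most twice. -/
theorem card_quadratic_le_two (n a b c : ℤ) (hn : 2 ≤ n) (ha : a ≠ 0) (s : Finset ℕ)
    (hs : ∀ k ∈ s, |c + n * k * b + (n * k) ^ 2 * a| ≤ |a|) : s.card ≤ 2 := by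
  by_contra hcon
  obtain ⟨i, j, k, hi, hj, hk, hij, hjk⟩ : ∃ i j k, i ∈ s ∧ j ∈ s ∧ k ∈ s ∧ i < j ∧ j < k := by
    have e : 2 < s.card := by omega
    let f := s.orderEmbOfFin rfl
    refine ⟨f ⟨0, by omega⟩, f ⟨1, by omega⟩, f ⟨2, by omega⟩, ?_, ?_, ?_, ?_, ?_⟩
    · exact s.orderEmbOfFin_mem rfl _
    · exact s.orderEmbOfFin_mem rfl _
    · exact s.orderEmbOfFin_mem rfl _
    · exact f.strictMono (by simp)
    · exact f.strictMono (by simp)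
  have h1 := hs i hi
  have h2 := hs j hj
  have h3 := hs k hk
  set y1 := c + n * i * b + (n * i) ^ 2 * a
  set y2 := c + n * j * b + (n * j) ^ 2 * a
  set y3 := c + n * k * b + (n * k) ^ 2 * a
  obtain ⟨p, hp, hp1⟩ : ∃ p : ℤ, (j : ℤ) = i + p ∧ 1 ≤ p := ⟨j - i, by ring, by omega⟩
  obtain ⟨q, hq, hq1⟩ : ∃ q : ℤ, (k : ℤ) = i + p + q ∧ 1 ≤ q := ⟨k - j, by rw [hp]; ring, by omega⟩
  have e : y1 * q - y2 * (p + q) + y3 * p = n ^ 2 * a * (p * q * (p + q)) := by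
    simp only [y1, y2, y3, hp, hq]; ring
  have hA : 0 < |a| := abs_pos.2 ha
  have e2 : n ^ 2 * |a| * (p * q * (p + q)) ≤ 2 * |a| * (p + q) := by
    have : |y1 * q - y2 * (p + q) + y3 * p| = n ^ 2 * |a| * (p * q * (p + q)) := by
      rw [e, abs_mul, abs_mul, abs_of_nonneg (by positivity : 0 ≤ n ^ 2),
        abs_of_nonneg (by positivity : 0 ≤ p * q * (p + q))]
    rw [← this]
    calc |y1 * q - y2 * (p + q) + y3 * p| ≤ |y1 * q| + |y2 * (p + q)| + |y3 * p| :=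
          (abs_add_le _ _).trans (add_le_add_left (abs_sub _ _) _)
      _ = |y1| * q + |y2| * (p + q) + |y3| * p := by
          rw [abs_mul, abs_mul, abs_mul, abs_of_nonneg (by omega : 0 ≤ q),
            abs_of_nonneg (by omega : 0 ≤ p), abs_of_nonneg (by omega : 0 ≤ p + q)]
      _ ≤ |a| * q + |a| * (p + q) + |a| * p := by gcongr
      _ = _ := by ring
  have hpq : 1 ≤ p * q := by nlinarith
  have hn2 : 4 ≤ n ^ 2 := by nlinarith
  have h4 : 4 ≤ n ^ 2 * (p * q) := by nlinarith
  have h5 : 0 < |a| * (p + q) := by positivity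
  nlinarith

theorem valMinAbs_shear {N : ℕ} [NeZero N] (n K k : ℕ) (hk : k ≤ K) (x : ZMod N × ZMod N × ZMod N)
    (h1 : 2 * (1 + n * K + (n * K) ^ 2) * |((n : ZMod N) * x.1).valMinAbs| < N)
    (h2 : 2 * (1 + n * K + (n * K) ^ 2) * |((n : ZMod N) * x.2.1).valMinAbs| < N)
    (h3 : 2 * (1 + n * K + (n * K) ^ 2) * |((n : ZMod N) * x.2.2).valMinAbs| < N) :
    ((n : ZMod N) * ((shear (n : ZMod N) ^ k) x).2.2).valMinAbs =
      ((n : ZMod N) * x.2.2).valMinAbs + n * k * ((n : ZMod N) * x.2.1).valMinAbs +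
        (n * k) ^ 2 * ((n : ZMod N) * x.1).valMinAbs := by
  rw [ZMod.valMinAbs_spec]
  set a := ((n : ZMod N) * x.1).valMinAbs with ha
  set b := ((n : ZMod N) * x.2.1).valMinAbs with hb
  set c := ((n : ZMod N) * x.2.2).valMinAbs with hc
  have hkK : (n * k : ℤ) ≤ n * K := by gcongr
  have hnk : (0 : ℤ) ≤ n * k := by positivity
  constructor
  · rw [shear_pow, shear_apply]
    push_cast
    rw [ha, hb, hc, ZMod.coe_valMinAbs, ZMod.coe_valMinAbs, ZMod.coe_valMinAbs]
    ring
  · have hbound : |c + n * k * b + (n * k) ^ 2 * a| * (2 * (1 + n * K + (n * K) ^ 2)) <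
        N * (1 + n * K + (n * K) ^ 2) := by
      calc |c + n * k * b + (n * k) ^ 2 * a| * (2 * (1 + n * K + (n * K) ^ 2))
          ≤ (|c| + n * K * |b| + (n * K) ^ 2 * |a|) * (2 * (1 + n * K + (n * K) ^ 2)) := by
            gcongr
            refine (abs_add_three _ _ _).trans ?_
            rw [abs_mul, abs_mul ((n * k : ℤ) ^ 2), abs_of_nonneg hnk,
              abs_of_nonneg (by positivity : (0 : ℤ) ≤ (n * k) ^ 2)]
            gcongr
        _ = (2 * (1 + n * K + (n * K) ^ 2) * |c|) + n * K * (2 * (1 + n * K + (n * K) ^ 2) * |b|)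
            + (n * K) ^ 2 * (2 * (1 + n * K + (n * K) ^ 2) * |a|) := by ring
        _ < N + n * K * N + (n * K) ^ 2 * N := by
            have hnK : (0 : ℤ) ≤ n * K := by positivity
            have := mul_le_mul_of_nonneg_left h2.le hnK
            have := mul_le_mul_of_nonneg_left h1.le (by positivity : (0 : ℤ) ≤ (n * K) ^ 2)
            linarith
        _ = _ := by ring
    have : |c + n * k * b + (n * k) ^ 2 * a| * 2 < N := by
      by_contra hcon
      push Not at hcon
      have := mul_le_mul_of_nonneg_right hcon (by positivity : (0 : ℤ) ≤ 1 + n * K + (n * K) ^ 2)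
      linarith
    have h5 := le_abs_self (c + n * k * b + (n * k) ^ 2 * a)
    have h6 := neg_abs_le (c + n * k * b + (n * k) ^ 2 * a)
    constructor <;> linarith

/-- Triples whose multiples by `n` have small representatives. -/
def nearZero (N n : ℕ) (C : ℤ) : Set (ZMod N × ZMod N × ZMod N) :=
  {x | C * |((n : ZMod N) * x.1).valMinAbs| < N ∧ C * |((n : ZMod N) * x.2.1).valMinAbs| < N ∧
    C * |((n : ZMod N) * x.2.2).valMinAbs| < N}

/-- Forms whose leading coefficient is nonzero and dominates the last one. -/
def leadDominant (N n : ℕ) : Set (ZMod N × ZMod N × ZMod N) :=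
  {x | x.1 ≠ 0 ∧ |((n : ZMod N) * x.2.2).valMinAbs| ≤ |((n : ZMod N) * x.1).valMinAbs|}

theorem mass_leadDominant_le {N n : ℕ} [NeZero N] (hn : 2 ≤ n) (hc : n.Coprime N) (K : ℕ)
    (μ : ZMod N × ZMod N × ZMod N → ℝ) (h0 : ∀ x, 0 ≤ μ x) {δ : ℝ}
    (hδ : ∑ x, |μ (shear (n : ZMod N) x) - μ x| ≤ δ) :
    K * mass μ (leadDominant N n) ≤
      2 * ∑ x, μ x + K * mass μ (nearZero N n (2 * (1 + n * K + (n * K) ^ 2)))ᶜ + K * (K * δ) := by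
  classical
  refine mul_mass_le_of_card_le_two h0 hδ _ _ K ?_
  rintro x ⟨h1, h2, h3⟩
  by_cases hx : x.1 = 0
  · rw [Finset.filter_false_of_mem]
    · simp
    · rintro k - ⟨hk, -⟩
      rw [shear_pow] at hk
      exact hk hx
  refine card_quadratic_le_two n ((n : ZMod N) * x.1).valMinAbs ((n : ZMod N) * x.2.1).valMinAbs
    ((n : ZMod N) * x.2.2).valMinAbs (by exact_mod_cast hn) ?_ _ ?_
  · rw [Ne, ZMod.valMinAbs_eq_zero, (ZMod.isUnit_iff_coprime n N).2 hc |>.mul_right_eq_zero]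
    exact hx
  · intro k hk
    rw [Finset.mem_filter, Finset.mem_range] at hk
    obtain ⟨hk, -, hk2⟩ := hk
    rw [valMinAbs_shear n K k hk.le x h1 h2 h3, shear_pow] at hk2
    exact hk2

theorem mass_ne_zero_le {N n : ℕ} [NeZero N] (hn : 2 ≤ n) (hc : n.Coprime N) (K : ℕ)
    (μ : ZMod N × ZMod N × ZMod N → ℝ) (h0 : ∀ x, 0 ≤ μ x) {δ : ℝ}
    (hδ : ∑ x, |μ (shear (n : ZMod N) x) - μ x| ≤ δ)
    (hδ' : ∑ x, |μ (flipForm (shear (n : ZMod N) (flipForm x))) - μ x| ≤ δ)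
    (hD : mass μ (nearZero N n (2 * (1 + n * K + (n * K) ^ 2)))ᶜ ≤ δ) :
    K * mass μ {x | x ≠ 0} ≤ 6 * ∑ x, μ x + K * (4 + 3 * K) * δ := by
  have hA := mass_leadDominant_le hn hc K μ h0 hδ
  have hsum : ∑ x, μ (flipForm x) = ∑ x, μ x := Equiv.sum_comp flipForm μ
  have hflip (A : Set (ZMod N × ZMod N × ZMod N)) :
      mass (fun x => μ (flipForm x)) A = mass μ (flipForm ⁻¹' A) := by
    rw [mass, mass, ← Equiv.sum_comp flipForm]
    refine Finset.sum_congr rfl fun x _ => ?_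
    by_cases hx : flipForm x ∈ A
    · rw [Set.indicator_of_mem hx, Set.indicator_of_mem (by exact hx)]; rfl
    · rw [Set.indicator_of_notMem hx, Set.indicator_of_notMem (by exact hx)]
  have hB := mass_leadDominant_le hn hc K (fun x => μ (flipForm x)) (fun x => h0 _) (δ := δ) (by
    rw [← Equiv.sum_comp flipForm]
    exact hδ')
  have hnz : flipForm ⁻¹' (nearZero N n (2 * (1 + n * K + (n * K) ^ 2)))ᶜ =
      (nearZero N n (2 * (1 + n * K + (n * K) ^ 2)))ᶜ := by
    ext x
    simp only [nearZero, Set.mem_preimage, Set.mem_compl_iff, Set.mem_ofPred_eq, flipForm_apply]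
    tauto
  rw [hflip, hflip, hsum, hnz] at hB
  set A := leadDominant N n
  set B := flipForm ⁻¹' leadDominant N n
  have hsub : {x : ZMod N × ZMod N × ZMod N | x ≠ 0} ⊆
      A ∪ B ∪ (shear (n : ZMod N)) ⁻¹' B := by
    intro x hx
    by_cases h1 : x.1 = 0
    · by_cases h3 : x.2.2 = 0
      · right
        have h2 : x.2.1 ≠ 0 := fun h => hx (Prod.ext h1 (Prod.ext h h3))
        refine ⟨?_, ?_⟩
        · simp only [flipForm_apply, shear_apply, h1, h3]
          simpa [(ZMod.isUnit_iff_coprime n N).2 hc |>.mul_right_eq_zero] using h2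
        · simp [flipForm_apply, shear_apply, h1]
      · left; right
        exact ⟨h3, by simp [flipForm_apply, h1]⟩
    · rcases le_total |((n : ZMod N) * x.2.2).valMinAbs| |((n : ZMod N) * x.1).valMinAbs| with h | h
      · left; left; exact ⟨h1, h⟩
      · left; right
        refine ⟨fun h3 => h1 ?_, h⟩
        have h3 : x.2.2 = 0 := h3
        rw [h3] at h
        simpa [(ZMod.isUnit_iff_coprime n N).2 hc |>.mul_right_eq_zero] using h
  have h4 := (mass_mono h0 hsub).trans ((mass_union_le h0 _ _).trans
    (add_le_add_left (mass_union_le h0 _ _) _))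
  have h5 : mass μ ((shear (n : ZMod N)) ⁻¹' B) ≤ mass μ B + δ := by
    have hinv : ∑ x, |μ ((shear (n : ZMod N)).symm x) - μ x| ≤ δ := by
      rw [← Equiv.sum_comp (shear (n : ZMod N))]
      simp only [Equiv.symm_apply_apply]
      simpa only [abs_sub_comm] using hδ
    have := mass_le_mass_preimage_add hinv ((shear (n : ZMod N)) ⁻¹' B)
    have e : (shear (n : ZMod N)).symm ⁻¹' (shear (n : ZMod N) ⁻¹' B) = B :=
      Set.ext fun x => by rw [Set.mem_preimage, Set.mem_preimage, Equiv.apply_symm_apply]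
    rwa [e] at this
  have hK : (0 : ℝ) ≤ K := Nat.cast_nonneg K
  have h6 := mul_le_mul_of_nonneg_left (h4.trans (add_le_add_right h5 _)) hK
  have h7 := mul_le_mul_of_nonneg_left hD hK
  nlinarith

/-- The standard bilinear pairing on triples. -/
def triplePair {R : Type*} [CommRing R] (x t : R × R × R) : R :=
  x.1 * t.1 + x.2.1 * t.2.1 + x.2.2 * t.2.2

section Fourier

variable {N : ℕ} [NeZero N] {H : Type*} [NormedAddCommGroup H] [InnerProductSpace ℂ H]

/-- The discrete Fourier transform of a vector-valued function on triples. -/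
noncomputable def tripleDft (a : ZMod N × ZMod N × ZMod N → H) (t : ZMod N × ZMod N × ZMod N) :
    H :=
  ∑ x, ZMod.stdAddChar (-(triplePair x t)) • a x

theorem sum_stdAddChar_triplePair (x : ZMod N × ZMod N × ZMod N) :
    ∑ t, (ZMod.stdAddChar (triplePair x t) : ℂ) = if x = 0 then (N : ℂ) ^ 3 else 0 := by
  classical
  let χ : AddChar (ZMod N × ZMod N × ZMod N) ℂ :=
    { toFun := fun t => ZMod.stdAddChar (triplePair x t)
      map_zero_eq_one' := by simp [triplePair]
      map_add_eq_mul' := fun s t => by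
        rw [← AddChar.map_add_eq_mul]
        congr 1
        simp only [triplePair, Prod.fst_add, Prod.snd_add]
        ring }
  have h := AddChar.sum_eq_ite χ
  have hχ : χ = 0 ↔ x = 0 := by
    constructor
    · intro h0
      have key (t) : triplePair x t = 0 := by
        apply ZMod.injective_stdAddChar (N := N)
        rw [AddChar.map_zero_eq_one]
        exact DFunLike.congr_fun h0 t
      have h1 := key (1, 0, 0)
      have h2 := key (0, 1, 0)
      have h3 := key (0, 0, 1)
      simp only [triplePair, mul_one, mul_zero, add_zero, zero_add] at h1 h2 h3
      exact Prod.ext h1 (Prod.ext h2 h3)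
    · rintro rfl
      ext t
      simp [χ, triplePair]
  have hcard : (Fintype.card (ZMod N × ZMod N × ZMod N) : ℂ) = (N : ℂ) ^ 3 := by
    simp [Fintype.card_prod, ZMod.card]; ring
  rw [hcard] at h
  simp only [hχ] at h
  convert h using 1
  rfl

theorem sum_norm_tripleDft_sq (a : ZMod N × ZMod N × ZMod N → H) :
    ∑ t, ‖tripleDft a t‖ ^ 2 = (N : ℝ) ^ 3 * ∑ x, ‖a x‖ ^ 2 := by
  have key : ∑ t, inner ℂ (tripleDft a t) (tripleDft a t) =
      (N : ℂ) ^ 3 * ∑ x, inner ℂ (a x) (a x) := by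
    simp only [tripleDft, sum_inner, inner_sum, inner_smul_left, inner_smul_right]
    rw [Finset.sum_comm, Finset.mul_sum]
    refine Finset.sum_congr rfl fun x _ => ?_
    simp only [Finset.mul_sum]
    rw [Finset.sum_comm]
    have (y : ZMod N × ZMod N × ZMod N) : ∑ t, (ZMod.stdAddChar (-(triplePair x t)) : ℂ) *
        ((starRingEnd ℂ) (ZMod.stdAddChar (-(triplePair y t))) * inner ℂ (a y) (a x)) =
        (if y - x = 0 then (N : ℂ) ^ 3 else 0) * inner ℂ (a y) (a x) := by
      rw [← sum_stdAddChar_triplePair, Finset.sum_mul]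
      refine Finset.sum_congr rfl fun t _ => ?_
      rw [← AddChar.map_neg_eq_conj, neg_neg, ← mul_assoc, ← AddChar.map_add_eq_mul]
      congr 2
      have : -triplePair x t + triplePair y t = triplePair (y - x) t := by
        simp only [triplePair, Prod.fst_sub, Prod.snd_sub]
        ring
      rw [this]
    simp only [this, sub_eq_zero]
    simp
  have h2 (y : H) : inner ℂ y y = ((‖y‖ ^ 2 : ℝ) : ℂ) := by
    rw [inner_self_eq_norm_sq_to_K]; simp
  simp only [h2] at key
  exact_mod_cast key

variable {G : Type*} [Group G] (π : G →* (H ≃ₗᵢ[ℂ] H)) (v : ZMod N × ZMod N × ZMod N → G)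

/-- The isotypic components of a vector under an abelian group of unitary operators. -/
noncomputable def spectralPart (f : H) (t : ZMod N × ZMod N × ZMod N) : H :=
  ((N : ℂ) ^ 3)⁻¹ • tripleDft (fun x => π (v x) f) t

theorem sum_norm_spectralPart_sq (f : H) : ∑ t, ‖spectralPart π v f t‖ ^ 2 = ‖f‖ ^ 2 := by
  have hN : (N : ℝ) ≠ 0 := by exact_mod_cast NeZero.ne N
  simp only [spectralPart, norm_smul, mul_pow]
  rw [← Finset.mul_sum, sum_norm_tripleDft_sq]
  simp only [LinearIsometryEquiv.norm_map, Finset.sum_const, Finset.card_univ, nsmul_eq_mul,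
    Fintype.card_prod, ZMod.card, norm_inv, norm_pow, Complex.norm_natCast]
  push_cast
  field_simp

theorem spectralPart_sub (f g : H) (t : ZMod N × ZMod N × ZMod N) :
    spectralPart π v (f - g) t = spectralPart π v f t - spectralPart π v g t := by
  simp [spectralPart, tripleDft, smul_sub]

theorem spectralPart_translate (hv : ∀ x y, v (x + y) = v x * v y) (f : H)
    (y t : ZMod N × ZMod N × ZMod N) :
    spectralPart π v (π (v y) f) t = ZMod.stdAddChar (triplePair y t) • spectralPart π v f t := by
  rw [spectralPart, spectralPart, smul_comm]
  congr 1
  rw [tripleDft, tripleDft, Finset.smul_sum, ← Equiv.sum_comp (Equiv.addRight y) fun x =>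
    (ZMod.stdAddChar (triplePair y t) : ℂ) • ZMod.stdAddChar (-(triplePair x t)) • π (v x) f]
  refine Finset.sum_congr rfl fun x _ => ?_
  rw [smul_smul, ← AddChar.map_add_eq_mul, Equiv.coe_addRight, hv, map_mul]
  congr 2
  simp only [triplePair, Prod.fst_add, Prod.snd_add]
  ring

theorem norm_spectralPart_intertwine (A B : Equiv.Perm (ZMod N × ZMod N × ZMod N)) (u : G)
    (hu : ∀ x, u * v x = v (A x) * u) (hAB : ∀ x t, triplePair (A x) t = triplePair x (B t))
    (f : H) (t : ZMod N × ZMod N × ZMod N) :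
    ‖spectralPart π v (π u f) t‖ = ‖spectralPart π v f (B t)‖ := by
  have : spectralPart π v (π u f) t = π u (spectralPart π v f (B t)) := by
    rw [spectralPart, spectralPart, map_smul]
    congr 1
    rw [tripleDft, tripleDft, map_sum, ← Equiv.sum_comp A]
    refine Finset.sum_congr rfl fun x _ => ?_
    rw [map_smul, hAB]
    congr 1
    have := congrArg (fun g => π g f) (hu x)
    simp only [map_mul, LinearIsometryEquiv.coe_mul, Function.comp_apply] at this
    exact this.symm
  rw [this, LinearIsometryEquiv.norm_map]

theorem norm_translate_sub_sq (hv : ∀ x y, v (x + y) = v x * v y) (f : H)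
    (y : ZMod N × ZMod N × ZMod N) :
    ‖π (v y) f - f‖ ^ 2 = ∑ t, ‖(ZMod.stdAddChar (triplePair y t) : ℂ) - 1‖ ^ 2 *
      ‖spectralPart π v f t‖ ^ 2 := by
  rw [← sum_norm_spectralPart_sq π v]
  refine Finset.sum_congr rfl fun t _ => ?_
  rw [spectralPart_sub, spectralPart_translate π v hv, ← mul_pow, ← norm_smul, sub_smul, one_smul]

theorem sum_abs_norm_spectralPart_sub_le (f g : H) :
    ∑ t, |‖spectralPart π v f t‖ ^ 2 - ‖spectralPart π v g t‖ ^ 2| ≤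
      ‖f - g‖ * (‖f‖ + ‖g‖) := by
  have cs (a b : H) : ∑ t, ‖spectralPart π v a t‖ * ‖spectralPart π v b t‖ ≤ ‖a‖ * ‖b‖ := by
    refine abs_le_of_sq_le_sq' ?_ (by positivity) |>.2
    refine (Finset.sum_mul_sq_le_sq_mul_sq _ _ _).trans ?_
    rw [sum_norm_spectralPart_sq, sum_norm_spectralPart_sq, mul_pow]
  calc _ ≤ ∑ t, (‖spectralPart π v (f - g) t‖ * ‖spectralPart π v f t‖ +
        ‖spectralPart π v (f - g) t‖ * ‖spectralPart π v g t‖) := by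
        refine Finset.sum_le_sum fun t _ => ?_
        rw [sq_sub_sq, abs_mul, ← mul_add, mul_comm, spectralPart_sub,
          abs_of_nonneg (by positivity : (0 : ℝ) ≤
            ‖spectralPart π v f t‖ + ‖spectralPart π v g t‖)]
        gcongr
        exact abs_norm_sub_norm_le _ _
    _ ≤ _ := by
        rw [Finset.sum_add_distrib, mul_add]
        exact add_le_add (cs _ _) (cs _ _)

theorem four_le_mul_norm_stdAddChar_sub_one (z : ZMod N) {C : ℝ} (hC : 0 < C)
    (h : (N : ℝ) ≤ C * |(z.valMinAbs : ℝ)|) : 4 ≤ C * ‖(ZMod.stdAddChar z : ℂ) - 1‖ := by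
  have hN : (0 : ℝ) < N := by exact_mod_cast NeZero.pos N
  have e : (ZMod.stdAddChar z : ℂ) =
      Complex.exp (Complex.I * ((2 * Real.pi * (z.valMinAbs / N) : ℝ) : ℂ)) := by
    conv_lhs => rw [← ZMod.coe_valMinAbs z, ZMod.stdAddChar_coe]
    congr 1
    push_cast
    ring
  have hle : |(z.valMinAbs : ℝ) / N| ≤ 1 / 2 := by
    have := ZMod.valMinAbs_mem_Ioc z
    have h1 : -(N : ℝ) < z.valMinAbs * 2 := by exact_mod_cast this.1
    have h2 : (z.valMinAbs * 2 : ℝ) ≤ N := by exact_mod_cast this.2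
    rw [abs_le]
    constructor
    · rw [le_div_iff₀ hN]; linarith
    · rw [div_le_iff₀ hN]; linarith
  have hpi := Real.pi_pos
  have hsin := Real.mul_abs_le_abs_sin (x := Real.pi * (z.valMinAbs / N)) (by
    rw [abs_mul, abs_of_pos hpi]
    nlinarith)
  rw [abs_mul, abs_of_pos hpi, abs_div, abs_of_pos hN] at hsin
  rw [e, Complex.norm_exp_I_mul_ofReal_sub_one]
  have e2 : 2 * Real.pi * ((z.valMinAbs : ℝ) / N) / 2 = Real.pi * (z.valMinAbs / N) := by ring
  rw [e2, norm_mul, Real.norm_eq_abs, Real.norm_eq_abs, abs_two]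
  have e3 : 2 / Real.pi * (Real.pi * (|(z.valMinAbs : ℝ)| / N)) =
      2 * (|(z.valMinAbs : ℝ)| / N) := by
    field_simp
  rw [e3] at hsin
  have h1 : 1 ≤ C * (|(z.valMinAbs : ℝ)| / N) := by
    rw [← mul_div_assoc, le_div_iff₀ hN]; linarith
  nlinarith

/-- The adjoint of `shear` with respect to `triplePair`. -/
@[simps]
def dualShear {R : Type*} [CommRing R] (n : R) : Equiv.Perm (R × R × R) where
  toFun x := (x.1 + 2 * n * x.2.1 + n ^ 2 * x.2.2, x.2.1 + n * x.2.2, x.2.2)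
  invFun x := (x.1 - 2 * n * x.2.1 + n ^ 2 * x.2.2, x.2.1 - n * x.2.2, x.2.2)
  left_inv x := by ext <;> simp; ring
  right_inv x := by ext <;> simp; ring

theorem mass_compl_nearZero_le (hv : ∀ x y, v (x + y) = v x * v y) (f : H) (n : ℕ) (C : ℤ)
    (hC : 0 < C) {ε : ℝ}
    (h1 : ‖π (v (n, 0, 0)) f - f‖ ≤ ε * ‖f‖) (h2 : ‖π (v (0, n, 0)) f - f‖ ≤ ε * ‖f‖)
    (h3 : ‖π (v (0, 0, n)) f - f‖ ≤ ε * ‖f‖) :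
    mass (fun t => ‖spectralPart π v f t‖ ^ 2) (nearZero N n C)ᶜ ≤
      3 * C ^ 2 * ε ^ 2 * ‖f‖ ^ 2 := by
  have hC' : (0 : ℝ) < C := by exact_mod_cast hC
  have h1' := pow_le_pow_left₀ (norm_nonneg _) h1 2
  have h2' := pow_le_pow_left₀ (norm_nonneg _) h2 2
  have h3' := pow_le_pow_left₀ (norm_nonneg _) h3 2
  rw [norm_translate_sub_sq π v hv] at h1' h2' h3'
  have key : mass (fun t => ‖spectralPart π v f t‖ ^ 2) (nearZero N n C)ᶜ ≤
      (C : ℝ) ^ 2 * (∑ t, ‖(ZMod.stdAddChar (triplePair ((n : ZMod N), 0, 0) t) : ℂ) - 1‖ ^ 2 *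
        ‖spectralPart π v f t‖ ^ 2 +
      ∑ t, ‖(ZMod.stdAddChar (triplePair (0, (n : ZMod N), 0) t) : ℂ) - 1‖ ^ 2 *
        ‖spectralPart π v f t‖ ^ 2 +
      ∑ t, ‖(ZMod.stdAddChar (triplePair (0, 0, (n : ZMod N)) t) : ℂ) - 1‖ ^ 2 *
        ‖spectralPart π v f t‖ ^ 2) := by
    rw [mass, ← Finset.sum_add_distrib, ← Finset.sum_add_distrib, Finset.mul_sum]
    refine Finset.sum_le_sum fun t _ => ?_
    rw [← add_mul, ← add_mul, ← mul_assoc]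
    set s := ‖spectralPart π v f t‖ ^ 2 with hs
    have hs0 : 0 ≤ s := by positivity
    by_cases ht : t ∈ (nearZero N n C)ᶜ
    · rw [Set.indicator_of_mem ht]
      refine le_mul_of_one_le_left hs0 ?_
      simp only [triplePair, zero_mul, add_zero, zero_add]
      set A1 := ‖(ZMod.stdAddChar ((n : ZMod N) * t.1) : ℂ) - 1‖ with hA1
      set A2 := ‖(ZMod.stdAddChar ((n : ZMod N) * t.2.1) : ℂ) - 1‖ with hA2
      set A3 := ‖(ZMod.stdAddChar ((n : ZMod N) * t.2.2) : ℂ) - 1‖ with hA3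
      have aux (z : ZMod N) (hz : ¬ C * |z.valMinAbs| < N) :
          1 ≤ (C : ℝ) ^ 2 * ‖(ZMod.stdAddChar z : ℂ) - 1‖ ^ 2 := by
        have : (N : ℝ) ≤ C * |(z.valMinAbs : ℝ)| := by exact_mod_cast not_lt.1 hz
        have := four_le_mul_norm_stdAddChar_sub_one z hC' this
        nlinarith
      have p1 : 0 ≤ (C : ℝ) ^ 2 * A1 ^ 2 := by positivity
      have p2 : 0 ≤ (C : ℝ) ^ 2 * A2 ^ 2 := by positivity
      have p3 : 0 ≤ (C : ℝ) ^ 2 * A3 ^ 2 := by positivity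
      simp only [nearZero, Set.mem_compl_iff, Set.mem_ofPred_eq, not_and_or] at ht
      rcases ht with ht | ht | ht
      · have := aux _ ht
        linarith
      · have := aux _ ht
        linarith
      · have := aux _ ht
        linarith
    · rw [Set.indicator_of_notMem ht]
      positivity
  refine key.trans ?_
  have : (0 : ℝ) ≤ (C : ℝ) ^ 2 := by positivity
  nlinarith

/-- Uniform relative property (T) for binary quadratic forms modulo `N`: a vector almost invariant
under two opposite unipotent matrices and three translations is almost invariant under all
translations. -/
theorem exists_relative_property_T (n : ℕ) (hn : 2 ≤ n) {η : ℝ} (hη : 0 < η) :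
    ∃ ε : ℝ, 0 < ε ∧ ∀ (N : ℕ) [NeZero N], n.Coprime N →
      ∀ {G : Type*} [Group G] {H : Type*} [NormedAddCommGroup H] [InnerProductSpace ℂ H]
        (π : G →* (H ≃ₗᵢ[ℂ] H)) (v : ZMod N × ZMod N × ZMod N → G) (u l : G) (f : H),
        (∀ x y, v (x + y) = v x * v y) →
        (∀ x, u * v x = v (dualShear (n : ZMod N) x) * u) →
        (∀ x, l * v x = v (flipForm (dualShear (n : ZMod N) (flipForm x))) * l) →
        ‖π u f - f‖ ≤ ε * ‖f‖ → ‖π l f - f‖ ≤ ε * ‖f‖ →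
        ‖π (v (n, 0, 0)) f - f‖ ≤ ε * ‖f‖ → ‖π (v (0, n, 0)) f - f‖ ≤ ε * ‖f‖ →
        ‖π (v (0, 0, n)) f - f‖ ≤ ε * ‖f‖ →
        ∀ x, ‖π (v x) f - f‖ ≤ η * ‖f‖ := by
  obtain ⟨K, hK⟩ := exists_nat_gt (48 / η ^ 2)
  have hη2 : 0 < η ^ 2 := by positivity
  have hK0 : (0 : ℝ) < K := lt_trans (by positivity) hK
  set C : ℤ := 2 * (1 + n * K + (n * K) ^ 2) with hC
  have hC0 : 0 < C := by positivity
  set Q : ℝ := 8 * (4 + 3 * K) * (2 + 3 * C ^ 2) with hQ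
  have hQ0 : 0 < Q := by positivity
  refine ⟨min 1 (η ^ 2 / Q), lt_min one_pos (by positivity), ?_⟩
  set ε := min 1 (η ^ 2 / Q) with hε
  have hε0 : 0 < ε := lt_min one_pos (by positivity)
  have hε1 : ε ≤ 1 := min_le_left _ _
  have hεQ : ε * Q ≤ η ^ 2 := by
    rw [← le_div_iff₀ hQ0]; exact min_le_right _ _
  intro N _ hc G _ H _ _ π v u l f hv hu hl huf hlf h1 h2 h3 x
  set μ : ZMod N × ZMod N × ZMod N → ℝ := fun t => ‖spectralPart π v f t‖ ^ 2 with hμ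
  have hf0 := norm_nonneg f
  have hD := mass_compl_nearZero_le π v hv f n C hC0 h1 h2 h3
  set δ : ℝ := (2 * ε + 3 * C ^ 2 * ε ^ 2) * ‖f‖ ^ 2 with hδ
  have near (w : G) (A B : Equiv.Perm (ZMod N × ZMod N × ZMod N))
      (hw : ∀ x, w * v x = v (A x) * w)
      (hAB : ∀ x t, triplePair (A x) t = triplePair x (B t)) (hwf : ‖π w f - f‖ ≤ ε * ‖f‖) :
      ∑ t, |μ (B t) - μ t| ≤ δ := by
    have := sum_abs_norm_spectralPart_sub_le π v (π w f) f
    simp only [norm_spectralPart_intertwine π v A B w hw hAB, LinearIsometryEquiv.norm_map] at this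
    refine this.trans ?_
    have h4 := mul_le_mul_of_nonneg_right hwf (by positivity : 0 ≤ ‖f‖ + ‖f‖)
    have h5 : (0 : ℝ) ≤ 3 * C ^ 2 * ε ^ 2 * ‖f‖ ^ 2 := by positivity
    rw [hδ]
    nlinarith
  have hmain := mass_ne_zero_le hn hc K μ (fun t => by positivity) (δ := δ)
    (near u _ (shear (n : ZMod N)) hu (fun x t => by simp [triplePair]; ring) huf)
    (near l (flipForm.trans ((dualShear (n : ZMod N)).trans flipForm))
      (flipForm.trans ((shear (n : ZMod N)).trans flipForm)) hl
      (fun x t => by simp [triplePair]; ring) hlf)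
    (hD.trans (by
      rw [hδ, add_mul]
      have : 0 ≤ 2 * ε * ‖f‖ ^ 2 := by positivity
      linarith))
  rw [hμ, sum_norm_spectralPart_sq, ← hμ] at hmain
  have hle : ‖π (v x) f - f‖ ^ 2 ≤ 4 * mass μ {t | t ≠ 0} := by
    rw [norm_translate_sub_sq π v hv, mass, Finset.mul_sum]
    refine Finset.sum_le_sum fun t _ => ?_
    by_cases ht : t = 0
    · simp [ht, triplePair]
    · rw [Set.indicator_of_mem (by exact ht)]
      have : ‖(ZMod.stdAddChar (triplePair x t) : ℂ) - 1‖ ≤ 2 := by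
        refine (norm_sub_le _ _).trans ?_
        rw [AddChar.norm_apply, norm_one]
        norm_num
      have := pow_le_pow_left₀ (norm_nonneg _) this 2
      exact mul_le_mul_of_nonneg_right (by linarith) (by positivity)
  have hδ1 : δ * (8 * (4 + 3 * K)) ≤ η ^ 2 * ‖f‖ ^ 2 := by
    have : 2 * ε + 3 * C ^ 2 * ε ^ 2 ≤ (2 + 3 * C ^ 2) * ε := by
      have : ε ^ 2 ≤ ε := by nlinarith
      have : 3 * (C : ℝ) ^ 2 * ε ^ 2 ≤ 3 * C ^ 2 * ε :=
        mul_le_mul_of_nonneg_left this (by positivity)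
      linarith
    calc δ * (8 * (4 + 3 * K)) ≤ (2 + 3 * C ^ 2) * ε * ‖f‖ ^ 2 * (8 * (4 + 3 * K)) := by
          rw [hδ]; gcongr
      _ = ε * Q * ‖f‖ ^ 2 := by rw [hQ]; ring
      _ ≤ _ := by gcongr
  have hK2 : 48 ≤ η ^ 2 * K := by
    rw [div_lt_iff₀ hη2] at hK; linarith
  have hfin : ‖π (v x) f - f‖ ^ 2 ≤ (η * ‖f‖) ^ 2 := by
    have hA : K * (4 * mass μ {t | t ≠ 0}) ≤ K * (η ^ 2 * ‖f‖ ^ 2) := by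
      have := mul_le_mul_of_nonneg_right hK2 (by positivity : 0 ≤ ‖f‖ ^ 2)
      have := mul_le_mul_of_nonneg_left hδ1 hK0.le
      linarith
    rw [mul_pow]
    exact hle.trans (le_of_mul_le_mul_left hA hK0)
  exact abs_le_of_sq_le_sq' hfin (by positivity) |>.2

end Fourier

namespace SymplecticGroup

section Elementary

open Matrix Pointwise

theorem isSymm_conj {l R : Type*} [Fintype l] [CommRing R] {S : Matrix l l R} (hS : S.IsSymm)
    (a : Matrix l l R) : (a * S * aᵀ).IsSymm := by
  rw [IsSymm, transpose_mul, transpose_mul, transpose_transpose, hS.eq, mul_assoc]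

variable {l : Type*} [Fintype l] [DecidableEq l] {R : Type*} [CommRing R]

/-- The upper unipotent element attached to a symmetric matrix. -/
def upper (S : Matrix l l R) (hS : S.IsSymm) : symplecticGroup l R :=
  ⟨fromBlocks 1 S 0 1, fromBlocks_mem_iff.2 ⟨by simp, by simp [hS.eq], by simp⟩⟩

/-- The lower unipotent element attached to a symmetric matrix. -/
def lower (S : Matrix l l R) (hS : S.IsSymm) : symplecticGroup l R :=
  ⟨fromBlocks 1 0 S 1, fromBlocks_mem_iff.2 ⟨by simp [hS.eq], by simp, by simp⟩⟩

/-- The embedding of the general linear group as the Levi factor of the Siegel parabolic. -/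
def levi : (Matrix l l R)ˣ →* symplecticGroup l R where
  toFun a := ⟨fromBlocks a 0 0 (a⁻¹).valᵀ,
    fromBlocks_mem_iff.2 ⟨by simp, by simp, by simp [← transpose_mul]⟩⟩
  map_one' := by ext1; simp
  map_mul' a b := by ext1; simp [fromBlocks_multiply, transpose_mul]

@[simp]
theorem coe_upper (S : Matrix l l R) (hS : S.IsSymm) :
    (upper S hS : Matrix (l ⊕ l) (l ⊕ l) R) = fromBlocks 1 S 0 1 := rfl

@[simp]
theorem coe_lower (S : Matrix l l R) (hS : S.IsSymm) :
    (lower S hS : Matrix (l ⊕ l) (l ⊕ l) R) = fromBlocks 1 0 S 1 := rfl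

@[simp]
theorem coe_levi (a : (Matrix l l R)ˣ) : (levi a : Matrix (l ⊕ l) (l ⊕ l) R) =
    fromBlocks a 0 0 (a⁻¹).valᵀ := rfl

theorem upper_mul (S T : Matrix l l R) (hS : S.IsSymm) (hT : T.IsSymm) :
    upper S hS * upper T hT = upper (S + T) (hS.add hT) := by
  ext1; simp [fromBlocks_multiply, add_comm]

theorem lower_mul (S T : Matrix l l R) (hS : S.IsSymm) (hT : T.IsSymm) :
    lower S hS * lower T hT = lower (S + T) (hS.add hT) := by
  ext1; simp [fromBlocks_multiply]

theorem upper_zero : upper (0 : Matrix l l R) isSymm_zero = 1 := by ext1; simp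

theorem lower_zero : lower (0 : Matrix l l R) isSymm_zero = 1 := by ext1; simp

theorem upper_inv (S : Matrix l l R) (hS : S.IsSymm) : (upper S hS)⁻¹ = upper (-S) hS.neg := by
  rw [inv_eq_iff_mul_eq_one, upper_mul]
  simp only [add_neg_cancel, upper_zero]

theorem lower_inv (S : Matrix l l R) (hS : S.IsSymm) : (lower S hS)⁻¹ = lower (-S) hS.neg := by
  rw [inv_eq_iff_mul_eq_one, lower_mul]
  simp only [add_neg_cancel, lower_zero]

theorem levi_mul_upper (a : (Matrix l l R)ˣ) (S : Matrix l l R) (hS : S.IsSymm) :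
    levi a * upper S hS = upper (a.val * S * a.valᵀ) (isSymm_conj hS _) * levi a := by
  ext1
  simp [fromBlocks_multiply, mul_assoc, ← transpose_mul]

theorem levi_inv_mul_lower (a : (Matrix l l R)ˣ) (S : Matrix l l R) (hS : S.IsSymm) :
    levi a⁻¹ * lower S hS =
      lower (a.valᵀ * S * a.val)
        (by simpa using isSymm_conj hS a.valᵀ) * levi a⁻¹ := by
  ext1
  simp only [Submonoid.coe_mul, coe_levi, coe_lower, fromBlocks_multiply, inv_inv]
  simp [mul_assoc]

variable (l R) in
/-- The set of upper and lower unipotent elements. -/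
def elementarySet : Set (symplecticGroup l R) :=
  {g | ∃ (S : Matrix l l R) (hS : S.IsSymm), g = upper S hS ∨ g = lower S hS}

theorem upper_mem (S : Matrix l l R) (hS : S.IsSymm) : upper S hS ∈ elementarySet l R :=
  ⟨S, hS, Or.inl rfl⟩

theorem lower_mem (S : Matrix l l R) (hS : S.IsSymm) : lower S hS ∈ elementarySet l R :=
  ⟨S, hS, Or.inr rfl⟩

theorem exists_eq_lower_mul_levi_mul_upper (g : symplecticGroup l R) (a : (Matrix l l R)ˣ)
    (ha : (g : Matrix (l ⊕ l) (l ⊕ l) R).toBlocks₁₁ = a) :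
    ∃ (S T : Matrix l l R) (hS : S.IsSymm) (hT : T.IsSymm),
      g = lower S hS * levi a * upper T hT := by
  obtain ⟨A, B, C, D, hg⟩ : ∃ A B C D, (g : Matrix (l ⊕ l) (l ⊕ l) R) = fromBlocks A B C D :=
    ⟨_, _, _, _, (fromBlocks_toBlocks _).symm⟩
  have hmem := g.2
  rw [hg] at hmem ha
  rw [toBlocks_fromBlocks₁₁] at ha
  subst ha
  obtain ⟨h1, -, -⟩ := fromBlocks_mem_iff.1 hmem
  have hS : (C * (a⁻¹).val).IsSymm := by
    have h2 : (C * (a⁻¹).val) =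
        (a⁻¹).valᵀ * a.valᵀ * C *
          (a⁻¹).val := by
      rw [← transpose_mul]; simp
    rw [IsSymm]
    nth_rw 2 [h2]
    rw [mul_assoc _ _ C, h1, transpose_mul]
    simp [mul_assoc]
  set g' := levi a⁻¹ * (lower _ hS)⁻¹ * g with hg'
  have hg'' : (g' : Matrix (l ⊕ l) (l ⊕ l) R) = fromBlocks 1 ((a⁻¹).val * B) 0
      (a.valᵀ * (D - C * (a⁻¹).val * B)) := by
    rw [hg', lower_inv]
    simp only [Submonoid.coe_mul, coe_levi, coe_lower, hg, fromBlocks_multiply]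
    simp [mul_sub, mul_assoc]
    abel
  have hmem' := g'.2
  rw [hg''] at hmem'
  obtain ⟨-, h4, h5⟩ := fromBlocks_mem_iff.1 hmem'
  simp only [transpose_one, one_mul, transpose_zero, zero_mul, sub_zero] at h5
  rw [h5, transpose_one, mul_one, one_mul] at h4
  change IsSymm _ at h4
  refine ⟨_, _, hS, h4, ?_⟩
  have : g' = upper _ h4 := by ext1; rw [hg'', h5, coe_upper]
  rw [← this, hg']
  simp [mul_assoc]

theorem levi_mem_of_eq_one_add_mul (a : (Matrix l l R)ˣ) (s t : Matrix l l R) (hs : s.IsSymm)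
    (ht : t.IsSymm) (ha : a.val = 1 + s * t) :
    levi a ∈ elementarySet l R ^ 4 := by
  obtain ⟨S, T, hS, hT, h⟩ := exists_eq_lower_mul_levi_mul_upper (upper s hs * lower t ht) a
    (by simp [fromBlocks_multiply, ha])
  have : levi a = (lower S hS)⁻¹ * upper s hs * lower t ht * (upper T hT)⁻¹ := by
    rw [mul_assoc _ (upper s hs), h]; simp [mul_assoc]
  rw [this, lower_inv, upper_inv, show (4 : ℕ) = 1 + 1 + 1 + 1 from rfl, pow_succ, pow_succ,
    pow_succ, pow_one]
  exact Set.mul_mem_mul (Set.mul_mem_mul (Set.mul_mem_mul (lower_mem _ _) (upper_mem _ _))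
    (lower_mem _ _)) (upper_mem _ _)

end Elementary

section BoundedGeneration

open Matrix Pointwise

variable {l : Type*} [Fintype l] [DecidableEq l] {F : Type*} [Field F]

theorem exists_isSymm_mul_eq_vecMulVec_single (x : l → F) (k : l) :
    ∃ s t : Matrix l l F, s.IsSymm ∧ t.IsSymm ∧ s * t = vecMulVec x (Pi.single k 1) := by
  by_cases hx : x = 0
  · exact ⟨0, 0, isSymm_zero, isSymm_zero, by simp [hx]⟩
  have hsymm (c : F) : (c • vecMulVec x x).IsSymm := by
    rw [IsSymm, transpose_smul, transpose_vecMulVec]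
  by_cases hk : x k = 0
  · obtain ⟨i, hi⟩ := Function.ne_iff.1 hx
    have hi : x i ≠ 0 := hi
    refine ⟨(x i)⁻¹ • vecMulVec x x, vecMulVec (Pi.single i 1) (Pi.single k 1) +
      vecMulVec (Pi.single k 1) (Pi.single i 1), hsymm _, ?_, ?_⟩
    · rw [IsSymm, transpose_add, transpose_vecMulVec, transpose_vecMulVec, add_comm]
    · rw [mul_add, smul_mul, smul_mul, vecMulVec_mul_vecMulVec, vecMulVec_mul_vecMulVec]
      simp [hk, smul_smul, hi]
  · refine ⟨(x k)⁻¹ • vecMulVec x x, vecMulVec (Pi.single k 1) (Pi.single k 1), hsymm _, ?_, ?_⟩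
    · rw [IsSymm, transpose_vecMulVec]
    · rw [smul_mul, vecMulVec_mul_vecMulVec]
      simp [smul_smul, hk]

/-- Invertible matrices differing from the identity in a single column. -/
def columnOps : Set (Matrix l l F)ˣ :=
  {a | ∃ (x : l → F) (k : l), (a : Matrix l l F) = 1 + vecMulVec x (Pi.single k 1)}

theorem levi_mem_of_mem_columnOps {a : (Matrix l l F)ˣ} (ha : a ∈ columnOps) :
    levi a ∈ elementarySet l F ^ 4 := by
  obtain ⟨x, k, h⟩ := ha
  obtain ⟨s, t, hs, ht, hst⟩ := exists_isSymm_mul_eq_vecMulVec_single x k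
  exact levi_mem_of_eq_one_add_mul a s t hs ht (by rw [h, hst])

theorem exists_columnOp (x : l → F) (k : l) (hx : 1 + x k ≠ 0) :
    ∃ a : (Matrix l l F)ˣ, (a : Matrix l l F) = 1 + vecMulVec x (Pi.single k 1) ∧
      a⁻¹ ∈ columnOps := by
  let y : l → F := -(1 + x k)⁻¹ • x
  have h (u v : l → F) (huv : u + v + v k • u = 0) :
      (1 + vecMulVec u (Pi.single k 1)) * (1 + vecMulVec v (Pi.single k 1)) = 1 := by
    rw [mul_add, add_mul, add_mul, vecMulVec_mul_vecMulVec]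
    simp only [mul_one, one_mul, single_dotProduct]
    rw [vecMulVec_smul, ← smul_vecMulVec, add_assoc, ← add_vecMulVec, ← add_vecMulVec]
    rw [show u + (v + v k • u) = 0 by rw [← huv]; abel]
    simp
  refine ⟨⟨1 + vecMulVec x (Pi.single k 1), 1 + vecMulVec y (Pi.single k 1), h _ _ ?_, h _ _ ?_⟩,
    rfl, y, k, rfl⟩
  · ext i; simp [y]; field_simp; ring
  · ext i; simp [y]; field_simp; ring

theorem exists_mem_columnOps_pow (a : (Matrix l l F)ˣ) (s : Finset l) :
    ∃ b : (Matrix l l F)ˣ, b⁻¹ ∈ (columnOps : Set (Matrix l l F)ˣ) ^ (2 * s.card) ∧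
      ∀ j ∈ s, (b.val * a.val) *ᵥ Pi.single j 1 = Pi.single j 1 := by
  induction s using Finset.induction_on with
  | empty => exact ⟨1, by simp, by simp⟩
  | insert k s hk ih =>
    obtain ⟨b, hb, hs⟩ := ih
    set y := (b.val * a.val) *ᵥ Pi.single k 1 with hy
    -- some entry of `y` outside `s` is nonzero
    have hex : ∃ i ∉ s, y i ≠ 0 := by
      by_contra! hcon
      have h0 : (b.val * a.val) *ᵥ (Pi.single k 1 - ∑ j ∈ s, y j • Pi.single j 1) = 0 := by
        rw [mulVec_sub, mulVec_sum, ← hy, sub_eq_zero]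
        ext i
        rw [Finset.sum_apply, Finset.sum_congr rfl fun j hj => by rw [mulVec_smul, hs j hj]]
        by_cases hi : i ∈ s
        · simp [Pi.single_apply, hi]
        · simp [Pi.single_apply, hi, hcon i hi]
      have h1 := (mulVec_injective_iff_isUnit.2 (b * a).isUnit)
        (h0.trans (mulVec_zero _).symm)
      have := congrFun h1 k
      simp [Finset.sum_apply, Pi.single_apply, hk] at this
    -- one operation makes the diagonal entry nonzero, a second one clears the column
    obtain ⟨c, hc, hck, hcs⟩ : ∃ c : (Matrix l l F)ˣ, c⁻¹ ∈ columnOps ∧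
        (c.val *ᵥ y) k ≠ 0 ∧
        ∀ j ∈ s, c.val *ᵥ Pi.single j 1 = Pi.single j 1 := by
      by_cases hyk : y k = 0
      · obtain ⟨i, his, hi⟩ := hex
        have hik : i ≠ k := by rintro rfl; exact hi hyk
        obtain ⟨c, hc, hc'⟩ := exists_columnOp (Pi.single k (1 : F)) i (by simp [hik])
        refine ⟨c, hc', ?_, fun j hj => ?_⟩
        · rw [hc, add_mulVec, one_mulVec, vecMulVec_mulVec]
          simp [hyk, hi]
        · have : i ≠ j := by rintro rfl; exact his hj
          rw [hc, add_mulVec, one_mulVec, vecMulVec_mulVec]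
          simp [this]
      · exact ⟨1, ⟨0, k, by simp⟩, by simpa using hyk, fun j _ => by rw [Units.val_one, one_mulVec]⟩
    set z := c.val *ᵥ y with hz
    obtain ⟨d, hd, hd'⟩ := exists_columnOp ((z k)⁻¹ • (Pi.single k 1 - z)) k (by
      simp [mul_sub, hck])
    refine ⟨d * c * b, ?_, ?_⟩
    · rw [Finset.card_insert_of_notMem hk, _root_.mul_inv_rev, _root_.mul_inv_rev,
        ← mul_assoc, mul_add,
        mul_one, pow_add, pow_two]
      rw [mul_assoc]
      exact Set.mul_mem_mul hb (Set.mul_mem_mul hc hd')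
    · intro j hj
      have hcol (v : l → F) : ((d * c * b).val * a.val) *ᵥ v =
          d.val *ᵥ (c.val *ᵥ ((b.val * a.val) *ᵥ v)) := by
        simp [mul_assoc]
      rw [hcol]
      rcases Finset.mem_insert.1 hj with rfl | hj
      · rw [← hy, ← hz, hd, add_mulVec, one_mulVec, vecMulVec_mulVec]
        simp [hck, smul_smul]
      · have : k ≠ j := by rintro rfl; exact hk hj
        rw [hs j hj, hcs j hj, hd, add_mulVec, one_mulVec, vecMulVec_mulVec]
        simp [this]

theorem levi_mem (a : (Matrix l l F)ˣ) :
    levi a ∈ elementarySet l F ^ (4 * (2 * Fintype.card l)) := by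
  obtain ⟨b, hb, h⟩ := exists_mem_columnOps_pow a Finset.univ
  have hba : b⁻¹ = a := by
    rw [inv_eq_iff_mul_eq_one]
    ext i j
    have := congrFun (h j (Finset.mem_univ _)) i
    simpa [Pi.single_apply, one_apply] using this
  have key (n : ℕ) (c : (Matrix l l F)ˣ) (hc : c ∈ (columnOps : Set (Matrix l l F)ˣ) ^ n) :
      levi c ∈ elementarySet l F ^ (4 * n) := by
    induction n generalizing c with
    | zero => simp only [pow_zero, Set.mem_one] at hc; simp [hc]
    | succ n ih =>
      rw [pow_succ] at hc
      obtain ⟨c₁, h₁, c₂, h₂, rfl⟩ := hc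
      rw [map_mul, mul_add, mul_one, pow_add]
      exact Set.mul_mem_mul (ih _ h₁) (levi_mem_of_mem_columnOps h₂)
  rw [hba] at hb
  exact key _ _ hb

theorem exists_isSymm_isUnit_add_mul {A C : Matrix l l F} (hAC : Aᵀ * C = Cᵀ * A)
    (hker : ∀ x, A *ᵥ x = 0 → C *ᵥ x = 0 → x = 0) :
    ∃ S : Matrix l l F, S.IsSymm ∧ IsUnit (A + S * C) := by
  obtain ⟨K, ⟨S, hS, hK⟩, hmin⟩ := IsArtinian.set_has_minimal
    {K : Submodule F (l → F) | ∃ S : Matrix l l F, S.IsSymm ∧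
      K = LinearMap.ker (A + S * C).mulVecLin}
    ⟨_, 0, isSymm_zero, rfl⟩
  refine ⟨S, hS, mulVec_injective_iff_isUnit.1 ?_⟩
  rw [← coe_mulVecLin, ← LinearMap.ker_eq_bot, Submodule.eq_bot_iff]
  by_contra! ⟨x, hx, hx0⟩
  set B := A + S * C with hB
  have hBC : Bᵀ * C = Cᵀ * B := by
    rw [hB, transpose_add, transpose_mul, hS.eq, add_mul, mul_add, hAC, mul_assoc]
  have hx : B *ᵥ x = 0 := hx
  have hy : C *ᵥ x ≠ 0 := by
    intro h
    refine hx0 (hker x ?_ h)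
    simpa [hB, add_mulVec, ← mulVec_mulVec, h] using hx
  obtain ⟨i, hi⟩ := Function.ne_iff.1 hy
  have hi : (C *ᵥ x) i ≠ 0 := hi
  set z : l → F := Pi.single i 1 with hz
  have hsz : (vecMulVec z z).IsSymm := by rw [IsSymm, transpose_vecMulVec]
  have happ (w : l → F) : (A + (S + vecMulVec z z) * C) *ᵥ w = B *ᵥ w + (C *ᵥ w) i • z := by
    rw [add_mul, ← add_assoc, add_mulVec, ← mulVec_mulVec _ (vecMulVec z z), vecMulVec_mulVec]
    simp [hz, hB]
  refine hmin (LinearMap.ker (A + (S + vecMulVec z z) * C).mulVecLin) ⟨_, hS.add hsz, rfl⟩ ?_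
  rw [hK]
  refine lt_of_le_of_ne (fun w hw => ?_) fun heq => ?_
  · have hw : B *ᵥ w + (C *ᵥ w) i • z = 0 := by rw [← happ]; exact hw
    have h1 : (C *ᵥ x) ⬝ᵥ (B *ᵥ w) = 0 := by
      rw [dotProduct_mulVec, vecMul_mulVec, ← hBC, ← vecMul_vecMul, vecMul_transpose, hx,
        zero_vecMul,
        zero_dotProduct]
    have h2 := congrArg (fun u => (C *ᵥ x) ⬝ᵥ u) hw
    simp only [dotProduct_add, h1, dotProduct_smul, zero_add, dotProduct_zero, hz] at h2
    have h3 : (C *ᵥ w) i = 0 := by simpa [hi] using h2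
    rw [h3, zero_smul, add_zero] at hw
    exact hw
  · have : x ∈ LinearMap.ker (A + (S + vecMulVec z z) * C).mulVecLin := by
      rw [heq]; exact hx
    have h2 : B *ᵥ x + (C *ᵥ x) i • z = 0 := by rw [← happ]; exact this
    rw [hx, zero_add] at h2
    have := congrFun h2 i
    simp [hz, hi] at this

theorem elementarySet_pow_eq_univ :
    elementarySet l F ^ (8 * Fintype.card l + 3) = Set.univ := by
  refine Set.eq_univ_of_forall fun g => ?_
  obtain ⟨A, B, C, D, hg⟩ : ∃ A B C D, (g : Matrix (l ⊕ l) (l ⊕ l) F) = fromBlocks A B C D :=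
    ⟨_, _, _, _, (fromBlocks_toBlocks _).symm⟩
  have hmem := g.2
  rw [hg] at hmem
  obtain ⟨h1, -, h3⟩ := fromBlocks_mem_iff.1 hmem
  obtain ⟨S, hS, hu⟩ := exists_isSymm_isUnit_add_mul h1 fun x hA hC => by
    have : (fromBlocks A B C D) *ᵥ (Sum.elim x 0) = 0 := by
      rw [fromBlocks_mulVec]
      simp [hA, hC]
    have h0 : (fromBlocks A B C D).mulVec (Sum.elim x 0) = (fromBlocks A B C D) *ᵥ 0 := by
      rw [this, mulVec_zero]
    have := mulVec_injective_iff_isUnit.2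
      ((isUnit_iff_isUnit_det _).2 (symplectic_det hmem)) h0
    ext i
    exact congrFun this (Sum.inl i)
  obtain ⟨a, ha⟩ := hu
  obtain ⟨S', T, hS', hT, h⟩ := exists_eq_lower_mul_levi_mul_upper (upper S hS * g) a (by
    simp [hg, fromBlocks_multiply, ha])
  have : g = (upper S hS)⁻¹ * (lower S' hS' * levi a * upper T hT) := by rw [← h]; simp
  rw [this, upper_inv, show 8 * Fintype.card l + 3 = 1 + (1 + 4 * (2 * Fintype.card l) + 1) by ring,
    pow_add, pow_add, pow_add, pow_one]
  exact Set.mul_mem_mul (upper_mem _ _)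
    (Set.mul_mem_mul (Set.mul_mem_mul (lower_mem _ _) (levi_mem a)) (upper_mem _ _))

end BoundedGeneration

section Functoriality

open Matrix

variable {l : Type*} [Fintype l] [DecidableEq l] {R R' : Type*} [CommRing R] [CommRing R']

/-- The map on symplectic groups induced by a ring homomorphism. -/
def mapHom (f : R →+* R') : symplecticGroup l R →* symplecticGroup l R' where
  toFun g := ⟨g.1.map f, map_mem g.2 f⟩
  map_one' := by ext1; simp
  map_mul' g h := by ext1; simp [Matrix.map_mul]

theorem coe_mapHom (f : R →+* R') (g : symplecticGroup l R) :
    (mapHom f g : Matrix (l ⊕ l) (l ⊕ l) R') = g.1.map f := rfl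

theorem mapHom_upper (f : R →+* R') (S : Matrix l l R) (hS : S.IsSymm) :
    mapHom f (upper S hS) = upper (S.map f) (hS.map f) := by
  ext1; simp [coe_mapHom, fromBlocks_map]

theorem mapHom_lower (f : R →+* R') (S : Matrix l l R) (hS : S.IsSymm) :
    mapHom f (lower S hS) = lower (S.map f) (hS.map f) := by
  ext1; simp [coe_mapHom, fromBlocks_map]

theorem mapHom_levi (f : R →+* R') (a : (Matrix l l R)ˣ) :
    mapHom f (levi a) = levi (Units.map f.mapMatrix.toMonoidHom a) := by
  ext1
  rw [coe_mapHom, coe_levi, coe_levi, fromBlocks_map, ← map_inv]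
  simp [-coe_units_inv, transpose_map]

theorem eq_one_or_eq_neg_one_of_mem_center [IsDomain R] {z : symplecticGroup l R}
    (hz : z ∈ Subgroup.center (symplecticGroup l R)) :
    (z : Matrix (l ⊕ l) (l ⊕ l) R) = 1 ∨ (z : Matrix (l ⊕ l) (l ⊕ l) R) = -1 := by
  rw [Subgroup.mem_center_iff] at hz
  obtain ⟨A, B, C, D, hg⟩ : ∃ A B C D, (z : Matrix (l ⊕ l) (l ⊕ l) R) = fromBlocks A B C D :=
    ⟨_, _, _, _, (fromBlocks_toBlocks _).symm⟩
  have hup (S : Matrix l l R) (hS : S.IsSymm) := congrArg Subtype.val (hz (upper S hS))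
  have hlo (S : Matrix l l R) (hS : S.IsSymm) := congrArg Subtype.val (hz (lower S hS))
  simp only [Submonoid.coe_mul, hg, coe_upper, coe_lower, fromBlocks_multiply,
    fromBlocks_inj] at hup hlo
  have hC : C = 0 := by simpa using (hup 1 isSymm_one).1
  have hB : B = 0 := by simpa using (hlo 1 isSymm_one).1.symm
  have hD : D = A := by simpa [hB] using (hup 1 isSymm_one).2.1
  subst hC hB hD
  have hcomm (S : Matrix l l R) (hS : S.IsSymm) : S * D = D * S := by
    simpa using (hup S hS).2.1
  have hmem := z.2
  rw [hg] at hmem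
  have hDD : Dᵀ * D = 1 := by simpa using (fromBlocks_mem_iff.1 hmem).2.2
  have hoff (i j : l) (hij : i ≠ j) : D i j = 0 := by
    have h := congrFun (congrFun (hcomm (single j j 1) (by simp [IsSymm])) i) j
    simpa [hij] using h.symm
  have hdiag (i j : l) : D i i = D j j := by
    by_cases hij : i = j
    · rw [hij]
    have h := congrFun (congrFun (hcomm (single i j 1 + single j i 1)
      (by simp [IsSymm, add_comm])) i) j
    simpa [add_mul, mul_add, hij, Ne.symm hij] using h.symm
  rcases isEmpty_or_nonempty l with hl | ⟨⟨i₀⟩⟩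
  · left; ext i; exact (IsEmpty.false i).elim
  have hscal : D = D i₀ i₀ • (1 : Matrix l l R) := by
    ext i j
    by_cases hij : i = j
    · subst hij; simp [hdiag i i₀]
    · simp [hoff i j hij, hij]
  have hsq : D i₀ i₀ * D i₀ i₀ = 1 := by
    have h := congrFun (congrFun hDD i₀) i₀
    rw [hscal] at h
    simpa using h
  rw [hg]
  rcases mul_self_eq_one_iff.1 hsq with h | h <;> rw [hscal, h]
  · left; simp
  · right; rw [neg_one_smul, ← fromBlocks_one, fromBlocks_neg, neg_zero]

theorem mem_center_of_eq_one_or_eq_neg_one {z : symplecticGroup l R}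
    (hz : (z : Matrix (l ⊕ l) (l ⊕ l) R) = 1 ∨ (z : Matrix (l ⊕ l) (l ⊕ l) R) = -1) :
    z ∈ Subgroup.center (symplecticGroup l R) := by
  rw [Subgroup.mem_center_iff]
  intro g
  ext1
  rcases hz with h | h <;> simp [h]

theorem center_le_comap_center [IsDomain R] (f : R →+* R') :
    Subgroup.center (symplecticGroup l R) ≤
      (Subgroup.center (symplecticGroup l R')).comap (mapHom f) := by
  intro z hz
  refine mem_center_of_eq_one_or_eq_neg_one ?_
  rw [coe_mapHom]
  rcases eq_one_or_eq_neg_one_of_mem_center hz with h | h <;> rw [h]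
  · left; simp
  · right; simp [Matrix.map_neg]

/-- The map on projective symplectic groups induced by a ring homomorphism. -/
def projMap [IsDomain R] (f : R →+* R') :
    symplecticGroup l R ⧸ Subgroup.center (symplecticGroup l R) →*
      symplecticGroup l R' ⧸ Subgroup.center (symplecticGroup l R') :=
  QuotientGroup.map _ _ (mapHom f) (center_le_comap_center f)

end Functoriality

section BinaryForms

open Matrix

variable {m : ℕ} {R R' : Type*} [CommRing R] [CommRing R']

/-- The Gram matrix of a binary quadratic form in the coordinates `i` and `j`. -/
def binaryForm (i j : Fin m) (x : R × R × R) : Matrix (Fin m) (Fin m) R :=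
  single i i x.1 + (single i j x.2.1 + single j i x.2.1) + single j j x.2.2

theorem isSymm_binaryForm (i j : Fin m) (x : R × R × R) : (binaryForm i j x).IsSymm := by
  simp [IsSymm, binaryForm, add_comm]

theorem binaryForm_add (i j : Fin m) (x y : R × R × R) :
    binaryForm i j (x + y) = binaryForm i j x + binaryForm i j y := by
  simp only [binaryForm, Prod.fst_add, Prod.snd_add, single_add]
  abel

theorem binaryForm_flipForm (i j : Fin m) (x : R × R × R) :
    binaryForm i j (flipForm x) = binaryForm j i x := by
  simp only [binaryForm, flipForm]
  simp
  abel

theorem map_binaryForm (f : R →+* R') (i j : Fin m) (x : R × R × R) :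
    (binaryForm i j x).map f = binaryForm i j (f x.1, f x.2.1, f x.2.2) := by
  simp [binaryForm, Matrix.map_add]

/-- Transvections as invertible matrices. -/
def transvectionUnit {i j : Fin m} (hij : i ≠ j) (c : R) : (Matrix (Fin m) (Fin m) R)ˣ :=
  ⟨transvection i j c, transvection i j (-c), by simp [transvection_mul_transvection_same _ _ hij],
    by simp [transvection_mul_transvection_same _ _ hij]⟩

theorem transvectionUnit_pow {i j : Fin m} (hij : i ≠ j) (c : R) (n : ℕ) :
    transvectionUnit hij c ^ n = transvectionUnit hij (n * c) := by
  induction n with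
  | zero => ext1; simp [transvectionUnit]
  | succ n ih =>
    ext1
    rw [pow_succ, ih, Units.val_mul]
    simp [transvectionUnit, transvection_mul_transvection_same _ _ hij, add_mul]

theorem map_transvectionUnit (f : R →+* R') {i j : Fin m} (hij : i ≠ j) (c : R) :
    Units.map f.mapMatrix.toMonoidHom (transvectionUnit hij c) = transvectionUnit hij (f c) := by
  ext1
  simp [transvectionUnit, transvection, Matrix.map_add]

theorem transvection_mul_binaryForm {i j : Fin m} (hij : i ≠ j) (c : R) (x : R × R × R) :
    transvection i j c * binaryForm i j x * (transvection i j c)ᵀ =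
      binaryForm i j (dualShear c x) := by
  obtain ⟨a, b, d⟩ := x
  have h1 : a + 2 * c * b + c ^ 2 * d = a + c * b + (c * b + c * d * c) := by ring
  have h2 : b + c * d = b + d * c := by ring
  simp only [transvection, binaryForm, transpose_add, transpose_one, transpose_single, mul_add,
    add_mul, one_mul, mul_one, single_mul_single_same, dualShear_apply, h1]
  simp [hij, hij.symm, single_add, mul_comm]
  abel

theorem upper_pow (S : Matrix (Fin m) (Fin m) R) (hS : S.IsSymm) (n : ℕ) :
    upper S hS ^ n = upper (n • S) (by rw [IsSymm, transpose_smul, hS.eq]) := by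
  induction n with
  | zero => simp [upper_zero]
  | succ n ih => rw [pow_succ, ih, upper_mul]; congr 1; rw [succ_nsmul]

theorem lower_pow (S : Matrix (Fin m) (Fin m) R) (hS : S.IsSymm) (n : ℕ) :
    lower S hS ^ n = lower (n • S) (by rw [IsSymm, transpose_smul, hS.eq]) := by
  induction n with
  | zero => simp [lower_zero]
  | succ n ih => rw [pow_succ, ih, lower_mul]; congr 1; rw [succ_nsmul]

end BinaryForms

end SymplecticGroup

section AlmostInvariant

variable {G H : Type*} [Group G] [NormedAddCommGroup H] [InnerProductSpace ℂ H]
  (π : G →* (H ≃ₗᵢ[ℂ] H)) (f : H)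

theorem norm_rep_mul_sub_le (g h : G) :
    ‖π (g * h) f - f‖ ≤ ‖π g f - f‖ + ‖π h f - f‖ := by
  have : π (g * h) f - f = π g (π h f - f) + (π g f - f) := by
    rw [map_mul, LinearIsometryEquiv.coe_mul, Function.comp_apply, map_sub]; abel
  rw [this, add_comm ‖π g f - f‖]
  exact (norm_add_le _ _).trans_eq (by rw [LinearIsometryEquiv.norm_map])

theorem norm_rep_inv_sub (g : G) : ‖π g⁻¹ f - f‖ = ‖π g f - f‖ := by
  rw [← LinearIsometryEquiv.norm_map (π g) (π g⁻¹ f - f), map_sub]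
  have : π g (π g⁻¹ f) = f := by
    rw [← Function.comp_apply (f := π g), ← LinearIsometryEquiv.coe_mul, ← map_mul]
    simp
  rw [this, norm_sub_rev]

open Pointwise in
theorem norm_rep_pow_sub_le {E : Set G} {c : ℝ} (hE : ∀ g ∈ E, ‖π g f - f‖ ≤ c) (k : ℕ) {g : G}
    (hg : g ∈ E ^ k) : ‖π g f - f‖ ≤ k * c := by
  induction k generalizing g with
  | zero => simp only [pow_zero, Set.mem_one] at hg; simp [hg]
  | succ k ih =>
    rw [pow_succ] at hg
    obtain ⟨a, ha, b, hb, rfl⟩ := hg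
    have := norm_rep_mul_sub_le π f a b
    have := ih ha
    have := hE b hb
    push_cast
    linarith

end AlmostInvariant

namespace SymplecticGroup

open Matrix

section

variable {m : ℕ} {R : Type*} [CommRing R]

/-- Elementary integral symplectic matrices supported on two coordinates. -/
def basicGens (m : ℕ) : Set (symplecticGroup (Fin m) ℤ) :=
  (Set.range fun p : {p : Fin m × Fin m // p.1 ≠ p.2} => levi (transvectionUnit p.2 1)) ∪
    ⋃ x ∈ ({(1, 0, 0), (0, 1, 0), (0, 0, 1)} : Set (ℤ × ℤ × ℤ)),
      ((Set.range fun p : Fin m × Fin m =>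
        upper (binaryForm p.1 p.2 x) (isSymm_binaryForm p.1 p.2 x)) ∪
      (Set.range fun p : Fin m × Fin m =>
        lower (binaryForm p.1 p.2 x) (isSymm_binaryForm p.1 p.2 x)))

theorem finite_basicGens : (basicGens m).Finite :=
  (Set.finite_range _).union (Set.Finite.biUnion (Set.toFinite _) fun _ _ =>
    (Set.finite_range _).union (Set.finite_range _))

theorem levi_transvectionUnit_mem {i j : Fin m} (hij : i ≠ j) :
    levi (transvectionUnit hij 1) ∈ basicGens m := Or.inl ⟨⟨(i, j), hij⟩, rfl⟩

theorem upper_binaryForm_mem (i j : Fin m) {x : ℤ × ℤ × ℤ}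
    (hx : x = (1, 0, 0) ∨ x = (0, 1, 0) ∨ x = (0, 0, 1)) :
    upper (binaryForm i j x) (isSymm_binaryForm i j x) ∈ basicGens m :=
  Or.inr (Set.mem_biUnion (show x ∈ _ from hx) (Or.inl ⟨(i, j), rfl⟩))

theorem lower_binaryForm_mem (i j : Fin m) {x : ℤ × ℤ × ℤ}
    (hx : x = (1, 0, 0) ∨ x = (0, 1, 0) ∨ x = (0, 0, 1)) :
    lower (binaryForm i j x) (isSymm_binaryForm i j x) ∈ basicGens m :=
  Or.inr (Set.mem_biUnion (show x ∈ _ from hx) (Or.inr ⟨(i, j), rfl⟩))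

theorem upper_congr {S T : Matrix (Fin m) (Fin m) R} (h : S = T) (hS : S.IsSymm) (hT : T.IsSymm) :
    upper S hS = upper T hT := by subst h; rfl

theorem lower_congr {S T : Matrix (Fin m) (Fin m) R} (h : S = T) (hS : S.IsSymm) (hT : T.IsSymm) :
    lower S hS = lower T hT := by subst h; rfl

theorem smul_binaryForm (n : ℕ) (i j : Fin m) (x : R × R × R) :
    n • binaryForm i j x = binaryForm i j (n • x) := by
  simp [binaryForm, smul_add, smul_single]

theorem mapHom_levi_transvectionUnit_pow (f : ℤ →+* R) {i j : Fin m} (hij : i ≠ j) (n : ℕ) :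
    mapHom f (levi (transvectionUnit hij 1) ^ n) = levi (transvectionUnit hij (n : R)) := by
  rw [← map_pow, transvectionUnit_pow, mapHom_levi, map_transvectionUnit]
  simp

theorem mapHom_upper_binaryForm_pow (f : ℤ →+* R) (i j : Fin m) (x : ℤ × ℤ × ℤ) (n : ℕ) :
    mapHom f (upper (binaryForm i j x) (isSymm_binaryForm i j x) ^ n) =
      upper (binaryForm i j (n * f x.1, n * f x.2.1, n * f x.2.2)) (isSymm_binaryForm _ _ _) := by
  rw [upper_pow, mapHom_upper]
  refine upper_congr ?_ _ _
  rw [smul_binaryForm, map_binaryForm]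
  simp

theorem mapHom_lower_binaryForm_pow (f : ℤ →+* R) (i j : Fin m) (x : ℤ × ℤ × ℤ) (n : ℕ) :
    mapHom f (lower (binaryForm i j x) (isSymm_binaryForm i j x) ^ n) =
      lower (binaryForm i j (n * f x.1, n * f x.2.1, n * f x.2.2)) (isSymm_binaryForm _ _ _) := by
  rw [lower_pow, mapHom_lower]
  refine lower_congr ?_ _ _
  rw [smul_binaryForm, map_binaryForm]
  simp

theorem norm_rep_le_of_binaryForm {G H : Type*} [Group G] [NormedAddCommGroup H]
    [InnerProductSpace ℂ H] (π : G →* (H ≃ₗᵢ[ℂ] H)) (f : H) (hm : 2 ≤ m)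
    (w : {S : Matrix (Fin m) (Fin m) R // S.IsSymm} → G)
    (hw0 : w ⟨0, isSymm_zero⟩ = 1) (hw : ∀ S T, w ⟨S.1 + T.1, S.2.add T.2⟩ = w S * w T) {c : ℝ}
    (h : ∀ i j, i ≠ j → ∀ x, ‖π (w ⟨binaryForm i j x, isSymm_binaryForm i j x⟩) f - f‖ ≤ c)
    (S : {S : Matrix (Fin m) (Fin m) R // S.IsSymm}) : ‖π (w S) f - f‖ ≤ (m : ℝ) ^ 2 * c := by
  let T (p : Fin m × Fin m) : Matrix (Fin m) (Fin m) R :=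
    if p.1 = p.2 then single p.1 p.1 (S.1 p.1 p.1)
    else if p.1 < p.2 then single p.1 p.2 (S.1 p.1 p.2) + single p.2 p.1 (S.1 p.1 p.2) else 0
  have hT (p) : ∃ i j x, i ≠ j ∧ T p = binaryForm i j x := by
    by_cases hp : p.1 = p.2
    · have : Nontrivial (Fin m) := Fin.nontrivial_iff_two_le.2 hm
      obtain ⟨j, hj⟩ := exists_ne p.1
      exact ⟨p.1, j, (S.1 p.1 p.1, 0, 0), hj.symm, by simp [T, ← hp, binaryForm]⟩
    · refine ⟨p.1, p.2, (0, if p.1 < p.2 then S.1 p.1 p.2 else 0, 0), hp, ?_⟩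
      simp only [T, if_neg hp, binaryForm]
      split_ifs <;> simp
  have key (s : Finset (Fin m × Fin m)) : ∃ hs : (∑ p ∈ s, T p).IsSymm,
      ‖π (w ⟨∑ p ∈ s, T p, hs⟩) f - f‖ ≤ s.card * c := by
    induction s using Finset.induction_on with
    | empty => exact ⟨isSymm_zero, by simp [hw0]⟩
    | insert p s hp ih =>
      obtain ⟨hs, hle⟩ := ih
      obtain ⟨i, j, x, hij, hx⟩ := hT p
      have hsum : ∑ p ∈ insert p s, T p = binaryForm i j x + ∑ p ∈ s, T p := by
        rw [Finset.sum_insert hp, hx]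
      rw [hsum]
      refine ⟨(isSymm_binaryForm i j x).add hs, ?_⟩
      rw [hw ⟨_, isSymm_binaryForm i j x⟩ ⟨_, hs⟩, Finset.card_insert_of_notMem hp]
      have := norm_rep_mul_sub_le π f (w ⟨_, isSymm_binaryForm i j x⟩) (w ⟨_, hs⟩)
      have := h i j hij x
      push_cast
      linarith
  have hST : ∑ p, T p = S.1 := by
    ext a b
    have hsymm := S.2.apply
    have hTab (p : Fin m × Fin m) :
        T p a b = if p = (min a b, max a b) then S.1 a b else 0 := by
      obtain ⟨i, j⟩ := p
      have := hsymm a b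
      rcases lt_trichotomy i j with hij | rfl | hij
      · simp only [T, if_neg hij.ne, if_pos hij, Matrix.add_apply, single_apply, Prod.mk.injEq]
        grind
      · simp only [T, if_true, single_apply, Prod.mk.injEq]
        grind
      · simp only [T, if_neg hij.ne', if_neg hij.not_gt, Matrix.zero_apply, Prod.mk.injEq]
        grind
    rw [Matrix.sum_apply, Finset.sum_congr rfl fun p _ => hTab p]
    simp
  obtain ⟨hs, hle⟩ := key Finset.univ
  have : S = ⟨∑ p, T p, hs⟩ := Subtype.ext hST.symm
  rw [this]
  refine hle.trans_eq ?_
  simp [sq]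

theorem exists_unipotent_almost_invariant (hm : 2 ≤ m) (n : ℕ) (hn : 2 ≤ n) {η : ℝ} (hη : 0 < η) :
    ∃ ε : ℝ, 0 < ε ∧ ∀ (N : ℕ) [NeZero N], n.Coprime N →
      ∀ {H : Type*} [NormedAddCommGroup H] [InnerProductSpace ℂ H]
        (π : symplecticGroup (Fin m) (ZMod N) →* (H ≃ₗᵢ[ℂ] H)) (f : H),
        (∀ g ∈ basicGens m, ‖π (mapHom (Int.castRingHom (ZMod N)) (g ^ n)) f - f‖ ≤ ε * ‖f‖) →
        ∀ g ∈ elementarySet (Fin m) (ZMod N), ‖π g f - f‖ ≤ η * ‖f‖ := by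
  have hm0 : (0 : ℝ) < m := by exact_mod_cast (by omega : 0 < m)
  obtain ⟨ε, hε, h⟩ := exists_relative_property_T n hn (η := η / m ^ 2) (by positivity)
  refine ⟨ε, hε, fun N _ hN H _ _ π f hf => ?_⟩
  have hlevi (i j : Fin m) (hij : i ≠ j) :
      ‖π (levi (transvectionUnit hij (n : ZMod N))) f - f‖ ≤ ε * ‖f‖ := by
    rw [← mapHom_levi_transvectionUnit_pow (Int.castRingHom (ZMod N))]
    exact hf _ (levi_transvectionUnit_mem hij)
  have hupper (i j : Fin m) (x : ℤ × ℤ × ℤ)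
      (hx : x = (1, 0, 0) ∨ x = (0, 1, 0) ∨ x = (0, 0, 1)) :=
    (mapHom_upper_binaryForm_pow (Int.castRingHom (ZMod N)) i j x n) ▸
      hf _ (upper_binaryForm_mem i j hx)
  have hlower (i j : Fin m) (x : ℤ × ℤ × ℤ)
      (hx : x = (1, 0, 0) ∨ x = (0, 1, 0) ∨ x = (0, 0, 1)) :=
    (mapHom_lower_binaryForm_pow (Int.castRingHom (ZMod N)) i j x n) ▸
      hf _ (lower_binaryForm_mem i j hx)
  have hU (S : Matrix (Fin m) (Fin m) (ZMod N)) (hS : S.IsSymm) :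
      ‖π (upper S hS) f - f‖ ≤ η * ‖f‖ := by
    have := norm_rep_le_of_binaryForm π f hm (fun S => upper S.1 S.2) upper_zero
      (fun S T => (upper_mul _ _ S.2 T.2).symm) (c := η / m ^ 2 * ‖f‖)
      (fun i j hij => h N hN π (fun x => upper (binaryForm i j x) (isSymm_binaryForm i j x))
        (levi (transvectionUnit hij (n : ZMod N))) (levi (transvectionUnit hij.symm (n : ZMod N))) f
        (fun x y => by
          rw [upper_mul]
          exact upper_congr (binaryForm_add _ _ _ _) _ _)
        (fun x => by
          rw [levi_mul_upper]
          congr 1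
          exact upper_congr (transvection_mul_binaryForm hij _ _) _ _)
        (fun x => by
          rw [levi_mul_upper]
          congr 1
          refine upper_congr ?_ _ _
          rw [binaryForm_flipForm, ← transvection_mul_binaryForm hij.symm, binaryForm_flipForm]
          rfl)
        (hlevi _ _ _) (hlevi _ _ _)
        (by simpa using hupper i j (1, 0, 0) (by simp))
        (by simpa using hupper i j (0, 1, 0) (by simp))
        (by simpa using hupper i j (0, 0, 1) (by simp))) ⟨S, hS⟩
    refine this.trans_eq ?_
    field_simp
  have hL (S : Matrix (Fin m) (Fin m) (ZMod N)) (hS : S.IsSymm) :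
      ‖π (lower S hS) f - f‖ ≤ η * ‖f‖ := by
    have := norm_rep_le_of_binaryForm π f hm (fun S => lower S.1 S.2) lower_zero
      (fun S T => (lower_mul _ _ S.2 T.2).symm) (c := η / m ^ 2 * ‖f‖)
      (fun i j hij => h N hN π (fun x => lower (binaryForm i j x) (isSymm_binaryForm i j x))
        (levi (transvectionUnit hij.symm (n : ZMod N))⁻¹)
        (levi (transvectionUnit hij (n : ZMod N))⁻¹) f
        (fun x y => by
          rw [lower_mul]
          exact lower_congr (binaryForm_add _ _ _ _) _ _)
        (fun x => by
          rw [levi_inv_mul_lower]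
          congr 1
          refine lower_congr ?_ _ _
          rw [← transvection_mul_binaryForm hij]
          simp [transvectionUnit, transvection])
        (fun x => by
          rw [levi_inv_mul_lower]
          congr 1
          refine lower_congr ?_ _ _
          rw [binaryForm_flipForm, ← transvection_mul_binaryForm hij.symm, binaryForm_flipForm]
          simp [transvectionUnit, transvection])
        (by rw [map_inv, norm_rep_inv_sub]; exact hlevi _ _ _)
        (by rw [map_inv, norm_rep_inv_sub]; exact hlevi _ _ _)
        (by simpa using hlower i j (1, 0, 0) (by simp))
        (by simpa using hlower i j (0, 1, 0) (by simp))
        (by simpa using hlower i j (0, 0, 1) (by simp))) ⟨S, hS⟩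
    refine this.trans_eq ?_
    field_simp
  rintro g ⟨S, hS, rfl | rfl⟩
  exacts [hU S hS, hL S hS]

end

open Matrix

theorem mapHom_mapHom {l : Type*} [Fintype l] [DecidableEq l] {R R' R'' : Type*} [CommRing R]
    [CommRing R'] [CommRing R''] (f : R →+* R') (g : R' →+* R'') (x : symplecticGroup l R) :
    mapHom g (mapHom f x) = mapHom (g.comp f) x := by
  ext1; simp [coe_mapHom, Matrix.map_map]

variable {m : ℕ}

theorem exists_almost_invariant_of_basicGens (hm : 2 ≤ m) (n : ℕ) (hn : 2 ≤ n) :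
    ∃ ε : ℝ, 0 < ε ∧ ∀ (p q : ℕ) [Fact p.Prime] [Fact q.Prime], p ≠ q →
      n.Coprime p → n.Coprime q →
      ∀ {H : Type*} [NormedAddCommGroup H] [InnerProductSpace ℂ H]
        (π : symplecticGroup (Fin m) (ZMod p) × symplecticGroup (Fin m) (ZMod q) →* (H ≃ₗᵢ[ℂ] H))
        (f : H),
        (∀ g ∈ basicGens m, ‖π (mapHom (Int.castRingHom (ZMod p)) (g ^ n),
          mapHom (Int.castRingHom (ZMod q)) (g ^ n)) f - f‖ ≤ ε * ‖f‖) →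
        ∀ g, ‖π g f - f‖ ≤ 1 / 2 * ‖f‖ := by
  set K : ℕ := 8 * Fintype.card (Fin m) + 3 with hK
  obtain ⟨ε, hε, h⟩ := exists_unipotent_almost_invariant hm n hn (η := 1 / (4 * K))
    (by positivity)
  refine ⟨ε, hε, fun p q _ _ hpq hnp hnq H _ _ π f hf => ?_⟩
  have hp := Fact.out (p := p.Prime)
  have hq := Fact.out (p := q.Prime)
  have hcop : p.Coprime q := (Nat.coprime_primes hp hq).2 hpq
  have : NeZero (p * q) := ⟨mul_ne_zero hp.ne_zero hq.ne_zero⟩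
  let e := ZMod.chineseRemainder hcop
  let f₁ : ZMod (p * q) →+* ZMod p := (RingHom.fst _ _).comp e.toRingHom
  let f₂ : ZMod (p * q) →+* ZMod q := (RingHom.snd _ _).comp e.toRingHom
  let Φ := (mapHom (l := Fin m) f₁).prod (mapHom f₂)
  have key := h (p * q) (Nat.Coprime.mul_right hnp hnq) (π.comp Φ) f (fun g hg => by
    have := hf g hg
    rw [MonoidHom.comp_apply, MonoidHom.prod_apply, mapHom_mapHom, mapHom_mapHom,
      Subsingleton.elim (f₁.comp _) (Int.castRingHom (ZMod p)),
      Subsingleton.elim (f₂.comp _) (Int.castRingHom (ZMod q))]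
    exact this)
  have hfst (x : ZMod p) : f₁ (e.symm (x, 0)) = x := by simp [f₁]
  have hfst' (x : ZMod p) : f₂ (e.symm (x, 0)) = 0 := by simp [f₂]
  have hsnd (x : ZMod q) : f₁ (e.symm (0, x)) = 0 := by simp [f₁]
  have hsnd' (x : ZMod q) : f₂ (e.symm (0, x)) = x := by simp [f₂]
  have h₁ (g) (hg : g ∈ elementarySet (Fin m) (ZMod p)) :
      ‖π (g, 1) f - f‖ ≤ 1 / (4 * K) * ‖f‖ := by
    obtain ⟨S, hS, hg⟩ := hg
    let S' : Matrix (Fin m) (Fin m) (ZMod (p * q)) := S.map fun x => e.symm (x, 0)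
    have hS' : S'.IsSymm := hS.map _
    have e1 : S'.map f₁ = S := by ext i j; simp [S', hfst]
    have e2 : S'.map f₂ = 0 := by ext i j; simp [S', hfst']
    rcases hg with rfl | rfl
    · convert key _ (upper_mem S' hS') using 5
      rw [MonoidHom.comp_apply, MonoidHom.prod_apply, mapHom_upper, mapHom_upper]
      simp only [e1, e2, upper_zero]
    · convert key _ (lower_mem S' hS') using 5
      rw [MonoidHom.comp_apply, MonoidHom.prod_apply, mapHom_lower, mapHom_lower]
      simp only [e1, e2, lower_zero]
  have h₂ (g) (hg : g ∈ elementarySet (Fin m) (ZMod q)) :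
      ‖π (1, g) f - f‖ ≤ 1 / (4 * K) * ‖f‖ := by
    obtain ⟨S, hS, hg⟩ := hg
    let S' : Matrix (Fin m) (Fin m) (ZMod (p * q)) := S.map fun x => e.symm (0, x)
    have hS' : S'.IsSymm := hS.map _
    have e1 : S'.map f₁ = 0 := by ext i j; simp [S', hsnd]
    have e2 : S'.map f₂ = S := by ext i j; simp [S', hsnd']
    rcases hg with rfl | rfl
    · convert key _ (upper_mem S' hS') using 5
      rw [MonoidHom.comp_apply, MonoidHom.prod_apply, mapHom_upper, mapHom_upper]
      simp only [e1, e2, upper_zero]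
    · convert key _ (lower_mem S' hS') using 5
      rw [MonoidHom.comp_apply, MonoidHom.prod_apply, mapHom_lower, mapHom_lower]
      simp only [e1, e2, lower_zero]
  rintro ⟨g₁, g₂⟩
  have b₁ := norm_rep_pow_sub_le (π.comp (MonoidHom.inl _ _)) f h₁ K (g := g₁)
    (by rw [hK, elementarySet_pow_eq_univ]; trivial)
  have b₂ := norm_rep_pow_sub_le (π.comp (MonoidHom.inr _ _)) f h₂ K (g := g₂)
    (by rw [hK, elementarySet_pow_eq_univ]; trivial)
  have b := norm_rep_mul_sub_le π f (g₁, 1) (1, g₂)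
  simp only [MonoidHom.comp_apply, MonoidHom.inl_apply, MonoidHom.inr_apply] at b₁ b₂
  rw [Prod.mk_mul_mk, mul_one, one_mul] at b
  have hK0 : (K : ℝ) ≠ 0 := by positivity
  have : (K : ℝ) * (1 / (4 * K) * ‖f‖) = 1 / 4 * ‖f‖ := by field_simp
  linarith

end SymplecticGroup

section Regular

variable {X : Type*} [Group X] [Fintype X]

variable (X) in
/-- The right regular representation of a finite group. -/
noncomputable def regularRep : X →* (EuclideanSpace ℂ X ≃ₗᵢ[ℂ] EuclideanSpace ℂ X) where
  toFun g := LinearIsometryEquiv.piLpCongrLeft 2 ℂ ℂ (Equiv.mulRight g⁻¹)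
  map_one' := by
    ext f x
    change f (x * (1⁻¹)⁻¹) = f x
    simp
  map_mul' g h := by
    ext f x
    change f (x * ((g * h)⁻¹)⁻¹) = f (x * (g⁻¹)⁻¹ * (h⁻¹)⁻¹)
    simp [mul_assoc]

@[simp]
theorem regularRep_apply (g : X) (f : EuclideanSpace ℂ X) (x : X) :
    regularRep X g f x = f (x * g) := by simp [regularRep]

theorem eq_zero_of_almost_invariant {Y : Type*} [Group Y] (φ : Y →* X)
    (hφ : Function.Surjective φ) (f : EuclideanSpace ℂ X) (hf : ∑ x, f x = 0)
    (h : ∀ y, ‖regularRep X (φ y) f - f‖ ≤ 1 / 2 * ‖f‖) : f = 0 := by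
  have hsum : ∑ g, regularRep X g f = 0 := by
    ext x
    simp only [WithLp.ofLp_sum, Finset.sum_apply, regularRep_apply, WithLp.ofLp_zero, Pi.zero_apply]
    rw [← hf]
    exact Equiv.sum_comp (Equiv.mulLeft x) f
  have h2 : ‖∑ g : X, (regularRep X g f - f)‖ ≤ ∑ g : X, 1 / 2 * ‖f‖ := by
    refine (norm_sum_le _ _).trans (Finset.sum_le_sum fun g _ => ?_)
    obtain ⟨y, rfl⟩ := hφ g
    exact h y
  rw [Finset.sum_sub_distrib, hsum, zero_sub, norm_neg, Finset.sum_const, Finset.sum_const,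
    ← Nat.cast_smul_eq_nsmul ℝ, norm_smul] at h2
  simp only [Finset.card_univ, Real.norm_natCast, nsmul_eq_mul] at h2
  have hX : (0 : ℝ) < Fintype.card X := by exact_mod_cast Fintype.card_pos
  have := le_of_mul_le_mul_left h2 hX
  have := norm_nonneg f
  exact norm_eq_zero.1 (by linarith)

end Regular

section Mixing

open Pointwise

variable {G : Type*} [Group G]

theorem Admissible.one_mem_pow {S : Finset G} (hS : Admissible S) :
    ∃ k : ℕ, Odd k ∧ (1 : G) ∈ (S : Set G) ^ k := by
  obtain ⟨k, hk, w, hw⟩ := hS.2.2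
  exact ⟨k, hk, Set.mem_pow.2 ⟨w, hw⟩⟩

theorem Admissible.nonempty {S : Finset G} (hS : Admissible S) : S.Nonempty := by
  obtain ⟨k, hk, w, -⟩ := hS.2.2
  exact ⟨_, (w ⟨0, hk.pos⟩).2⟩

theorem sum_norm_sub_sq_eq {H ι : Type*} [NormedAddCommGroup H] [InnerProductSpace ℂ H]
    (S : Finset ι) (v : ι → H) {r : ℝ} (hv : ∀ s ∈ S, ‖v s‖ = r) :
    ∑ s ∈ S, ∑ t ∈ S, ‖v s - v t‖ ^ 2 = 2 * (S.card * r) ^ 2 - 2 * ‖∑ s ∈ S, v s‖ ^ 2 := by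
  have h1 : ∀ s ∈ S, ∀ t ∈ S,
      ‖v s - v t‖ ^ 2 = 2 * r ^ 2 - 2 * RCLike.re (inner ℂ (v s) (v t)) := by
    intro s hs t ht
    rw [@norm_sub_sq ℂ, hv s hs, hv t ht]; ring
  have h2 : ‖∑ s ∈ S, v s‖ ^ 2 = ∑ s ∈ S, ∑ t ∈ S, RCLike.re (inner ℂ (v s) (v t)) := by
    rw [← @inner_self_eq_norm_sq ℂ, sum_inner, map_sum]
    simp_rw [inner_sum, map_sum]
  rw [h2, Finset.sum_congr rfl fun s hs => Finset.sum_congr rfl (h1 s hs)]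
  simp only [Finset.sum_sub_distrib, Finset.sum_const, nsmul_eq_mul, ← Finset.mul_sum]
  ring

/-- An admissible set averages every vector that it does not almost fix with a uniform loss. -/
theorem Admissible.exists_norm_sum_le {S : Finset G} (hS : Admissible S) {ε : ℝ} (hε : 0 < ε) :
    ∃ θ : ℝ, 0 < θ ∧ θ < 1 ∧ ∀ {H : Type*} [NormedAddCommGroup H] [InnerProductSpace ℂ H]
      (π : G →* (H ≃ₗᵢ[ℂ] H)) (h : H), (∃ s ∈ S, ε * ‖h‖ ≤ ‖π s h - h‖) →
        ‖∑ s ∈ S, π s h‖ ≤ θ * S.card * ‖h‖ := by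
  obtain ⟨k, ⟨j, rfl⟩, h1⟩ := hS.one_mem_pow
  have hc : (0 : ℝ) < S.card := by exact_mod_cast hS.nonempty.card_pos
  set δ := ε / (2 * (j + 1)) with hδ
  have hδ0 : 0 < δ := by positivity
  set η := min (1 / 2) (δ ^ 2 / (2 * (S.card : ℝ) ^ 2))
  have hη0 : 0 < η := lt_min (by norm_num) (by positivity)
  have hη1 : η ≤ 1 / 2 := min_le_left _ _
  have hη2 : 2 * (S.card : ℝ) ^ 2 * η ≤ δ ^ 2 := by
    have := min_le_right (1 / 2) (δ ^ 2 / (2 * (S.card : ℝ) ^ 2))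
    rw [le_div_iff₀ (by positivity)] at this
    linarith
  refine ⟨√(1 - η), Real.sqrt_pos.2 (by linarith),
    by rw [Real.sqrt_lt' one_pos]; linarith, ?_⟩
  intro H _ _ π h ⟨s, hs, hsh⟩
  by_contra! hlt
  have hh : 0 < ‖h‖ := by
    rw [norm_pos_iff]
    rintro rfl
    simp at hlt
  have hsq : (1 - η) * (S.card * ‖h‖) ^ 2 < ‖∑ s ∈ S, π s h‖ ^ 2 := by
    have h0 : (0 : ℝ) ≤ √(1 - η) * S.card * ‖h‖ := by positivity
    have := pow_lt_pow_left₀ hlt h0 two_ne_zero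
    rwa [mul_assoc, mul_pow, Real.sq_sqrt (by linarith)] at this
  have hsum := sum_norm_sub_sq_eq S (fun s => π s h) (r := ‖h‖) (by simp)
  have hpair : ∀ a ∈ S, ∀ b ∈ S, ‖π a h - π b h‖ ≤ δ * ‖h‖ := by
    intro a ha b hb
    have h3 : ‖π a h - π b h‖ ^ 2 ≤ ∑ s ∈ S, ∑ t ∈ S, ‖π s h - π t h‖ ^ 2 :=
      (Finset.single_le_sum (f := fun t => ‖π a h - π t h‖ ^ 2) (fun _ _ => by positivity) hb).trans
        (Finset.single_le_sum (f := fun s => ∑ t ∈ S, ‖π s h - π t h‖ ^ 2)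
          (fun _ _ => by positivity) ha)
    refine (sq_le_sq₀ (norm_nonneg _) (by positivity)).1 (h3.trans ?_)
    rw [hsum, mul_pow]
    nlinarith [sq_nonneg ‖h‖]
  have hE : ∀ g ∈ (S : Set G) * S, ‖π g h - h‖ ≤ δ * ‖h‖ := by
    rintro _ ⟨a, ha, b, hb, rfl⟩
    have := hpair b hb a⁻¹ ((hS.1 a).1 ha)
    rw [← LinearIsometryEquiv.norm_map (π a), map_sub] at this
    simpa [LinearIsometryEquiv.coe_mul] using this
  have hmem : s ∈ ((S : Set G) * S) ^ (j + 1) := by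
    rw [← sq, ← pow_mul, mul_add, mul_one, ← Nat.add_assoc (2 * j) 1 1, pow_succ]
    exact ⟨1, h1, s, hs, one_mul s⟩
  have := norm_rep_pow_sub_le π h hE (j + 1) hmem
  have h4 : ((j + 1 : ℕ) : ℝ) * (δ * ‖h‖) = ε / 2 * ‖h‖ := by
    rw [hδ]; push_cast; field_simp
  nlinarith

theorem norm_sum_words_le {X : Type*} [Group X] [Fintype X] (S : Finset G) (φ : G →* X) {c : ℝ}
    (hc : 0 ≤ c) (h : ∀ f : EuclideanSpace ℂ X, ∑ x, f x = 0 →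
      ‖∑ s ∈ S, regularRep X (φ s) f‖ ≤ c * ‖f‖) (k : ℕ) (f : EuclideanSpace ℂ X)
    (hf : ∑ x, f x = 0) :
    ‖∑ w : Fin k → S, f (φ (List.ofFn fun i => (w i : G)).prod)‖ ≤ c ^ k * ‖f‖ := by
  suffices H : ∀ (k : ℕ) (f : EuclideanSpace ℂ X), ∑ x, f x = 0 → ∃ f' : EuclideanSpace ℂ X,
      (∀ x, f' x = ∑ w : Fin k → S, f (x * φ (List.ofFn fun i => (w i : G)).prod)) ∧
        ‖f'‖ ≤ c ^ k * ‖f‖ by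
    obtain ⟨f', h1, h2⟩ := H k f hf
    have := h1 1
    simp only [one_mul] at this
    rw [← this]
    exact (PiLp.norm_apply_le f' 1).trans h2
  intro k
  induction k with
  | zero => intro f _; exact ⟨f, by simp, by simp⟩
  | succ k ih =>
    intro f hf
    obtain ⟨f', h1, h2⟩ := ih (∑ s ∈ S, regularRep X (φ s) f) (by
      simp only [WithLp.ofLp_sum, Finset.sum_apply, regularRep_apply]
      rw [Finset.sum_comm]
      refine Finset.sum_eq_zero fun s _ => ?_
      rw [← hf]
      exact Equiv.sum_comp (Equiv.mulRight (φ s)) f)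
    refine ⟨f', fun x => ?_, h2.trans ?_⟩
    · rw [h1, ← (Fin.snocEquiv fun _ => S).sum_comp, Fintype.sum_prod_type_right]
      refine Finset.sum_congr rfl fun w _ => ?_
      simp only [WithLp.ofLp_sum, Finset.sum_apply, regularRep_apply]
      rw [← Finset.sum_coe_sort S]
      refine Finset.sum_congr rfl fun s _ => ?_
      rw [List.ofFn_succ']
      simp [Fin.snocEquiv, mul_assoc]
    · calc _ ≤ c ^ k * (c * ‖f‖) := by gcongr; exact h f hf
        _ = _ := by ring

end Mixing

open Pointwise in
theorem Admissible.exists_mem_pow {G : Type*} [Group G] {S : Finset G} (hS : Admissible S) (g : G) :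
    ∃ k : ℕ, g ∈ (S : Set G) ^ k := by
  have hg : g ∈ Subgroup.closure (S : Set G) := by rw [hS.2.1]; trivial
  induction hg using Subgroup.closure_induction with
  | mem x hx => exact ⟨1, by simpa using hx⟩
  | one => exact ⟨0, by simp⟩
  | mul x y _ _ hx hy =>
    obtain ⟨a, ha⟩ := hx
    obtain ⟨b, hb⟩ := hy
    exact ⟨a + b, by rw [pow_add]; exact Set.mul_mem_mul ha hb⟩
  | inv x _ hx =>
    obtain ⟨a, ha⟩ := hx
    refine ⟨a, ?_⟩
    have hinv : (S : Set G)⁻¹ = S := by ext x; simpa using (hS.1 x).symm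
    rw [← hinv, inv_pow]
    simpa using ha

namespace SymplecticGroup

open Matrix

/-- The projective symplectic group over `R`. -/
abbrev ProjSp (m : ℕ) (R : Type*) [CommRing R] : Type _ :=
  symplecticGroup (Fin m) R ⧸ Subgroup.center (symplecticGroup (Fin m) R)

variable {m : ℕ} {Γ : Type*} [Group Γ]

/-- Simultaneous reduction modulo two primes. -/
noncomputable def reductionPair (ρ : Γ →* ProjSp m ℤ) (p q : ℕ) [Fact p.Prime] [Fact q.Prime] :
    Γ →* ProjSp m (ZMod p) × ProjSp m (ZMod q) :=
  ((projMap (Int.castRingHom (ZMod p))).comp ρ).prod ((projMap (Int.castRingHom (ZMod q))).comp ρ)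

theorem exists_spectral_gap (hm : 2 ≤ m) (ρ : Γ →* ProjSp m ℤ) (hρ : ρ.range.FiniteIndex)
    {S : Finset Γ} (hS : Admissible S) :
    ∃ n : ℕ, 0 < n ∧ ∃ ε : ℝ, 0 < ε ∧ ∀ (p q : ℕ) [Fact p.Prime] [Fact q.Prime],
      p ≠ q → n.Coprime p → n.Coprime q →
      ∀ [Fintype (ProjSp m (ZMod p) × ProjSp m (ZMod q))]
        (f : EuclideanSpace ℂ (ProjSp m (ZMod p) × ProjSp m (ZMod q))), ∑ x, f x = 0 →
        ∃ s ∈ S, ε * ‖f‖ ≤ ‖regularRep _ (reductionPair ρ p q s) f - f‖ := by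
  set N := ρ.range.normalCore.index with hN
  have hN0 : N ≠ 0 := Subgroup.FiniteIndex.index_ne_zero
  obtain ⟨ε, hε, H⟩ := exists_almost_invariant_of_basicGens hm (2 * N) (by omega)
  have hpow : ∀ g : symplecticGroup (Fin m) ℤ, ∃ γ : Γ,
      ρ γ = QuotientGroup.mk' _ (g ^ (2 * N)) := by
    intro g
    have h1 : (QuotientGroup.mk' (Subgroup.center _) g) ^ N ∈ ρ.range.normalCore :=
      Subgroup.pow_index_mem _ _
    have h2 := Subgroup.pow_mem _ (Subgroup.normalCore_le _ h1) 2
    rwa [← pow_mul, mul_comm, ← map_pow] at h2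
  choose γ hγ using hpow
  choose ℓ hℓ using hS.exists_mem_pow
  obtain ⟨b, hb⟩ := (finite_basicGens (m := m)).image (fun g => ℓ (γ g)) |>.bddAbove
  refine ⟨2 * N, by omega, ε / (b + 1), by positivity, ?_⟩
  intro p q _ _ hpq hp hq _ f hf
  by_contra! hlt
  have hf0 : f = 0 := by
    let ψ : symplecticGroup (Fin m) (ZMod p) × symplecticGroup (Fin m) (ZMod q) →*
        ProjSp m (ZMod p) × ProjSp m (ZMod q) :=
      (QuotientGroup.mk' (Subgroup.center (symplecticGroup (Fin m) (ZMod p)))).prodMap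
        (QuotientGroup.mk' (Subgroup.center (symplecticGroup (Fin m) (ZMod q))))
    have hψ : Function.Surjective ψ :=
      (QuotientGroup.mk'_surjective _).prodMap (QuotientGroup.mk'_surjective _)
    refine eq_zero_of_almost_invariant ψ hψ f hf ?_
    have key := H p q hpq hp hq
      ((regularRep (ProjSp m (ZMod p) × ProjSp m (ZMod q))).comp ψ) f
    refine fun g => key (fun g hg => ?_) g
    have h1 := norm_rep_pow_sub_le ((regularRep _).comp (reductionPair ρ p q)) f
      (E := (S : Set Γ)) (fun s hs => (hlt s hs).le) _ (hℓ (γ g))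
    have h2 : reductionPair ρ p q (γ g) = (QuotientGroup.mk' _ (mapHom (Int.castRingHom (ZMod p))
        (g ^ (2 * N))), QuotientGroup.mk' _ (mapHom (Int.castRingHom (ZMod q)) (g ^ (2 * N)))) := by
      simp only [reductionPair, MonoidHom.prod_apply, MonoidHom.comp_apply, hγ]
      rfl
    rw [MonoidHom.comp_apply, h2] at h1
    refine h1.trans ?_
    have h3 : (ℓ (γ g) : ℝ) ≤ b := by exact_mod_cast hb ⟨g, hg, rfl⟩
    calc (ℓ (γ g) : ℝ) * (ε / (b + 1) * ‖f‖) ≤ (b + 1) * (ε / (b + 1) * ‖f‖) := by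
          gcongr; linarith
      _ = ε * ‖f‖ := by field_simp
  obtain ⟨s, hs⟩ := hS.nonempty
  have := hlt s hs
  simp [hf0] at this

theorem card_projSp_le (p : ℕ) [Fact p.Prime] : Nat.card (ProjSp m (ZMod p)) ≤ p ^ (4 * m ^ 2) := by
  calc Nat.card (ProjSp m (ZMod p)) ≤ Nat.card (symplecticGroup (Fin m) (ZMod p)) :=
        Nat.card_le_card_of_surjective _ Quotient.mk''_surjective
    _ ≤ Nat.card (Matrix (Fin m ⊕ Fin m) (Fin m ⊕ Fin m) (ZMod p)) :=
        Nat.card_le_card_of_injective _ Subtype.coe_injective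
    _ = p ^ (4 * m ^ 2) := by
        rw [Matrix, Nat.card_fun, Nat.card_fun, Nat.card_zmod, Nat.card_sum, Nat.card_fin,
          ← pow_mul]
        ring_nf

/-- Reductions of a random word modulo two primes are asymptotically decorrelated. -/
theorem exists_decorrelation (hm : 2 ≤ m) (ρ : Γ →* ProjSp m ℤ) (hρ : ρ.range.FiniteIndex)
    {S : Finset Γ} (hS : Admissible S) :
    ∃ n : ℕ, 0 < n ∧ ∃ θ : ℝ, 0 < θ ∧ θ < 1 ∧ ∀ (p q : ℕ) [Fact p.Prime] [Fact q.Prime],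
      p ≠ q → n.Coprime p → n.Coprime q →
      ∀ (u : ProjSp m (ZMod p) → ℝ) (v : ProjSp m (ZMod q) → ℝ), ∑ᶠ x, u x = 0 →
        (∀ x, |u x| ≤ 1) → (∀ y, |v y| ≤ 1) → ∀ k : ℕ,
        |∑ w : Fin k → S,
          u (projMap (Int.castRingHom (ZMod p)) (ρ (List.ofFn fun i => (w i : Γ)).prod)) *
          v (projMap (Int.castRingHom (ZMod q)) (ρ (List.ofFn fun i => (w i : Γ)).prod))| ≤
        (θ * S.card) ^ k * √((p * q : ℝ) ^ (4 * m ^ 2)) := by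
  obtain ⟨n, hn, ε, hε, H⟩ := exists_spectral_gap hm ρ hρ hS
  obtain ⟨θ, hθ0, hθ1, hθ⟩ := hS.exists_norm_sum_le hε
  refine ⟨n, hn, θ, hθ0, hθ1, ?_⟩
  intro p q _ _ hpq hp hq u v hu hu1 hv1 k
  have : Fintype (ProjSp m (ZMod p)) := Fintype.ofFinite _
  have : Fintype (ProjSp m (ZMod q)) := Fintype.ofFinite _
  let f : EuclideanSpace ℂ (ProjSp m (ZMod p) × ProjSp m (ZMod q)) :=
    WithLp.toLp 2 fun x => ((u x.1 * v x.2 : ℝ) : ℂ)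
  have hf : ∑ x, f x = 0 := by
    simp only [f, ← Complex.ofReal_sum]
    rw [Fintype.sum_prod_type, Finset.sum_comm]
    simp_rw [← Finset.sum_mul]
    rw [← finsum_eq_sum_of_fintype u, hu]
    simp
  have h1 := norm_sum_words_le S (reductionPair ρ p q) (c := θ * S.card) (by positivity)
    (fun f hf => hθ ((regularRep _).comp (reductionPair ρ p q)) f (H p q hpq hp hq f hf)) k f hf
  simp only [f, ← Complex.ofReal_sum, Complex.norm_real, Real.norm_eq_abs] at h1
  refine h1.trans ?_
  gcongr
  rw [EuclideanSpace.norm_eq]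
  apply Real.sqrt_le_sqrt
  calc _ ≤ ∑ x : ProjSp m (ZMod p) × ProjSp m (ZMod q), (1 : ℝ) := by
        refine Finset.sum_le_sum fun x _ => ?_
        rw [Complex.norm_real, Real.norm_eq_abs, abs_mul]
        exact pow_le_one₀ (by positivity) (mul_le_one₀ (hu1 _) (abs_nonneg _) (hv1 _))
    _ = (Nat.card (ProjSp m (ZMod p)) * Nat.card (ProjSp m (ZMod q)) : ℕ) := by
        rw [Finset.sum_const, Finset.card_univ, Fintype.card_prod]
        simp [Nat.card_eq_fintype_card]
    _ ≤ ((p ^ (4 * m ^ 2) * q ^ (4 * m ^ 2) : ℕ) : ℝ) := by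
        exact_mod_cast Nat.mul_le_mul (card_projSp_le p) (card_projSp_le q)
    _ = _ := by push_cast; rw [mul_pow]

end SymplecticGroup

section Commutant

open Polynomial Matrix

variable {n F : Type*} [Fintype n] [DecidableEq n] [Field F] {A : Matrix n n F}

theorem isUnit_aeval_of_irreducible_charpoly (hA : Irreducible A.charpoly) {f : F[X]} (hf : f ≠ 0)
    (hdeg : f.degree < A.charpoly.degree) : IsUnit (aeval A f) := by
  have hcop : IsCoprime A.charpoly f :=
    hA.coprime_iff_not_dvd.2 fun h => hf (eq_zero_of_dvd_of_degree_lt h hdeg)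
  obtain ⟨a, b, hab⟩ := hcop
  have := congrArg (aeval A) hab
  simp only [map_add, map_mul, aeval_self_charpoly, mul_zero, zero_add, map_one] at this
  exact IsUnit.of_mul_eq_one_right _ this

/-- The commutant of a matrix with irreducible characteristic polynomial consists of polynomials
in that matrix. -/
theorem exists_aeval_eq_of_commute (hA : Irreducible A.charpoly) {C : Matrix n n F}
    (hC : Commute C A) : ∃ f : F[X], C = aeval A f := by
  have hn : Nonempty n := by
    by_contra h
    rw [not_nonempty_iff] at h
    exact hA.not_isUnit (by simp [charpoly])
  obtain ⟨i⟩ := hn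
  let v : n → F := Pi.single i 1
  have hv : v ≠ 0 := by simp [v]
  let T : degreeLT F (Fintype.card n) →ₗ[F] (n → F) :=
    { toFun := fun f => aeval A (f : F[X]) *ᵥ v
      map_add' := fun f g => by simp [add_mulVec]
      map_smul' := fun c f => by simp [smul_mulVec] }
  have hinj : Function.Injective T := by
    refine (injective_iff_map_eq_zero T).2 fun f hf => ?_
    by_contra h0
    have hu : IsUnit (aeval A (f : F[X])) := by
      refine isUnit_aeval_of_irreducible_charpoly hA (by simpa using h0) ?_
      rw [charpoly_degree_eq_dim]
      exact mem_degreeLT.1 f.2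
    have h1 : aeval A (f : F[X]) *ᵥ v = 0 := hf
    exact hv (mulVec_injective_of_isUnit hu (by rw [h1, mulVec_zero]))
  have hsurj : Function.Surjective T := by
    refine (LinearMap.injective_iff_surjective_of_finrank_eq_finrank ?_).1 hinj
    rw [(degreeLTEquiv F (Fintype.card n)).finrank_eq]
    simp
  obtain ⟨f, hf⟩ := hsurj (C *ᵥ v)
  have hf' : aeval A (f : F[X]) *ᵥ v = C *ᵥ v := hf
  refine ⟨f, ext_of_mulVec_single fun j => ?_⟩
  obtain ⟨g, hg⟩ := hsurj (Pi.single j 1)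
  have hg' : aeval A (g : F[X]) *ᵥ v = Pi.single j 1 := hg
  have hcomm : Commute C (aeval A (g : F[X])) := by
    induction (g : F[X]) using Polynomial.induction_on' with
    | add p q hp hq => rw [map_add]; exact hp.add_right hq
    | monomial k a =>
      rw [aeval_monomial]
      exact (Algebra.commute_algebraMap_right a C).mul_right (hC.pow_right k)
  rw [← hg', mulVec_mulVec, mulVec_mulVec, hcomm.eq, ← mulVec_mulVec, ← hf', mulVec_mulVec,
    ← map_mul, ← map_mul, mul_comm]

end Commutant

section Centralizer

open Polynomial Matrix

variable {F E : Type*} [Field F] [Field E] [Algebra F E]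

theorem aeval_eq_zero_iff_of_irreducible_charpoly {n : Type*} [Fintype n] [DecidableEq n]
    {A : Matrix n n F} (hA : Irreducible A.charpoly) {β : E}
    (hβ : aeval β A.charpoly = 0) (f : F[X]) : aeval A f = 0 ↔ aeval β f = 0 := by
  have hn : Nonempty n := by
    by_contra h
    rw [not_nonempty_iff] at h
    exact hA.not_isUnit (by simp [charpoly])
  have h1 := minpoly.eq_of_irreducible_of_monic hA (aeval_self_charpoly A) A.charpoly_monic
  have h2 := minpoly.eq_of_irreducible_of_monic hA hβ A.charpoly_monic
  rw [← minpoly.dvd_iff, ← minpoly.dvd_iff, ← h1, ← h2]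

variable {l : Type*} [Fintype l] [DecidableEq l]

theorem SymplecticGroup.mul_J_mul_transpose (g : symplecticGroup l F) :
    (g : Matrix (l ⊕ l) (l ⊕ l) F) * J l F * (g : Matrix (l ⊕ l) (l ⊕ l) F)ᵀ = J l F :=
  SymplecticGroup.mem_iff.1 g.2

theorem SymplecticGroup.J_mul_transpose_aeval (g : symplecticGroup l F) (f : F[X]) :
    J l F * (aeval (g : Matrix (l ⊕ l) (l ⊕ l) F) f)ᵀ =
      aeval (g⁻¹ : symplecticGroup l F).1 f * J l F := by
  have h1 : J l F * (g : Matrix (l ⊕ l) (l ⊕ l) F)ᵀ = (g⁻¹ : symplecticGroup l F).1 * J l F := by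
    have h2 : (g⁻¹ : symplecticGroup l F).1 * g.1 = 1 := by
      rw [← Submonoid.coe_mul, inv_mul_cancel]; rfl
    calc _ = (g⁻¹ : symplecticGroup l F).1 * g.1 * (J l F * g.1ᵀ) := by rw [h2, one_mul]
      _ = _ := by rw [mul_assoc, ← mul_assoc g.1, mul_J_mul_transpose]
  have hpow : ∀ k : ℕ, J l F * (g.1ᵀ) ^ k = (g⁻¹ : symplecticGroup l F).1 ^ k * J l F := by
    intro k
    induction k with
    | zero => simp
    | succ k ih => rw [pow_succ, ← mul_assoc, ih, mul_assoc, h1, pow_succ, mul_assoc]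
  induction f using Polynomial.induction_on' with
  | add p q hp hq => rw [map_add, transpose_add, mul_add, hp, hq, map_add, add_mul]
  | monomial k a =>
    rw [aeval_monomial, aeval_monomial, ← Algebra.smul_def, ← Algebra.smul_def, transpose_smul,
      transpose_pow, mul_smul_comm, hpow, smul_mul_assoc]

/-- Elements of the symplectic group commuting with an element with irreducible characteristic
polynomial correspond to elements of relative norm one. -/
theorem SymplecticGroup.exists_norm_one_of_commute {g : symplecticGroup l F}
    (hg : Irreducible g.1.charpoly) {β : E} (hβ : aeval β g.1.charpoly = 0) (σ : E →ₐ[F] E)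
    (hσ : β * σ β = 1) {C : symplecticGroup l F} (hC : Commute C g) :
    ∃ f : F[X], C.1 = aeval g.1 f ∧ aeval β f * σ (aeval β f) = 1 := by
  have hcoe : ∀ {x : symplecticGroup l F}, Commute x g → Commute x.1 g.1 := fun h =>
    congrArg Subtype.val h.eq
  obtain ⟨f, hf⟩ := exists_aeval_eq_of_commute hg (hcoe hC)
  obtain ⟨h, hh⟩ := exists_aeval_eq_of_commute hg (hcoe (Commute.refl g).inv_left)
  refine ⟨f, hf, ?_⟩
  have key := aeval_eq_zero_iff_of_irreducible_charpoly hg hβ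
  have h1 : β * aeval β h = 1 := by
    have := (key (X * h - 1)).1 (by
      rw [map_sub, map_mul, aeval_X, ← hh, map_one, ← Submonoid.coe_mul, mul_inv_cancel]
      exact sub_self _)
    simpa [sub_eq_zero] using this
  have h2 : aeval β h = σ β := by
    have : β ≠ 0 := left_ne_zero_of_mul_eq_one h1
    exact mul_left_cancel₀ this (h1.trans hσ.symm)
  have h3 : aeval g.1 f * aeval (g⁻¹ : symplecticGroup l F).1 f = 1 := by
    have := mul_J_mul_transpose C
    rw [mul_assoc, hf, J_mul_transpose_aeval, ← mul_assoc] at this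
    have hJ : IsUnit (J l F) := (isUnit_iff_isUnit_det _).2 (isUnit_det_J l F)
    exact hJ.mul_right_cancel (by rw [this, one_mul])
  have h4 := (key (f * f.comp h - 1)).1 (by
    rw [map_sub, map_mul, aeval_comp, ← hh, h3, map_one, sub_self])
  rw [map_sub, map_mul, aeval_comp, h2, aeval_algHom_apply, map_one, sub_eq_zero] at h4
  exact h4

theorem SymplecticGroup.card_centralizer_le {g : symplecticGroup l F}
    (hg : Irreducible g.1.charpoly) {β : E} (hβ : aeval β g.1.charpoly = 0) (σ : E →ₐ[F] E)
    (q : ℕ) (hσq : ∀ x, σ x = x ^ q) (hσ : β ^ (q + 1) = 1) :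
    Nat.card {C : symplecticGroup l F // Commute C g} ≤ q + 1 := by
  classical
  choose! f hf using fun C (hC : Commute C g) => exists_norm_one_of_commute hg hβ σ
    (by rw [hσq, ← pow_succ', hσ]) hC
  let e : {C : symplecticGroup l F // Commute C g} → nthRootsFinset (q + 1) (1 : E) := fun C =>
    ⟨aeval β (f C), by
      rw [mem_nthRootsFinset q.succ_pos, pow_succ', ← hσq]; exact (hf C C.2).2⟩
  have he : Function.Injective e := by
    intro C D h
    have h1 : aeval β (f C) = aeval β (f D) := congrArg Subtype.val h
    have := (aeval_eq_zero_iff_of_irreducible_charpoly hg hβ (f C - f D)).2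
      (by rw [map_sub, h1, sub_self])
    rw [map_sub, sub_eq_zero, ← (hf C C.2).1, ← (hf D D.2).1] at this
    exact Subtype.ext (Subtype.ext this)
  calc _ ≤ Nat.card (nthRootsFinset (q + 1) (1 : E)) := Nat.card_le_card_of_injective e he
    _ = (nthRootsFinset (q + 1) (1 : E)).card := by rw [Nat.card_eq_fintype_card, Fintype.card_coe]
    _ ≤ (nthRoots (q + 1) (1 : E)).card := Multiset.toFinset_card_le _
    _ ≤ q + 1 := card_nthRoots _ _

end Centralizer

section TorusElement

open Polynomial Matrix

variable {F K E : Type*} [Field F] [Field K] [Field E] [Algebra F K] [Algebra F E]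

theorem aeval_charpoly_eq_zero_iff {n : Type*} [Fintype n] [DecidableEq n] (A : Matrix n n F)
    (β : E) : aeval β A.charpoly = 0 ↔
      ∃ v, v ≠ 0 ∧ A.map (algebraMap F E) *ᵥ v = β • v := by
  rw [← eval_map_algebraMap, ← charpoly_map, eval_charpoly, ← exists_mulVec_eq_zero_iff]
  simp only [sub_mulVec, scalar_apply, ← smul_one_eq_diagonal, smul_mulVec, one_mulVec,
    sub_eq_zero]
  exact exists_congr fun v => and_congr_right fun _ => eq_comm

theorem isSymm_traceMatrix_mul_leftMulMatrix {ι : Type*} [Fintype ι] [DecidableEq ι]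
    (b : Module.Basis ι F K) (x : K) :
    (Algebra.traceMatrix F b * Algebra.leftMulMatrix b x).IsSymm := by
  have key : ∀ i j, (Algebra.traceMatrix F b * Algebra.leftMulMatrix b x) i j =
      Algebra.trace F K (x * b j * b i) := by
    intro i j
    rw [← congrFun (Algebra.traceMatrix_of_basis_mulVec b (x * b j)) i]
    simp [Matrix.mul_apply, mulVec, dotProduct, Algebra.leftMulMatrix_eq_repr_mul]
  ext i j
  rw [transpose_apply, key, key]
  congr 1
  ring

theorem SymplecticGroup.exists_charpoly_eq_minpoly {m : ℕ} [FiniteDimensional F K]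
    [Algebra.IsSeparable F K] (hK : Module.finrank F K = m) (ι : K →ₐ[F] E) {α : K} {β : E}
    (hαβ : β * ι α = β * β + 1) (hβ_int : IsIntegral F β) (hdeg : (minpoly F β).natDegree = 2 * m) :
    ∃ g : symplecticGroup (Fin m) F, g.1.charpoly = minpoly F β := by
  let b := Module.finBasisOfFinrankEq F K hK
  set A := Algebra.leftMulMatrix b α
  set s := Algebra.traceMatrix F b
  have hs : IsUnit s.det := (Algebra.discr_not_zero_of_basis F b).isUnit
  have hsym : sᵀ = s := by
    ext i j
    simp [s, Algebra.traceMatrix_apply, mul_comm]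
  have hsA : Aᵀ * s = s * A := by
    have := isSymm_traceMatrix_mul_leftMulMatrix b α
    rw [IsSymm, transpose_mul] at this
    exact (congrArg (Aᵀ * ·) hsym.symm).trans this
  let g : symplecticGroup (Fin m) F := ⟨fromBlocks A (-s⁻¹) s 0, by
    rw [fromBlocks_mem_iff]
    simp [hsym, hsA, mul_nonsing_inv _ hs]⟩
  have hα : aeval (ι α) A.charpoly = 0 := by
    rw [aeval_algHom_apply, map_eq_zero]
    apply Algebra.leftMulMatrix_injective b
    rw [← aeval_algHom_apply, map_zero]
    exact aeval_self_charpoly _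
  obtain ⟨v, hv, hAv⟩ := (aeval_charpoly_eq_zero_iff A (ι α)).1 hα
  have hβ : aeval β g.1.charpoly = 0 := by
    refine (aeval_charpoly_eq_zero_iff _ β).2
      ⟨Sum.elim (β • v) (s.map (algebraMap F E) *ᵥ v), ?_, ?_⟩
    · intro h
      have hβ0 : β ≠ 0 := by
        rintro rfl
        simp at hαβ
      have h1 : β • v = 0 := funext fun i => congrFun h (Sum.inl i)
      exact hv ((smul_eq_zero.1 h1).resolve_left hβ0)
    · have hss : (s⁻¹).map (algebraMap F E) * s.map (algebraMap F E) = 1 := by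
        rw [← Matrix.map_mul, nonsing_inv_mul _ hs]
        simp
      have hneg : (-s⁻¹).map (algebraMap F E) = -(s⁻¹).map (algebraMap F E) := by
        ext; simp
      have hz : (0 : Matrix (Fin m) (Fin m) F).map (algebraMap F E) = 0 := by
        ext; simp
      simp only [g, fromBlocks_map, fromBlocks_mulVec, hneg, hz, Sum.elim_comp_inl,
        Sum.elim_comp_inr, mulVec_smul, hAv, neg_mulVec, mulVec_mulVec, neg_mul, hss, one_mulVec]
      ext (i | i)
      · simp only [Sum.elim_inl, Pi.add_apply, Pi.smul_apply, Pi.neg_apply, smul_eq_mul]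
        linear_combination v i * hαβ
      · simp
  refine ⟨g, ?_⟩
  refine eq_of_monic_of_dvd_of_natDegree_le (minpoly.monic hβ_int) g.1.charpoly_monic
    (minpoly.dvd _ _ hβ) ?_
  rw [hdeg, charpoly_natDegree_eq_dim]
  simp [two_mul]

end TorusElement

section FiniteField

open Polynomial

theorem two_mul_sum_pow_add_three_le {p m : ℕ} (hp : 3 ≤ p) (hm : m ≠ 0) :
    2 * ∑ d ∈ Finset.Ico 1 m, p ^ d + 3 ≤ p ^ m := by
  induction m with
  | zero => exact absurd rfl hm
  | succ m ih =>
    rcases Nat.eq_zero_or_pos m with rfl | h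
    · simpa using hp
    · rw [Finset.sum_Ico_succ_top h, pow_succ]
      have := ih h.ne'
      have h3 := Nat.mul_le_mul_left (p ^ m) hp
      simp only [Nat.succ_eq_add_one, zero_add]
      linarith

variable {p : ℕ} [Fact p.Prime] {m : ℕ} {E : Type*} [Field E] [Algebra (ZMod p) E]

theorem pow_natDegree_minpoly [Finite E] (β : E) :
    β ^ p ^ (minpoly (ZMod p) β).natDegree = β := by
  have : FiniteDimensional (ZMod p) E := .of_finite
  have hβ_int : IsIntegral (ZMod p) β := Algebra.IsIntegral.isIntegral β
  have := Fintype.ofFinite (IntermediateField.adjoin (ZMod p) {β})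
  have h := FiniteField.pow_card (IntermediateField.AdjoinSimple.gen (ZMod p) β)
  rw [← Nat.card_eq_fintype_card, Module.natCard_eq_pow_finrank (K := ZMod p), Nat.card_zmod,
    IntermediateField.adjoin.finrank hβ_int] at h
  exact congrArg Subtype.val h

theorem card_nthRootsFinset_of_dvd {E : Type*} [Field E] [Finite E] {n : ℕ}
    (hn : n ∣ Nat.card E - 1) :
    (nthRootsFinset n (1 : E)).card = n := by
  obtain ⟨g, hg⟩ := IsCyclic.exists_ofOrder_eq_natCard (α := Eˣ)
  obtain ⟨k, hk⟩ := hn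
  rw [Nat.card_units, hk] at hg
  have hk0 : k ≠ 0 := by
    rintro rfl
    have := Finite.one_lt_card (α := E)
    omega
  refine IsPrimitiveRoot.card_nthRootsFinset (ζ := ((g ^ k : Eˣ) : E)) ?_
  rw [IsPrimitiveRoot.coe_units_iff]
  have := IsPrimitiveRoot.orderOf (g ^ k)
  rwa [orderOf_pow_of_dvd hk0 (hg ▸ Dvd.intro_left _ rfl), hg,
    Nat.mul_div_cancel _ (Nat.pos_of_ne_zero hk0)] at this

theorem exists_algHom_apply_eq (hm : m ≠ 0)
    (ι : GaloisField p m →ₐ[ZMod p] E) {α : E} (hα : α ^ p ^ m = α) : ∃ a, ι a = α := by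
  classical
  have hp : 1 < p := (Fact.out : p.Prime).one_lt
  have := Fintype.ofFinite (GaloisField p m)
  have hq : 1 < p ^ m := Nat.one_lt_pow hm hp
  have hne : (X ^ p ^ m - X : E[X]) ≠ 0 := FiniteField.X_pow_card_sub_X_ne_zero E hq
  have hsub : Finset.univ.image ι ⊆ (X ^ p ^ m - X : E[X]).roots.toFinset := by
    intro x hx
    obtain ⟨a, -, rfl⟩ := Finset.mem_image.1 hx
    have := FiniteField.pow_card a
    rw [← Nat.card_eq_fintype_card, GaloisField.card p m hm] at this
    simp [hne, ← map_pow, this]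
  have heq := Finset.eq_of_subset_of_card_le hsub (by
    rw [Finset.card_image_of_injective (f := ι) _ ι.toRingHom.injective, Finset.card_univ,
      ← Nat.card_eq_fintype_card,
      GaloisField.card p m hm]
    refine (Multiset.toFinset_card_le _).trans ((card_roots' _).trans ?_)
    rw [FiniteField.X_pow_card_sub_X_natDegree_eq E hq])
  have : α ∈ Finset.univ.image ι := by
    rw [heq]
    simp [hne, hα]
  simpa using this

/-- At least half of the elements of relative norm one generate the field of order `p ^ (2 * m)`. -/
theorem card_norm_one_generators [Finite E] (hp : 3 ≤ p) (hm : m ≠ 0)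
    (hE : Module.finrank (ZMod p) E = 2 * m) :
    p ^ m + 1 ≤ 2 * ((nthRootsFinset (p ^ m + 1) (1 : E)).filter fun β =>
      (minpoly (ZMod p) β).natDegree = 2 * m).card := by
  classical
  have : FiniteDimensional (ZMod p) E := .of_finite
  have hp0 : 0 < p := by omega
  have hcard : Nat.card E = p ^ (2 * m) := by
    rw [Module.natCard_eq_pow_finrank (K := ZMod p), hE, Nat.card_zmod]
  have hU : (nthRootsFinset (p ^ m + 1) (1 : E)).card = p ^ m + 1 := by
    refine card_nthRootsFinset_of_dvd ⟨p ^ m - 1, ?_⟩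
    rw [hcard, ← Nat.sq_sub_sq, ← pow_mul, mul_comm m 2, one_pow]
  have hbad : ((nthRootsFinset (p ^ m + 1) (1 : E)).filter fun β =>
      ¬ (minpoly (ZMod p) β).natDegree = 2 * m) ⊆
      nthRootsFinset 2 (1 : E) ∪ (Finset.Ico 1 m).biUnion fun d =>
        (X ^ p ^ d - X : E[X]).roots.toFinset := by
    intro β hβ
    rw [Finset.mem_filter, mem_nthRootsFinset (Nat.succ_pos _)] at hβ
    obtain ⟨hβ1, hβ2⟩ := hβ
    have hβ_int : IsIntegral (ZMod p) β := Algebra.IsIntegral.isIntegral β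
    have hdvd : (minpoly (ZMod p) β).natDegree ∣ 2 * m := hE ▸ minpoly.degree_dvd hβ_int
    have hpow := pow_natDegree_minpoly (p := p) β
    have hpos := minpoly.natDegree_pos hβ_int
    set d := (minpoly (ZMod p) β).natDegree
    have hdm : d ≤ m := by
      obtain ⟨c, hc⟩ := hdvd
      have : 2 ≤ c := by
        by_contra! h
        interval_cases c <;> omega
      nlinarith
    rw [Finset.mem_union]
    rcases hdm.eq_or_lt with h | h
    · left
      rw [mem_nthRootsFinset two_pos, sq]
      rw [h] at hpow
      rwa [pow_succ, hpow] at hβ1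
    · right
      refine Finset.mem_biUnion.2 ⟨d, Finset.mem_Ico.2 ⟨hpos, h⟩, ?_⟩
      have hne : (X ^ p ^ d - X : E[X]) ≠ 0 :=
        FiniteField.X_pow_card_sub_X_ne_zero E (Nat.one_lt_pow hpos.ne' (by omega))
      simp [hne, hpow]
  have hbadcard : ((nthRootsFinset (p ^ m + 1) (1 : E)).filter fun β =>
      ¬ (minpoly (ZMod p) β).natDegree = 2 * m).card ≤ 2 + ∑ d ∈ Finset.Ico 1 m, p ^ d := by
    refine (Finset.card_le_card hbad).trans ((Finset.card_union_le _ _).trans ?_)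
    gcongr
    · exact (Multiset.toFinset_card_le _).trans (card_nthRoots _ _)
    · refine Finset.card_biUnion_le.trans (Finset.sum_le_sum fun d hd => ?_)
      rw [Finset.mem_Ico] at hd
      refine (Multiset.toFinset_card_le _).trans ((card_roots' _).trans ?_)
      rw [FiniteField.X_pow_card_sub_X_natDegree_eq E (Nat.one_lt_pow (by omega) (by omega))]
  have hsplit := Finset.card_filter_add_card_filter_not (s := nthRootsFinset (p ^ m + 1) (1 : E))
    (fun β => (minpoly (ZMod p) β).natDegree = 2 * m)
  have := two_mul_sum_pow_add_three_le hp hm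
  omega

end FiniteField

namespace SymplecticGroup

open Polynomial Matrix

theorem charpoly_conj {l R : Type*} [Fintype l] [DecidableEq l] [CommRing R]
    (x g : symplecticGroup l R) : (x * g * x⁻¹).1.charpoly = g.1.charpoly := by
  rw [mul_assoc, Submonoid.coe_mul, charpoly_mul_comm, ← Submonoid.coe_mul, mul_assoc,
    inv_mul_cancel, mul_one]

variable {p : ℕ} [Fact p.Prime] {m : ℕ}

theorem card_filter_conj_eq_le {G : Type*} [Group G] [Fintype G] [DecidableEq G] {c : ℕ} {g : G}
    (hg : Nat.card {C : G // Commute C g} ≤ c) (y : G) :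
    (Finset.univ.filter fun x => x * g * x⁻¹ = y).card ≤ c := by
  rcases (Finset.univ.filter fun x => x * g * x⁻¹ = y).eq_empty_or_nonempty with h | ⟨x₀, hx₀⟩
  · simp [h]
  · rw [← Fintype.card_coe, ← Nat.card_eq_fintype_card]
    refine (Nat.card_le_card_of_injective (β := {C : G // Commute C g})
      (fun x => ⟨x₀⁻¹ * x.1, ?comm⟩) ?inj).trans hg
    case comm =>
      have h1 : x₀ * g * x₀⁻¹ = y := (Finset.mem_filter.1 hx₀).2
      have h2 : x.1 * g * x.1⁻¹ = y := (Finset.mem_filter.1 x.2).2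
      rw [mul_inv_eq_iff_eq_mul] at h1 h2
      change x₀⁻¹ * x.1 * g = g * (x₀⁻¹ * x.1)
      rw [mul_assoc, h2, ← mul_assoc, ← mul_assoc]
      congr 1
      rw [inv_mul_eq_iff_eq_mul, ← mul_assoc, h1, mul_inv_cancel_right]
    case inj =>
      intro a b h
      exact Subtype.ext (mul_left_cancel (congrArg Subtype.val h))

theorem exists_charpoly_eq_minpoly_of_norm_one (hm : m ≠ 0) {β : GaloisField p (2 * m)}
    (hβ : β ^ (p ^ m + 1) = 1) (hdeg : (minpoly (ZMod p) β).natDegree = 2 * m) :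
    ∃ g : symplecticGroup (Fin m) (ZMod p), g.1.charpoly = minpoly (ZMod p) β := by
  have hm2 : 2 * m ≠ 0 := by omega
  have hβ_int : IsIntegral (ZMod p) β := by
    by_contra h
    rw [minpoly.eq_zero h] at hdeg
    simp at hdeg
    omega
  obtain ⟨ι⟩ : Nonempty (GaloisField p m →ₐ[ZMod p] GaloisField p (2 * m)) := by
    apply FiniteField.nonempty_algHom_of_finrank_dvd
    rw [GaloisField.finrank p hm, GaloisField.finrank p hm2]
    exact Dvd.intro_left 2 rfl
  have hβ0 : β ≠ 0 := by
    rintro rfl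
    simp at hβ
  have hinv : β ^ p ^ m = β⁻¹ := by
    rw [pow_succ] at hβ
    exact eq_inv_of_mul_eq_one_left hβ
  obtain ⟨α, hα⟩ := exists_algHom_apply_eq hm ι (α := β + β⁻¹) (by
    rw [add_pow_char_pow, inv_pow, hinv, inv_inv, add_comm])
  refine exists_charpoly_eq_minpoly (GaloisField.finrank p hm) ι (α := α) ?_ hβ_int hdeg
  rw [hα, mul_add, mul_inv_cancel₀ hβ0]

/-- A positive proportion of the symplectic group over a finite prime field has irreducible
characteristic polynomial. -/
theorem card_le_mul_card_irreducible_charpoly (hp : 3 ≤ p) (hm : m ≠ 0) :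
    Nat.card (symplecticGroup (Fin m) (ZMod p)) ≤ 4 * m *
      Nat.card {g : symplecticGroup (Fin m) (ZMod p) // Irreducible g.1.charpoly} := by
  classical
  have := Fintype.ofFinite (symplecticGroup (Fin m) (ZMod p))
  have hm2 : 2 * m ≠ 0 := by omega
  have : FiniteDimensional (ZMod p) (GaloisField p (2 * m)) := .of_finite
  set T := (nthRootsFinset (p ^ m + 1) (1 : GaloisField p (2 * m))).filter fun β =>
      (minpoly (ZMod p) β).natDegree = 2 * m with hT
  have hTcard : p ^ m + 1 ≤ 2 * T.card :=
    card_norm_one_generators hp hm (GaloisField.finrank p hm2)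
  have hTmem : ∀ β ∈ T, β ^ (p ^ m + 1) = 1 ∧ (minpoly (ZMod p) β).natDegree = 2 * m := by
    intro β hβ
    rwa [hT, Finset.mem_filter, mem_nthRootsFinset (Nat.succ_pos _)] at hβ
  have hex : ∀ β ∈ T, ∃ g : symplecticGroup (Fin m) (ZMod p),
      g.1.charpoly = minpoly (ZMod p) β := fun β hβ =>
    exists_charpoly_eq_minpoly_of_norm_one hm (hTmem β hβ).1 (hTmem β hβ).2
  choose! g hg using hex
  have hirr : ∀ β ∈ T, Irreducible (g β).1.charpoly := fun β hβ => by
    rw [hg β hβ]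
    exact minpoly.irreducible (Algebra.IsIntegral.isIntegral β)
  have hcent : ∀ β ∈ T,
      Nat.card {C : symplecticGroup (Fin m) (ZMod p) // Commute C (g β)} ≤ p ^ m + 1 := by
    intro β hβ
    refine card_centralizer_le (hirr β hβ) (by rw [hg β hβ, minpoly.aeval])
      (FiniteField.frobeniusAlgHom (ZMod p) (GaloisField p (2 * m)) ^ m) _ (fun x => ?_)
      (hTmem β hβ).1
    rw [AlgHom.coe_pow, FiniteField.coe_frobeniusAlgHom, pow_iterate, ZMod.card]
  let φ : GaloisField p (2 * m) × symplecticGroup (Fin m) (ZMod p) →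
    symplecticGroup (Fin m) (ZMod p) := fun x => x.2 * g x.1 * x.2⁻¹
  have hfib : ∀ y ∈ (T ×ˢ Finset.univ).image φ,
      ((T ×ˢ Finset.univ).filter fun x => φ x = y).card ≤ (p ^ m + 1) * (2 * m) := by
    intro y _
    refine (Finset.card_le_mul_card_image (f := Prod.fst) _ (p ^ m + 1) ?_).trans ?_
    · intro β hβ
      obtain ⟨⟨β', x⟩, hx, rfl⟩ := Finset.mem_image.1 hβ
      have hβT : β' ∈ T := (Finset.mem_product.1 (Finset.mem_filter.1 hx).1).1
      refine le_trans ?_ (card_filter_conj_eq_le (hcent β' hβT) y)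
      refine Finset.card_le_card_of_injOn Prod.snd ?_ ?_
      · rintro ⟨b, z⟩ hz
        simp only [Finset.coe_filter, Finset.mem_filter, Set.mem_ofPred_eq] at hz
        obtain ⟨⟨-, h1⟩, rfl⟩ := hz
        simpa [φ] using h1
      · rintro ⟨b, z⟩ hz ⟨b', z'⟩ hz' h
        simp only [Finset.coe_filter, Finset.mem_filter, Set.mem_ofPred_eq] at hz hz'
        rw [Prod.mk.injEq]
        exact ⟨hz.2.trans hz'.2.symm, h⟩
    · gcongr
      have hy0 : y.1.charpoly.map (algebraMap (ZMod p) (GaloisField p (2 * m))) ≠ 0 :=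
        (y.1.charpoly_monic.map _).ne_zero
      calc _ ≤ (y.1.charpoly.map
            (algebraMap (ZMod p) (GaloisField p (2 * m)))).roots.toFinset.card := by
            refine Finset.card_le_card fun β hβ => ?_
            obtain ⟨⟨β', x⟩, hx, rfl⟩ := Finset.mem_image.1 hβ
            rw [Finset.mem_filter, Finset.mem_product] at hx
            rw [Multiset.mem_toFinset, mem_roots hy0, IsRoot.def, eval_map_algebraMap, ← hx.2]
            simp only [φ]
            rw [charpoly_conj, hg _ hx.1.1, minpoly.aeval]
        _ ≤ _ := (Multiset.toFinset_card_le _).trans (card_roots' _)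
        _ = 2 * m := by
            rw [(y.1.charpoly_monic).natDegree_map, charpoly_natDegree_eq_dim]
            simp [two_mul]
  have h1 := Finset.card_le_mul_card_image _ _ hfib
  have h2 : ((T ×ˢ Finset.univ).image φ).card ≤
      Nat.card {g : symplecticGroup (Fin m) (ZMod p) // Irreducible g.1.charpoly} := by
    rw [Nat.card_eq_fintype_card, Fintype.card_subtype]
    refine Finset.card_le_card fun y hy => ?_
    obtain ⟨⟨β, x⟩, hx, rfl⟩ := Finset.mem_image.1 hy
    rw [Finset.mem_filter]
    refine ⟨Finset.mem_univ _, ?_⟩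
    simp only [φ]
    rw [charpoly_conj]
    exact hirr β (Finset.mem_product.1 hx).1
  rw [Finset.card_product, Finset.card_univ, ← Nat.card_eq_fintype_card] at h1
  refine le_of_mul_le_mul_left (a := p ^ m + 1) ?_ (Nat.succ_pos _)
  calc _ ≤ 2 * (T.card * Nat.card (symplecticGroup (Fin m) (ZMod p))) := by
        rw [← mul_assoc]; gcongr
    _ ≤ 2 * ((p ^ m + 1) * (2 * m) *
        Nat.card {g : symplecticGroup (Fin m) (ZMod p) // Irreducible g.1.charpoly}) := by
        exact Nat.mul_le_mul_left 2 (h1.trans (Nat.mul_le_mul_left _ h2))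
    _ = _ := by ring

end SymplecticGroup

namespace Matrix

open Polynomial

variable {n R : Type*} [Fintype n] [DecidableEq n] [CommRing R]

theorem charpoly_neg (A : Matrix n n R) :
    (-A).charpoly = (-1) ^ Fintype.card n * algEquivAevalNegX A.charpoly := by
  have h : (algEquivAevalNegX : R[X] ≃ₐ[R] R[X]).mapMatrix (charmatrix A) =
      -charmatrix (-A) := by
    ext1 i j
    by_cases hij : i = j <;> simp [hij, algEquivAevalNegX, sub_eq_add_neg, add_comm]
  rw [charpoly, charpoly, AlgEquiv.map_det, h, det_neg, ← mul_assoc, ← mul_pow]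
  simp

theorem irreducible_charpoly_neg_iff (A : Matrix n n R) :
    Irreducible (-A).charpoly ↔ Irreducible A.charpoly := by
  rw [charpoly_neg, irreducible_isUnit_mul (isUnit_one.neg.pow _)]
  exact MulEquiv.irreducible_iff (algEquivAevalNegX : R[X] ≃ₐ[R] R[X])

end Matrix

/-- A Chebyshev-type bound for events that every one of a family of nearly uncorrelated
random variables detects. -/
theorem card_mul_sq_le_of_nearly_uncorrelated {Ω ι : Type*} [Fintype Ω] {P : Finset ι}
    (hP : P.Nonempty) {X : ι → Ω → ℝ} {d η : ℝ} (hd : 0 ≤ d) (hη : 0 ≤ η)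
    (hX : ∀ p ∈ P, ∀ ω, |X p ω| ≤ 1)
    (hcorr : ∀ p ∈ P, ∀ q ∈ P, p ≠ q → ∑ ω, X p ω * X q ω ≤ Fintype.card Ω * η)
    {Z : Finset Ω} (hZ : ∀ p ∈ P, ∀ ω ∈ Z, X p ω ≤ -d) :
    Z.card * d ^ 2 ≤ Fintype.card Ω * ((P.card : ℝ)⁻¹ + η) := by
  classical
  have hPc : (0 : ℝ) < P.card := by exact_mod_cast hP.card_pos
  have h1 : Z.card * (d * P.card) ^ 2 ≤ ∑ ω, (∑ p ∈ P, X p ω) ^ 2 := by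
    calc _ = ∑ ω ∈ Z, (d * P.card) ^ 2 := by rw [Finset.sum_const, nsmul_eq_mul]
      _ ≤ ∑ ω ∈ Z, (∑ p ∈ P, X p ω) ^ 2 := by
          refine Finset.sum_le_sum fun ω hω => ?_
          have : ∑ p ∈ P, X p ω ≤ -(d * P.card) := by
            calc _ ≤ ∑ _p ∈ P, -d := Finset.sum_le_sum fun p hp => hZ p hp ω hω
              _ = _ := by rw [Finset.sum_const, nsmul_eq_mul]; ring
          have h0 : 0 ≤ d * P.card := by positivity
          nlinarith
      _ ≤ _ := Finset.sum_le_sum_of_subset_of_nonneg (Finset.subset_univ _)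
          fun _ _ _ => sq_nonneg _
  have h2 : ∑ ω, (∑ p ∈ P, X p ω) ^ 2 = ∑ p ∈ P, ∑ q ∈ P, ∑ ω, X p ω * X q ω := by
    simp_rw [sq, Finset.sum_mul_sum]
    rw [Finset.sum_comm]
    exact Finset.sum_congr rfl fun p _ => Finset.sum_comm
  have h3 : ∑ p ∈ P, ∑ q ∈ P, ∑ ω, X p ω * X q ω ≤
      ∑ p ∈ P, ∑ q ∈ P, ((if p = q then (Fintype.card Ω : ℝ) else 0) + Fintype.card Ω * η) := by
    refine Finset.sum_le_sum fun p hp => Finset.sum_le_sum fun q hq => ?_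
    split_ifs with h
    · subst h
      have : ∑ ω, X p ω * X p ω ≤ ∑ _ω : Ω, (1 : ℝ) := Finset.sum_le_sum fun ω _ => by
        have := hX p hp ω
        rw [← abs_mul_abs_self]
        nlinarith [abs_nonneg (X p ω)]
      have h0 : 0 ≤ Fintype.card Ω * η := by positivity
      simp only [Finset.sum_const, Finset.card_univ, nsmul_eq_mul, mul_one] at this
      linarith
    · simpa using hcorr p hp q hq h
  have h4 : ∑ p ∈ P, ∑ q ∈ P,
      ((if p = q then (Fintype.card Ω : ℝ) else 0) + Fintype.card Ω * η) =
      P.card ^ 2 * (Fintype.card Ω * ((P.card : ℝ)⁻¹ + η)) := by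
    simp only [Finset.sum_add_distrib, Finset.sum_ite_eq, Finset.sum_const, nsmul_eq_mul]
    rw [Finset.sum_congr rfl fun p hp => if_pos hp, Finset.sum_const, nsmul_eq_mul]
    field_simp
  have h5 : (P.card : ℝ) ^ 2 * (Z.card * d ^ 2) ≤
      P.card ^ 2 * (Fintype.card Ω * ((P.card : ℝ)⁻¹ + η)) := by
    rw [← h4]
    refine le_trans (le_of_eq ?_) (h1.trans (h2.trans_le h3))
    ring
  exact le_of_mul_le_mul_left h5 (by positivity)

theorem eventually_sqrt_le_card_primes_Ioc (N : ℕ) :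
    ∀ᶠ L : ℕ in Filter.atTop,
      √(L : ℝ) ≤ (((Finset.Ioc N L).subtype Nat.Prime).card : ℝ) := by
  have hlog : ∀ᶠ x : ℝ in Filter.atTop, Real.log x ≤ 1 / 8 * √x := by
    have := (isLittleO_log_rpow_atTop (r := 1 / 2) (by norm_num)).bound
      (show (0 : ℝ) < 1 / 8 by norm_num)
    filter_upwards [this, Filter.eventually_ge_atTop 1] with x hx hx1
    rw [← Real.sqrt_eq_rpow, Real.norm_of_nonneg (Real.log_nonneg hx1),
      Real.norm_of_nonneg (Real.sqrt_nonneg _)] at hx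
    exact hx
  filter_upwards [tendsto_natCast_atTop_atTop.eventually hlog,
    Filter.eventually_ge_atTop (N ^ 2 + 2)] with L h1 h2
  have hL2 : (2 : ℝ) ≤ L := by exact_mod_cast (show 2 ≤ L by omega)
  have hlogpos : 0 < Real.log L := Real.log_pos (by linarith)
  have hcount : L.primeCounting ≤ N + ((Finset.Ioc N L).subtype Nat.Prime).card := by
    rw [Finset.card_subtype, Nat.primeCounting, Nat.primeCounting', Nat.count_eq_card_filter_range]
    calc _ ≤ (Finset.Ioc 0 N ∪ (Finset.Ioc N L).filter Nat.Prime).card := by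
          refine Finset.card_le_card fun p hp => ?_
          simp only [Finset.mem_filter, Finset.mem_range, Finset.mem_union, Finset.mem_Ioc] at hp ⊢
          have := hp.2.pos
          by_cases h : p ≤ N
          · exact .inl ⟨this, h⟩
          · exact .inr ⟨⟨by omega, by omega⟩, hp.2⟩
      _ ≤ _ := (Finset.card_union_le _ _).trans (by simp)
  have hN : (N : ℝ) ≤ √L := Real.le_sqrt_of_sq_le (by exact_mod_cast (by omega : N ^ 2 ≤ L))
  have hs : √(L : ℝ) * √L = L := Real.mul_self_sqrt (by positivity)
  have hs1 : 1 ≤ √(L : ℝ) := Real.one_le_sqrt.2 (by linarith)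
  have hlog1 : Real.log (L + 1) ≤ 2 * Real.log L := by
    rw [← Real.log_rpow (by linarith), Real.rpow_two]
    exact Real.log_le_log (by linarith) (by nlinarith)
  have hpi := (div_le_iff₀ hlogpos).1 (Chebyshev.pi_ge L)
  have hlog2 := Real.log_two_gt_d9
  have hcount' : (L.primeCounting : ℝ) ≤
      N + ((Finset.Ioc N L).subtype Nat.Prime).card := by exact_mod_cast hcount
  by_contra! hlt
  have h3 : (L.primeCounting : ℝ) ≤ 2 * √L := by linarith
  have h4 : L * Real.log 2 - Real.log (L + 1) ≤ 2 * √L * (1 / 8 * √L) :=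
    hpi.trans (by gcongr)
  nlinarith

namespace SymplecticGroup

open Polynomial Matrix

section IrreducibleClasses

variable {m : ℕ}

/-- The classes in the projective symplectic group of the matrices with irreducible
characteristic polynomial. -/
def irreducibleClasses (m : ℕ) (R : Type*) [CommRing R] : Set (ProjSp m R) :=
  {x | ∃ g : symplecticGroup (Fin m) R, QuotientGroup.mk' (Subgroup.center _) g = x ∧
    Irreducible g.1.charpoly}

theorem mk_mem_irreducibleClasses_iff {R : Type*} [CommRing R] [IsDomain R]
    (g : symplecticGroup (Fin m) R) :
    QuotientGroup.mk' (Subgroup.center _) g ∈ irreducibleClasses m R ↔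
      Irreducible g.1.charpoly := by
  refine ⟨?_, fun h => ⟨g, rfl, h⟩⟩
  rintro ⟨h, hgh, hirr⟩
  obtain ⟨z, hz, rfl⟩ := (QuotientGroup.mk'_eq_mk' _).1 hgh
  rw [Submonoid.coe_mul]
  rcases eq_one_or_eq_neg_one_of_mem_center hz with hz | hz <;> rw [hz]
  · rwa [mul_one]
  · rwa [mul_neg, mul_one, irreducible_charpoly_neg_iff]

theorem card_projSp_le_mul_card_irreducibleClasses (hm : m ≠ 0) {p : ℕ} [Fact p.Prime]
    (hp : 3 ≤ p) :
    Nat.card (ProjSp m (ZMod p)) ≤ 4 * m * Nat.card (irreducibleClasses m (ZMod p)) := by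
  have h := card_le_mul_card_irreducible_charpoly hp hm
  have hc : Nat.card {g : symplecticGroup (Fin m) (ZMod p) // Irreducible g.1.charpoly} =
      Nat.card (Subgroup.center (symplecticGroup (Fin m) (ZMod p))) *
        Nat.card (irreducibleClasses m (ZMod p)) := by
    rw [← Nat.card_prod, ← Nat.card_congr (QuotientGroup.preimageMkEquivSubgroupProdSet
      (Subgroup.center (symplecticGroup (Fin m) (ZMod p))) (irreducibleClasses m (ZMod p)))]
    exact Nat.card_congr (Equiv.subtypeEquivRight fun g =>
      (mk_mem_irreducibleClasses_iff g).symm)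
  rw [hc, Subgroup.card_eq_card_quotient_mul_card_subgroup (Subgroup.center _)] at h
  have hpos : 0 < Nat.card (Subgroup.center (symplecticGroup (Fin m) (ZMod p))) := Nat.card_pos
  refine Nat.le_of_mul_le_mul_right (h.trans (le_of_eq ?_)) hpos
  ring

theorem projMap_notMem_irreducibleClasses {A : symplecticGroup (Fin m) ℤ}
    (hA : ¬ Irreducible (A.1.charpoly.map (Int.castRingHom ℚ))) (p : ℕ) [Fact p.Prime] :
    projMap (Int.castRingHom (ZMod p)) (QuotientGroup.mk' (Subgroup.center _) A) ∉
      irreducibleClasses m (ZMod p) := by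
  intro h
  have h' : Irreducible (mapHom (Int.castRingHom (ZMod p)) A).1.charpoly :=
    (mk_mem_irreducibleClasses_iff _).1 h
  rw [coe_mapHom, charpoly_map] at h'
  exact hA ((A.1.charpoly_monic.irreducible_iff_irreducible_map_fraction_map (K := ℚ)).1
    (A.1.charpoly_monic.irreducible_of_irreducible_map _ _ h'))

/-- The centred indicator function of the irreducible classes. -/
noncomputable def centredIndicator (m p : ℕ) (x : ProjSp m (ZMod p)) : ℝ :=
  (irreducibleClasses m (ZMod p)).indicator 1 x -
    Nat.card (irreducibleClasses m (ZMod p)) / Nat.card (ProjSp m (ZMod p))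

variable (m) (p : ℕ) [Fact p.Prime]

theorem finsum_centredIndicator : ∑ᶠ x, centredIndicator m p x = 0 := by
  classical
  have := Fintype.ofFinite (ProjSp m (ZMod p))
  rw [finsum_eq_sum_of_fintype]
  simp only [centredIndicator, Finset.sum_sub_distrib, Finset.sum_const, nsmul_eq_mul,
    Finset.card_univ, ← Nat.card_eq_fintype_card]
  rw [mul_div_cancel₀ _ (by exact_mod_cast Nat.card_pos.ne'), sub_eq_zero]
  simp [Set.indicator_apply, Finset.sum_boole, Nat.card_eq_fintype_card, Fintype.card_subtype]

theorem abs_centredIndicator_le_one (x : ProjSp m (ZMod p)) : |centredIndicator m p x| ≤ 1 := by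
  have h0 : (0 : ℝ) ≤ Nat.card (irreducibleClasses m (ZMod p)) / Nat.card (ProjSp m (ZMod p)) := by
    positivity
  have h1 : (Nat.card (irreducibleClasses m (ZMod p)) / Nat.card (ProjSp m (ZMod p)) : ℝ) ≤ 1 :=
    div_le_one_of_le₀ (by exact_mod_cast Finite.card_subtype_le _) (by positivity)
  rw [centredIndicator, abs_le]
  by_cases h : x ∈ irreducibleClasses m (ZMod p) <;> simp only [h, Set.indicator_of_mem,
    Set.indicator_of_notMem, Pi.one_apply, not_false_eq_true] <;> constructor <;> linarith

variable {m p}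

theorem centredIndicator_le (hm : m ≠ 0) (hp : 3 ≤ p) {x : ProjSp m (ZMod p)}
    (hx : x ∉ irreducibleClasses m (ZMod p)) : centredIndicator m p x ≤ -(1 / (4 * m)) := by
  rw [centredIndicator, Set.indicator_of_notMem hx, zero_sub, neg_le_neg_iff]
  have hm' : (0 : ℝ) < m := by exact_mod_cast Nat.pos_of_ne_zero hm
  rw [div_le_div_iff₀ (by positivity) (by exact_mod_cast Nat.card_pos), one_mul, mul_comm]
  exact_mod_cast card_projSp_le_mul_card_irreducibleClasses hm hp

end IrreducibleClasses

variable {m : ℕ} {Γ : Type*} [Group Γ]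

theorem exists_walkProb_le (hm : 2 ≤ m) (ρ : Γ →* ProjSp m ℤ) (hρ : ρ.range.FiniteIndex)
    {S : Finset Γ} (hS : Admissible S) {Z : Set Γ}
    (hZ : ∀ γ ∈ Z, ∀ (p : ℕ) [Fact p.Prime],
      projMap (Int.castRingHom (ZMod p)) (ρ γ) ∉ irreducibleClasses m (ZMod p)) :
    ∃ N : ℕ, ∃ θ : ℝ, 0 < θ ∧ θ < 1 ∧ ∀ k L : ℕ,
      ((Finset.Ioc N L).subtype Nat.Prime).Nonempty →
      walkProb S k Z ≤ 16 * m ^ 2 *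
        ((((Finset.Ioc N L).subtype Nat.Prime).card : ℝ)⁻¹ + θ ^ k * L ^ (4 * m ^ 2)) := by
  classical
  obtain ⟨n, hn, θ, hθ0, hθ1, hdec⟩ := exists_decorrelation hm ρ hρ hS
  refine ⟨max n 2, θ, hθ0, hθ1, fun k L hP => ?_⟩
  have hprime : ∀ p : {p : ℕ // p.Prime}, Fact (p : ℕ).Prime := fun p => ⟨p.2⟩
  have hm0 : m ≠ 0 := by omega
  have hm' : (0 : ℝ) < m := by exact_mod_cast Nat.pos_of_ne_zero hm0
  have hcard : (Fintype.card (Fin k → S) : ℝ) = (S.card : ℝ) ^ k := by simp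
  have hmem : ∀ p ∈ (Finset.Ioc (max n 2) L).subtype Nat.Prime,
      n < (p : ℕ) ∧ 3 ≤ (p : ℕ) ∧ (p : ℕ) ≤ L := fun p hp => by
    have := Finset.mem_Ioc.1 (Finset.mem_subtype.1 hp)
    omega
  have hcop : ∀ p ∈ (Finset.Ioc (max n 2) L).subtype Nat.Prime, n.Coprime p := fun p hp =>
    Nat.Coprime.symm <|
    Nat.coprime_of_lt_prime hn.ne' (hmem p hp).1 p.2
  have key := card_mul_sq_le_of_nearly_uncorrelated hP (d := 1 / (4 * m))
    (η := θ ^ k * L ^ (4 * m ^ 2)) (by positivity) (by positivity)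
    (X := fun p (w : Fin k → S) => centredIndicator m p
      (projMap (Int.castRingHom (ZMod p)) (ρ (List.ofFn fun i => (w i : Γ)).prod)))
    (fun p _ w => abs_centredIndicator_le_one m p _)
    (fun p hp q hq hpq => ?_)
    (Z := Finset.univ.filter fun w : Fin k → S => (List.ofFn fun i => (w i : Γ)).prod ∈ Z)
    (fun p hp w hw => centredIndicator_le hm0 (hmem p hp).2.1
      (hZ _ (Finset.mem_filter.1 hw).2 p))
  · rw [hcard] at key
    have hSpos : (0 : ℝ) < (S.card : ℝ) ^ k := by
      have := hS.nonempty.card_pos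
      positivity
    rw [walkProb, div_le_iff₀ hSpos, Nat.card_eq_fintype_card, Fintype.card_subtype]
    have := mul_le_mul_of_nonneg_left key (show (0 : ℝ) ≤ 16 * m ^ 2 by positivity)
    refine le_trans (le_of_eq ?_) (this.trans (le_of_eq ?_))
    · field_simp
      norm_num
    · ring
  · refine (le_abs_self _).trans ((hdec p q (fun h => hpq (Subtype.ext h)) (hcop p hp) (hcop q hq)
      _ _ (finsum_centredIndicator m p) (abs_centredIndicator_le_one m p)
      (abs_centredIndicator_le_one m q) k).trans ?_)
    rw [hcard, mul_pow, mul_comm (θ ^ k), mul_assoc]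
    gcongr
    rw [Real.sqrt_le_left (by positivity), ← pow_mul, mul_comm (4 * m ^ 2) 2, pow_mul (L : ℝ)]
    have h1 : ((p : ℕ) : ℝ) ≤ L := by exact_mod_cast (hmem p hp).2.2
    have h2 : ((q : ℕ) : ℝ) ≤ L := by exact_mod_cast (hmem q hq).2.2
    gcongr
    rw [sq]
    gcongr

end SymplecticGroup

theorem walkProb_le_one {G : Type*} [Group G] (S : Finset G) (k : ℕ) (Z : Set G) :
    walkProb S k Z ≤ 1 := by
  refine div_le_one_of_le₀ ?_ (by positivity)
  exact_mod_cast (Finite.card_subtype_le _).trans_eq (by simp)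

/-- A bound of sieve type implies exponential smallness. -/
theorem expSmallWrt_of_sieve_bound {G : Type*} [Group G] {S : Finset G} {Z : Set G} {N D : ℕ}
    (hD : D ≠ 0) {C θ : ℝ} (hC : 0 ≤ C) (hθ0 : 0 < θ) (hθ1 : θ < 1)
    (h : ∀ k L : ℕ, ((Finset.Ioc N L).subtype Nat.Prime).Nonempty →
      walkProb S k Z ≤ C *
        ((((Finset.Ioc N L).subtype Nat.Prime).card : ℝ)⁻¹ + θ ^ k * L ^ D)) :
    ExpSmallWrt S Z := by
  obtain ⟨L₀, hL₀⟩ := Filter.eventually_atTop.1 (eventually_sqrt_le_card_primes_Ioc N)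
  have hD' : (0 : ℝ) < D := by exact_mod_cast Nat.pos_of_ne_zero hD
  obtain ⟨b, hb1, hb⟩ : ∃ b : ℝ, 1 < b ∧ θ * b ^ (4 * D) = 1 := by
    refine ⟨θ⁻¹ ^ (((4 * D : ℕ) : ℝ)⁻¹), Real.one_lt_rpow ((one_lt_inv₀ hθ0).2 hθ1)
      (by positivity), ?_⟩
    rw [Real.rpow_inv_natCast_pow (by positivity) (by omega), mul_inv_cancel₀ hθ0.ne']
  refine ⟨3 * C + (L₀ + 1), Real.log b, by positivity, Real.log_pos hb1, fun k => ?_⟩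
  have hexp : Real.exp (-Real.log b * k) = (b ^ k)⁻¹ := by
    rw [neg_mul, Real.exp_neg, mul_comm, Real.exp_nat_mul, Real.exp_log (by linarith)]
  set t := b ^ k with ht
  have ht1 : 1 ≤ t := one_le_pow₀ hb1.le
  have hθt : θ ^ k * t ^ (4 * D) = 1 := by
    rw [ht, ← pow_mul, mul_comm k, pow_mul, ← mul_pow, hb, one_pow]
  rw [hexp, ← div_eq_mul_inv, le_div_iff₀ (by positivity)]
  by_cases hL : L₀ ≤ ⌊t ^ 2⌋₊
  · set L := ⌊t ^ 2⌋₊ with hLdef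
    have hLle : (L : ℝ) ≤ t ^ 2 := Nat.floor_le (by positivity)
    have hLge : t / 2 ≤ √(L : ℝ) := by
      refine Real.le_sqrt_of_sq_le ?_
      have h1 : t ^ 2 < L + 1 := Nat.lt_floor_add_one _
      have h2 : (1 : ℝ) ≤ L := by
        exact_mod_cast Nat.le_floor (by exact_mod_cast one_le_pow₀ ht1)
      nlinarith
    have hcard := hLge.trans (hL₀ L hL)
    have hne : ((Finset.Ioc N L).subtype Nat.Prime).Nonempty := by
      rw [← Finset.card_pos]
      exact_mod_cast (show (0 : ℝ) < t / 2 by positivity).trans_le hcard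
    have h1 : (((Finset.Ioc N L).subtype Nat.Prime).card : ℝ)⁻¹ * t ≤ 2 := by
      rw [inv_mul_le_iff₀ (by linarith)]
      linarith
    have h2 : θ ^ k * L ^ D * t ≤ 1 := by
      calc _ ≤ θ ^ k * (t ^ 2) ^ D * t ^ (2 * D) := by
            gcongr
            exact le_self_pow₀ ht1 (by omega)
        _ = 1 := by rw [← hθt]; ring
    calc _ ≤ C * ((((Finset.Ioc N L).subtype Nat.Prime).card : ℝ)⁻¹ + θ ^ k * L ^ D) * t := by
          gcongr
          exact h k L hne
      _ = C * ((((Finset.Ioc N L).subtype Nat.Prime).card : ℝ)⁻¹ * t + θ ^ k * L ^ D * t) := by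
          ring
      _ ≤ C * (2 + 1) := by gcongr
      _ ≤ _ := by linarith [(Nat.cast_nonneg L₀ : (0 : ℝ) ≤ L₀)]
  · have h1 : t ^ 2 < L₀ := (Nat.floor_lt (by positivity)).1 (not_le.1 hL)
    have h2 := walkProb_le_one S k Z
    nlinarith

theorem reducible_lift_expSmall_of_finite_index_in_PSp
    (m : ℕ) (hm : 2 ≤ m) (Γ : Type*) [Group Γ] (hΓ : Group.FG Γ)
    (ρ : Γ →* (Matrix.symplecticGroup (Fin m) ℤ ⧸
        Subgroup.center (Matrix.symplecticGroup (Fin m) ℤ)))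
    (hρ : ρ.range.FiniteIndex) :
    ExpSmall {γ : Γ | ∃ A : Matrix.symplecticGroup (Fin m) ℤ,
      QuotientGroup.mk' (Subgroup.center (Matrix.symplecticGroup (Fin m) ℤ)) A = ρ γ ∧
      ¬ Irreducible (((A : Matrix (Fin m ⊕ Fin m) (Fin m ⊕ Fin m) ℤ).charpoly).map
          (Int.castRingHom ℚ))} := by
  intro S hS
  obtain ⟨N, θ, hθ0, hθ1, h⟩ := SymplecticGroup.exists_walkProb_le hm ρ hρ hS
    (Z := {γ : Γ | ∃ A : Matrix.symplecticGroup (Fin m) ℤ,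
      QuotientGroup.mk' (Subgroup.center (Matrix.symplecticGroup (Fin m) ℤ)) A = ρ γ ∧
      ¬ Irreducible (((A : Matrix (Fin m ⊕ Fin m) (Fin m ⊕ Fin m) ℤ).charpoly).map
          (Int.castRingHom ℚ))}) (by
      rintro γ ⟨A, hA, hirr⟩ p _
      rw [← hA]
      exact SymplecticGroup.projMap_notMem_irreducibleClasses hirr p)
  exact expSmallWrt_of_sieve_bound (by positivity) (by positivity) hθ0 hθ1 h
end

section
/- For every n ≥ 1 and every integer m ≥ 1, the group homomorphism Sp(2n, ℤ) → Sp(2n, ℤ/mℤ) induced by entrywise reduction modulo m is surjective. -/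
open Matrix

lemma J_map {l : Type*} [DecidableEq l] [Fintype l] {R S : Type*} [CommRing R] [CommRing S]
    (f : R →+* S) : (Matrix.J l R).map f = Matrix.J l S := by
  ext i j
  cases i <;> cases j <;>
    simp [Matrix.J, Matrix.map_apply, Matrix.one_apply, apply_ite f]

lemma mem_sp_map {l : Type*} [DecidableEq l] [Fintype l] {R S : Type*} [CommRing R] [CommRing S]
    (f : R →+* S) (A : Matrix (l ⊕ l) (l ⊕ l) R) (hA : A ∈ Matrix.symplecticGroup l R) :
    A.map f ∈ Matrix.symplecticGroup l S := by
  rw [SymplecticGroup.mem_iff] at hA ⊢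
  have h2 : (A * Matrix.J l R * Aᵀ).map f = (Matrix.J l R).map f := by rw [hA]
  rw [Matrix.map_mul, Matrix.map_mul, Matrix.transpose_map, J_map f] at h2
  rw [← Matrix.transpose_map]
  exact h2

/-- Entrywise reduction as a group homomorphism between symplectic groups. -/
def spReduce (l : Type*) [DecidableEq l] [Fintype l] {R S : Type*} [CommRing R] [CommRing S]
    (f : R →+* S) : Matrix.symplecticGroup l R →* Matrix.symplecticGroup l S where
  toFun A := ⟨A.1.map f, mem_sp_map f A.1 A.2⟩
  map_one' := Subtype.ext (by
    show (1 : Matrix (l ⊕ l) (l ⊕ l) R).map f = (1 : Matrix (l ⊕ l) (l ⊕ l) S)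
    ext i j
    simp [Matrix.map_apply, Matrix.one_apply, apply_ite f])
  map_mul' A B := Subtype.ext (by
    show (A.1 * B.1).map f = A.1.map f * B.1.map f
    exact Matrix.map_mul)

/-- In a finite ring, some positive power of `a` is the indicator of the maximal ideals that
do not contain `a`. -/
theorem exists_mem_iff_and_sub_one_mem {R : Type*} [CommRing R] [Finite R] (a : R) :
    ∃ e : R, ∀ P : Ideal R, P.IsPrime → (a ∈ P ∧ e ∈ P) ∨ (a ∉ P ∧ e - 1 ∈ P) := by
  obtain ⟨i, j, hij, h⟩ : ∃ i j : ℕ, i < j ∧ a ^ i = a ^ j := by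
    obtain ⟨i, j, hne, h⟩ := Finite.exists_ne_map_eq_of_infinite (fun k : ℕ => a ^ k)
    rcases hne.lt_or_gt with hlt | hlt
    · exact ⟨i, j, hlt, h⟩
    · exact ⟨j, i, hlt, h.symm⟩
  refine ⟨a ^ (j - i), fun P hP => ?_⟩
  by_cases ha : a ∈ P
  · exact Or.inl ⟨ha, P.pow_mem_of_mem ha _ (by omega)⟩
  · refine Or.inr ⟨ha, (hP.mem_or_mem (x := a ^ i) ?_).resolve_left
      fun hi => ha (hP.mem_of_pow_mem _ hi)⟩
    rw [mul_sub, ← pow_add, Nat.add_sub_cancel' hij.le, h, mul_one, sub_self]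
    exact P.zero_mem

theorem exists_isUnit_mul_add_and_mul_sub {R : Type*} [CommRing R] [Finite R] (a b : R) :
    ∃ s t : R, IsUnit (s * a + t) ∧ IsUnit (t * b - s) := by
  obtain ⟨e, he⟩ := exists_mem_iff_and_sub_one_mem a
  obtain ⟨g, hg⟩ := exists_mem_iff_and_sub_one_mem b
  have isUnit_of_notMem (x : R) (h : ∀ P : Ideal R, P.IsPrime → x ∉ P) : IsUnit x := by
    by_contra hx
    obtain ⟨P, hP, hxP⟩ := exists_max_ideal_of_mem_nonunits hx
    exact h P hP.isPrime hxP
  refine ⟨e + (1 - e) * (1 - g), 1 - e, isUnit_of_notMem _ fun P hP h => ?_,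
    isUnit_of_notMem _ fun P hP h => ?_⟩
  all_goals
    have h1 := (Ideal.ne_top_iff_one P).1 hP.ne_top
    have he := he P hP
    have hg := hg P hP
    simp only [← Ideal.Quotient.eq_zero_iff_mem, map_add, map_mul, map_sub, map_one] at *
    generalize Ideal.Quotient.mk P a = a' at *
    generalize Ideal.Quotient.mk P b = b' at *
    generalize Ideal.Quotient.mk P e = e' at *
    generalize Ideal.Quotient.mk P g = g' at *
    rcases he with ⟨ha, he⟩ | ⟨ha, he⟩ <;> rcases hg with ⟨hb, hg⟩ | ⟨hb, hg⟩ <;> grind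

namespace SymplecticGroup

variable {l R : Type*} [DecidableEq l] [Fintype l] [CommRing R]

/-- The alternating form preserved by the symplectic group. -/
noncomputable def form (l R : Type*) [DecidableEq l] [Fintype l] [CommRing R] :
    LinearMap.BilinForm R (l ⊕ l → R) :=
  Matrix.toBilin' (J l R)

theorem form_apply (x y : l ⊕ l → R) : form l R x y = x ⬝ᵥ J l R *ᵥ y :=
  Matrix.toBilin'_apply' _ _ _

theorem form_single (i j : l ⊕ l) :
    form l R (Pi.single i 1) (Pi.single j 1) = J l R i j :=
  Matrix.toBilin'_single _ _ _

theorem isAlt_form : (form l R).IsAlt := by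
  intro x
  rw [form_apply, ← Sum.elim_comp_inl_inr x, J, fromBlocks_mulVec]
  simp [neg_mulVec, dotProduct, mul_comm]

theorem form_smul_smul (M : symplecticGroup l R) (x y : l ⊕ l → R) :
    form l R (M • x) (M • y) = form l R x y := by
  have hM := mem_iff'.1 M.2
  change form l R (M.1 *ᵥ x) (M.1 *ᵥ y) = _
  rw [form_apply, form_apply, ← vecMul_transpose, ← dotProduct_mulVec, mulVec_mulVec,
    mulVec_mulVec, hM]

/-- The symplectic transvection `x ↦ x + c ω(x, u) u`. -/
def transvection (u : l ⊕ l → R) (c : R) : symplecticGroup l R :=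
  ⟨1 + vecMulVec (c • u) (J l R *ᵥ u), by
    have hu : u ⬝ᵥ J l R *ᵥ u = 0 := by rw [← form_apply, isAlt_form.self_eq_zero]
    have hJ : u ᵥ* J l R = -(J l R *ᵥ u) := by
      rw [← mulVec_transpose, J_transpose, neg_mulVec]
    rw [mem_iff']
    rw [transpose_add, transpose_one, transpose_vecMulVec, smul_vecMulVec, vecMulVec_smul,
      Matrix.add_mul, Matrix.one_mul, Matrix.mul_add, Matrix.mul_one, Matrix.mul_smul, Matrix.smul_mul,
      Matrix.add_mul, Matrix.smul_mul, vecMulVec_mul, mul_vecMulVec, hJ, vecMulVec_mul_vecMulVec,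
      neg_dotProduct, dotProduct_comm, hu, vecMulVec_neg]
    simp⟩

theorem transvection_smul (u : l ⊕ l → R) (c : R) (x : l ⊕ l → R) :
    transvection u c • x = x + (c * form l R x u) • u := by
  change (1 + vecMulVec (c • u) (J l R *ᵥ u)) *ᵥ x = _
  rw [add_mulVec, one_mulVec, vecMulVec_mulVec, form_apply, dotProduct_comm x]
  ext i
  simp
  ring

theorem transvection_sub_smul {x y : l ⊕ l → R} {c : R} (h : c * form l R x y = 1) :
    transvection (y - x) c • x = y := by
  rw [transvection_smul, map_sub, isAlt_form.self_eq_zero, sub_zero, h, one_smul,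
    add_sub_cancel]

theorem form_smul_left_of_smul_eq {M : symplecticGroup l R} {x y : l ⊕ l → R}
    (h : M • x = x) : form l R x (M • y) = form l R x y := by
  nth_rw 1 [← h]
  exact form_smul_smul M x y

theorem exists_mem_smul_eq_and_smul_eq [Finite R] (K : Subgroup (symplecticGroup l R))
    (W : Submodule R (l ⊕ l → R)) (hK : ∀ u ∈ W, ∀ c, transvection u c ∈ K)
    (hW : ∀ k ∈ K, ∀ x ∈ W, k • x ∈ W) {v w e f : l ⊕ l → R} (hv : v ∈ W) (hw : w ∈ W)
    (he : e ∈ W) (hf : f ∈ W) (hvw : form l R v w = 1) (hef : form l R e f = 1) :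
    ∃ k ∈ K, k • v = e ∧ k • w = f := by
  obtain ⟨k, hk, hkv⟩ : ∃ k ∈ K, k • v = e := by
    obtain ⟨s, t, h₁, h₂⟩ := exists_isUnit_mul_add_and_mul_sub (form l R v f) (form l R w e)
    have hz : s • f + t • w ∈ W := W.add_mem (W.smul_mem _ hf) (W.smul_mem _ hw)
    obtain ⟨c, hc⟩ := h₁.exists_left_inv
    obtain ⟨d, hd⟩ := h₂.exists_left_inv
    refine ⟨transvection (e - (s • f + t • w)) d * transvection (s • f + t • w - v) c,
      K.mul_mem (hK _ (W.sub_mem he hz) _) (hK _ (W.sub_mem hz hv) _), ?_⟩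
    rw [mul_smul, transvection_sub_smul, transvection_sub_smul]
    · have hfe : form l R f e = -1 := by rw [← isAlt_form.neg_eq, hef]
      rw [← hd]
      simp [hfe]
      ring
    · rw [← hc]
      simp [hvw]
  have hkw : form l R e (k • w) = 1 := by rw [← hkv, form_smul_smul, hvw]
  set c := form l R (k • w) f - 1 with hc
  have hz : transvection e c • k • w = k • w - c • e := by
    rw [transvection_smul, ← isAlt_form.neg_eq, hkw, mul_neg_one, neg_smul, sub_eq_add_neg]
  have hTe : transvection e c • e = e := by
    rw [transvection_smul, isAlt_form.self_eq_zero, mul_zero, zero_smul, add_zero]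
  have hkwW := hW k hk w hw
  refine ⟨transvection (f - (k • w - c • e)) 1 * (transvection e c * k),
    K.mul_mem (hK _ (W.sub_mem hf (W.sub_mem hkwW (W.smul_mem _ he))) _)
      (K.mul_mem (hK _ he _) hk), ?_, ?_⟩
  · rw [mul_smul, mul_smul, hkv, hTe, transvection_smul]
    simp [hef, hkw, isAlt_form.self_eq_zero]
  · rw [mul_smul, mul_smul, hz, transvection_sub_smul]
    simp [hef, hc]

theorem eq_top_of_transvection_mem [Finite R] (H : Subgroup (symplecticGroup l R))
    (hH : ∀ u c, transvection u c ∈ H) : H = ⊤ := by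
  refine eq_top_iff.2 fun M _ => ?_
  obtain ⟨h, hh, hfix⟩ : ∃ h ∈ H, ∀ i ∈ (Finset.univ : Finset l),
      (h * M) • (Pi.single (.inr i) 1 : l ⊕ l → R) = Pi.single (.inr i) 1 ∧
      (h * M) • (Pi.single (.inl i) 1 : l ⊕ l → R) = Pi.single (.inl i) 1 := by
    induction (Finset.univ : Finset l) using Finset.induction_on with
    | empty => exact ⟨1, H.one_mem, by simp⟩
    | insert j s hj ih =>
      obtain ⟨h, hh, hfix⟩ := ih
      let F : Set (l ⊕ l → R) :=
        {x | ∃ i ∈ s, x = Pi.single (.inr i) 1 ∨ x = Pi.single (.inl i) 1}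
      let W : Submodule R (l ⊕ l → R) := ⨅ x ∈ F, LinearMap.ker (form l R x)
      let K : Subgroup (symplecticGroup l R) := H ⊓ fixingSubgroup (symplecticGroup l R) F
      have mem_W (y : l ⊕ l → R) : y ∈ W ↔ ∀ x ∈ F, form l R x y = 0 := by simp [W]
      have mem_K (k) : k ∈ K ↔ k ∈ H ∧ ∀ x ∈ F, k • x = x := by
        simp [K, Subgroup.mem_inf, mem_fixingSubgroup_iff]
      have hM : ∀ x ∈ F, (h * M) • x = x := by
        rintro x ⟨i, hi, rfl | rfl⟩
        exacts [(hfix i hi).1, (hfix i hi).2]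
      have smul_mem_W {g : symplecticGroup l R} (hg : ∀ x ∈ F, g • x = x) {y : l ⊕ l → R}
          (hy : y ∈ W) : g • y ∈ W := by
        rw [mem_W] at hy ⊢
        exact fun x hx => (form_smul_left_of_smul_eq (hg x hx)).trans (hy x hx)
      have hr : (Pi.single (.inr j) 1 : l ⊕ l → R) ∈ W := by
        rw [mem_W]
        rintro x ⟨i, hi, rfl | rfl⟩ <;> rw [form_single] <;>
          simp [J, ne_of_mem_of_not_mem hi hj]
      have hl : (Pi.single (.inl j) 1 : l ⊕ l → R) ∈ W := by
        rw [mem_W]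
        rintro x ⟨i, hi, rfl | rfl⟩ <;> rw [form_single] <;>
          simp [J, ne_of_mem_of_not_mem hi hj]
      have hrl : form l R (Pi.single (.inr j) 1) (Pi.single (.inl j) 1) = 1 := by
        rw [form_single]
        simp [J]
      obtain ⟨k, hk, hkr, hkl⟩ := exists_mem_smul_eq_and_smul_eq K W
        (fun u hu c => (mem_K _).2 ⟨hH u c, fun x hx => by
          rw [transvection_smul, (mem_W u).1 hu x hx, mul_zero, zero_smul, add_zero]⟩)
        (fun k hk x hx => smul_mem_W ((mem_K k).1 hk).2 hx)
        (smul_mem_W hM hr) (smul_mem_W hM hl) hr hl ((form_smul_smul _ _ _).trans hrl) hrl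
      rw [mem_K] at hk
      refine ⟨k * h, H.mul_mem hk.1 hh, fun i hi => ?_⟩
      rw [mul_assoc, mul_smul k, mul_smul k]
      rcases Finset.mem_insert.1 hi with rfl | hi
      · exact ⟨hkr, hkl⟩
      · rw [(hfix i hi).1, (hfix i hi).2]
        exact ⟨hk.2 _ ⟨i, hi, .inl rfl⟩, hk.2 _ ⟨i, hi, .inr rfl⟩⟩
  have h_one : h * M = 1 := by
    refine Subtype.ext (Matrix.ext_of_mulVec_single fun i => ?_)
    rw [OneMemClass.coe_one, one_mulVec]
    rcases i with i | i
    exacts [(hfix i (Finset.mem_univ i)).2, (hfix i (Finset.mem_univ i)).1]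
  rw [eq_inv_of_mul_eq_one_right h_one]
  exact H.inv_mem hh

end SymplecticGroup

theorem spReduce_transvection {l R S : Type*} [DecidableEq l] [Fintype l] [CommRing R]
    [CommRing S] (f : R →+* S) (u : l ⊕ l → R) (c : R) :
    spReduce l f (SymplecticGroup.transvection u c) =
      SymplecticGroup.transvection (f ∘ u) (f c) := by
  refine Subtype.ext ?_
  change (1 + vecMulVec (c • u) (J l R *ᵥ u)).map f =
    1 + vecMulVec (f c • (f ∘ u)) (J l S *ᵥ (f ∘ u))
  ext i j
  have h := f.map_mulVec (J l R) u j
  rw [J_map] at h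
  simp [vecMulVec_apply, h, Matrix.one_apply, apply_ite f]

theorem spReduce_surjective_of_finite {l R S : Type*} [DecidableEq l] [Fintype l] [CommRing R]
    [CommRing S] [Finite S] {f : R →+* S} (hf : Function.Surjective f) :
    Function.Surjective (spReduce l f) := by
  refine MonoidHom.range_eq_top.1 (SymplecticGroup.eq_top_of_transvection_mem _ fun u c => ?_)
  obtain ⟨v, rfl⟩ := hf.comp_left u
  obtain ⟨d, rfl⟩ := hf c
  exact ⟨_, spReduce_transvection f v d⟩

theorem spReduce_surjective (n m : ℕ) (hn : 1 ≤ n) (hm : 1 ≤ m) :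
    Function.Surjective (spReduce (Fin n) (Int.castRingHom (ZMod m))) := by
  have : NeZero m := ⟨by omega⟩
  exact spReduce_surjective_of_finite (ZMod.ringHom_surjective _)
end

section
/- For every g ≥ 1 there exists a constant c ∈ (0,1) such that for every prime p, the number of matrices A ∈ Sp(2g, ℤ/pℤ) whose characteristic polynomial is not irreducible in (ℤ/pℤ)[x] is at most c·|Sp(2g, ℤ/pℤ)|. -/
open Matrix Polynomial Module

/-- A degree-two extension `K / L`, viewed over a subfield `F`, has a basis with respect to which
multiplication by `z` is symplectic exactly when `z` has relative norm one. -/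
theorem exists_basis_leftMulMatrix_mem_symplecticGroup_iff {ι F L K : Type*} [Fintype ι]
    [DecidableEq ι] [Field F] [Field L] [Field K] [Algebra F L] [Algebra L K] [Algebra F K]
    [IsScalarTower F L K] [FiniteDimensional F L] [Algebra.IsSeparable F L]
    (b : Basis ι F L) (hK : finrank L K = 2) :
    ∃ β : Basis (ι ⊕ ι) F K, ∀ z : K,
      Algebra.leftMulMatrix β z ∈ symplecticGroup ι F ↔ Algebra.norm L z = 1 := by
  have : FiniteDimensional L K := FiniteDimensional.of_finrank_pos (by omega)
  let e : K ≃ₗ[L] L × L := LinearEquiv.ofFinrankEq _ _ (by simp [hK])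
  have he (c : F) (x : K) : e (c • x) = c • e x := (e.restrictScalars F).map_smul c x
  let D : K → K → L := fun x y => (e x).2 * (e y).1 - (e x).1 * (e y).2
  have hD (z x y : K) : D (z * x) (z * y) = Algebra.norm L z * D x y := by
    have h := ((Basis.finTwoProd L).map e.symm).det_comp (Algebra.lmul L K z) ![x, y]
    rw [← Algebra.norm_apply] at h
    simp only [Basis.det_apply, Matrix.det_fin_two, Basis.toMatrix_apply] at h
    change (e (z * x)).1 * (e (z * y)).2 - (e (z * y)).1 * (e (z * x)).2 =
      _ * ((e x).1 * (e y).2 - (e y).1 * (e x).2) at h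
    simp only [D]
    linear_combination -h
  let B : K →ₗ[F] K →ₗ[F] F := LinearMap.mk₂ F (fun x y => Algebra.trace F L (D x y))
    (fun x y z => by rw [← map_add]; congr 1; simp [D]; ring)
    (fun c x y => by rw [← map_smul]; congr 1; simp [D, he, smul_sub])
    (fun x y z => by rw [← map_add]; congr 1; simp [D]; ring)
    (fun c x y => by rw [← map_smul]; congr 1; simp [D, he, smul_sub])
  have hBapp (x y : K) : B x y = Algebra.trace F L (D x y) := rfl
  let β : Basis (ι ⊕ ι) F K := (b.prod b.traceDual).map (e.restrictScalars F).symm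
  have hβ : LinearMap.toMatrix₂ β β B = J ι F := by
    ext i j
    rw [LinearMap.toMatrix₂_apply, hBapp]
    rcases i with i | i <;> rcases j with j | j <;>
      simp [β, D, J, Matrix.one_apply, eq_comm]
  refine ⟨β, fun z => ?_⟩
  have hcomp : (Algebra.leftMulMatrix β z)ᵀ * J ι F * Algebra.leftMulMatrix β z =
      LinearMap.toMatrix₂ β β (B.compl₁₂ (Algebra.lmul F K z) (Algebra.lmul F K z)) := by
    rw [LinearMap.toMatrix₂_compl₁₂ β β, hβ]; rfl
  rw [SymplecticGroup.mem_iff', hcomp, ← hβ, EmbeddingLike.apply_eq_iff_eq]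
  constructor
  · intro h
    rw [← sub_eq_zero]
    refine (traceForm_nondegenerate F L).1 _ fun c => ?_
    have h1 := LinearMap.congr_fun₂ h (e.symm (0, 1)) (e.symm (c, 0))
    change Algebra.trace F L (D (z * _) (z * _)) = Algebra.trace F L (D _ _) at h1
    rw [hD] at h1
    rw [Algebra.traceForm_apply, sub_mul, map_sub, sub_eq_zero]
    simpa [D] using h1
  · intro h
    ext x y
    change Algebra.trace F L (D (z * x) (z * y)) = Algebra.trace F L (D x y)
    rw [hD, h, one_mul]

/-- If each element of `S` has centralizer of order at most `b` and at most `a` of them lie in any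
one conjugacy class, then the conjugates of elements of `S` make up a large part of the group. -/
theorem card_mul_card_le_mul_card_conjugates {G : Type*} [Group G] [Fintype G] [DecidableEq G]
    (S X : Finset G) (a b : ℕ) (hX : ∀ s ∈ S, ∀ h : G, h * s * h⁻¹ ∈ X)
    (ha : ∀ y : G, (S.filter fun s => IsConj s y).card ≤ a)
    (hb : ∀ s ∈ S, (Finset.univ.filter fun h : G => h * s = s * h).card ≤ b) :
    S.card * Fintype.card G ≤ a * b * X.card := by
  have h1 : (S ×ˢ (Finset.univ : Finset G)).card ≤ (b * a) * X.card := by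
    refine Finset.card_le_mul_card_image_of_maps_to (f := fun q => q.2 * q.1 * q.2⁻¹)
      (fun q hq => hX _ (Finset.mem_product.1 hq).1 _) _ fun y _ => ?_
    refine (Finset.card_le_mul_card_image_of_maps_to (f := Prod.fst)
      (t := S.filter fun s => IsConj s y) ?_ b ?_).trans (Nat.mul_le_mul_left _ (ha y))
    · intro q hq
      simp only [Finset.mem_filter, Finset.mem_product, Finset.mem_univ, and_true] at hq ⊢
      exact ⟨hq.1, isConj_iff.2 ⟨q.2, hq.2⟩⟩
    · intro s hs
      obtain ⟨hsS, hs⟩ := Finset.mem_filter.1 hs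
      obtain ⟨k, rfl⟩ := isConj_iff.1 hs
      refine (Finset.card_le_card_of_injOn (fun q => k⁻¹ * q.2) ?_ ?_).trans (hb s hsS)
      · rintro ⟨t, h⟩ hq
        simp only [Finset.coe_filter, Finset.mem_filter, Finset.mem_product, Finset.mem_univ,
          and_true, Set.mem_ofPred_eq, true_and] at hq ⊢
        obtain ⟨⟨-, h2⟩, rfl⟩ := hq
        rw [mul_inv_eq_iff_eq_mul] at h2
        rw [mul_assoc, h2]
        group
      · rintro ⟨t, h⟩ hq ⟨t', h'⟩ hq' heq
        simp only [Finset.coe_filter, Finset.mem_filter, Set.mem_ofPred_eq] at hq hq'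
        obtain ⟨-, rfl⟩ := hq
        obtain ⟨-, rfl⟩ := hq'
        simpa using heq
  rwa [Finset.card_product, Finset.card_univ, mul_comm b a] at h1

/-- Matrices commuting with multiplication by a primitive element are multiplications. -/
theorem exists_leftMulMatrix_eq_of_commute {ι F K : Type*} [Fintype ι] [DecidableEq ι] [Field F]
    [Field K] [Algebra F K] [FiniteDimensional F K] (β : Basis ι F K) {z : K}
    (hz : (minpoly F z).natDegree = finrank F K) {M : Matrix ι ι F}
    (hM : M * Algebra.leftMulMatrix β z = Algebra.leftMulMatrix β z * M) :
    ∃ w, Algebra.leftMulMatrix β w = M := by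
  have htop : Algebra.adjoin F {z} = ⊤ := by
    rw [← IntermediateField.adjoin_simple_toSubalgebra_of_isAlgebraic
      (Algebra.IsAlgebraic.isAlgebraic z),
      (Field.primitive_element_iff_minpoly_natDegree_eq F z).2 hz]
    rfl
  have hcomm (x : K) : Commute M (Algebra.leftMulMatrix β x) := by
    have hx : x ∈ Algebra.adjoin F {z} := htop ▸ Algebra.mem_top
    induction hx using Algebra.adjoin_induction with
    | mem x hx => rw [Set.mem_singleton_iff.1 hx]; exact hM
    | algebraMap r => rw [AlgHom.commutes]; exact (Algebra.commutes r M).symm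
    | add x y _ _ hx hy => rw [map_add]; exact hx.add_right hy
    | mul x y _ _ hx hy => rw [map_mul]; exact hx.mul_right hy
  refine ⟨Matrix.toLin β β M 1, (Matrix.toLin β β).injective <| LinearMap.ext fun x => ?_⟩
  have h := congrArg (fun N => Matrix.toLin β β N 1) (hcomm x).eq
  simp only [Matrix.toLin_mul β β β, LinearMap.comp_apply] at h
  have key (w y : K) : Matrix.toLin β β (Algebra.leftMulMatrix β w) y = w * y := by
    rw [Algebra.leftMulMatrix_apply, Matrix.toLin_toMatrix]; rfl
  rw [key, key, mul_one] at h
  rw [key, h, mul_comm]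

theorem charpoly_leftMulMatrix_eq_minpoly {ι F K : Type*} [Fintype ι] [DecidableEq ι] [Field F]
    [Field K] [Algebra F K] [FiniteDimensional F K] (β : Basis ι F K) {z : K}
    (hz : (minpoly F z).natDegree = finrank F K) :
    (Algebra.leftMulMatrix β z).charpoly = minpoly F z := by
  have hd : minpoly F z ∣ (Algebra.leftMulMatrix β z).charpoly := by
    refine minpoly.dvd F z (Algebra.leftMulMatrix_injective β ?_)
    rw [← Polynomial.aeval_algHom_apply, Matrix.aeval_self_charpoly, map_zero]
  refine Polynomial.eq_of_monic_of_dvd_of_natDegree_le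
    (minpoly.monic (Algebra.IsIntegral.isIntegral z)) (Matrix.charpoly_monic _) hd ?_
  rw [Matrix.charpoly_natDegree_eq_dim, hz, finrank_eq_card_basis β]

theorem pow_card_pow_natDegree_minpoly {F K : Type*} [Field F] [Finite F] [Field K] [Algebra F K]
    [FiniteDimensional F K] (z : K) : z ^ Nat.card F ^ (minpoly F z).natDegree = z := by
  have : Finite K := Module.finite_of_finite F
  have := Fintype.ofFinite (IntermediateField.adjoin F {z})
  have h := FiniteField.pow_card (IntermediateField.AdjoinSimple.gen F z)
  rw [← Nat.card_eq_fintype_card, Module.natCard_eq_pow_finrank (K := F),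
    IntermediateField.adjoin.finrank (Algebra.IsIntegral.isIntegral z)] at h
  simpa using congrArg (algebraMap (IntermediateField.adjoin F {z}) K) h

theorem card_filter_pow_eq_self_le {K : Type*} [Field K] [Fintype K] [DecidableEq K] {n : ℕ}
    (hn : 1 < n) : (Finset.univ.filter fun z : K => z ^ n = z).card ≤ n := by
  have hne : (X ^ n - X : K[X]) ≠ 0 := FiniteField.X_pow_card_sub_X_ne_zero K hn
  calc (Finset.univ.filter fun z : K => z ^ n = z).card
      ≤ (X ^ n - X : K[X]).roots.toFinset.card := Finset.card_le_card fun z hz => by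
        simpa [hne, sub_eq_zero] using hz
    _ ≤ (X ^ n - X : K[X]).natDegree :=
        (Multiset.toFinset_card_le _).trans (Polynomial.card_roots' _)
    _ = n := FiniteField.X_pow_card_sub_X_natDegree_eq K hn

theorem card_filter_norm_eq_one {L K : Type*} [Field L] [Field K] [Algebra L K] [Fintype K]
    [DecidableEq L] (hK : finrank L K = 2) :
    (Finset.univ.filter fun z : K => Algebra.norm L z = 1).card = Nat.card L + 1 := by
  have : FiniteDimensional L K := FiniteDimensional.of_finrank_pos (by omega)
  have : Finite L := Finite.of_injective _ (algebraMap L K).injective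
  let N : Kˣ →* Lˣ := Units.map (Algebra.norm L (S := K))
  have hcard : (Finset.univ.filter fun z : K => Algebra.norm L z = 1).card = Nat.card N.ker := by
    rw [← Fintype.card_subtype, ← Nat.card_eq_fintype_card]
    refine (Nat.card_congr (Equiv.ofBijective
      (fun u : N.ker => (⟨(u : Kˣ), congrArg Units.val u.2⟩ :
        {z : K // Algebra.norm L z = 1})) ⟨?_, ?_⟩)).symm
    · intro u v h
      exact Subtype.ext (Units.ext (congrArg Subtype.val h))
    · rintro ⟨z, hz⟩
      have hz0 : z ≠ 0 := by rintro rfl; simp at hz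
      exact ⟨⟨Units.mk0 z hz0, Units.ext hz⟩, rfl⟩
  have h := N.ker.card_mul_index
  rw [Subgroup.index_ker, MonoidHom.range_eq_top.2 (FiniteField.unitsMap_norm_surjective L K),
    Subgroup.card_top, Nat.card_units, Nat.card_units,
    Module.natCard_eq_pow_finrank (K := L) (V := K), hK, ← hcard] at h
  have h1 : 1 < Nat.card L := Finite.one_lt_card
  obtain ⟨m, hm⟩ : ∃ m, Nat.card L = m + 2 := ⟨Nat.card L - 2, by omega⟩
  rw [hm] at h ⊢
  refine Nat.eq_of_mul_eq_mul_right (show 0 < m + 2 - 1 by omega) (h.trans ?_)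
  rw [show m + 2 - 1 = m + 1 by omega, Nat.sub_eq_iff_eq_add (Nat.one_le_pow _ _ (by omega))]
  ring

/-- A definite proportion of the elements of relative norm one generate the field. -/
theorem card_norm_eq_one_le_mul_card_primitive {p g : ℕ} [Fact p.Prime] (hg : 1 ≤ g)
    {L K : Type*} [Field L] [Field K] [Algebra (ZMod p) L] [Algebra L K] [Algebra (ZMod p) K]
    [IsScalarTower (ZMod p) L K] [Fintype K] [DecidableEq L] [DecidableEq K]
    (hL : finrank (ZMod p) L = g) (hK : finrank L K = 2) :
    (Finset.univ.filter fun z : K => Algebra.norm L z = 1).card ≤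
        4 ^ g * (Finset.univ.filter fun z : K =>
          Algebra.norm L z = 1 ∧ (minpoly (ZMod p) z).natDegree = 2 * g).card := by
  have hp : p.Prime := Fact.out
  have : FiniteDimensional (ZMod p) L := FiniteDimensional.of_finrank_pos (by omega)
  have : FiniteDimensional L K := FiniteDimensional.of_finrank_pos (by omega)
  have : FiniteDimensional (ZMod p) K := Module.Finite.trans L K
  have hFK : finrank (ZMod p) K = 2 * g := by
    rw [← finrank_mul_finrank (ZMod p) L K, hL, hK, mul_comm]
  have hcL : Nat.card L = p ^ g := by
    rw [Module.natCard_eq_pow_finrank (K := ZMod p), hL, Nat.card_zmod]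
  set S := Finset.univ.filter fun z : K =>
    Algebra.norm L z = 1 ∧ (minpoly (ZMod p) z).natDegree = 2 * g with hS
  set C := Finset.univ.filter fun z : K => Algebra.norm L z = 1 with hC
  have hCcard : C.card = p ^ g + 1 := by rw [hC, card_filter_norm_eq_one hK, hcL]
  set T := Finset.univ.filter fun z : K => z ^ 2 = 1 with hT
  have hnorm (z : K) (hz : Algebra.norm L z = 1) : z ^ (p ^ g) * z = 1 := by
    have h := FiniteField.algebraMap_norm_eq_pow (K := L) (x := z)
    have h1 : 1 < p ^ g := Nat.one_lt_pow (by omega) hp.one_lt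
    rw [hz, map_one, Module.natCard_eq_pow_finrank (K := L) (V := K), hK, hcL,
      show (p ^ g) ^ 2 - 1 = (p ^ g + 1) * (p ^ g - 1) by
        simpa using Nat.sq_sub_sq (p ^ g) 1,
      Nat.mul_div_cancel _ (by omega), pow_succ] at h
    exact h.symm
  have hsub : C ⊆ S ∪ (T ∪ (Finset.Ico 1 g).biUnion fun d =>
      Finset.univ.filter fun z : K => z ^ p ^ d = z) := by
    intro z hz
    have hz : Algebra.norm L z = 1 := by simpa [hC] using hz
    simp only [hS, hT, Finset.mem_union, Finset.mem_filter, Finset.mem_univ, true_and, hz,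
      Finset.mem_biUnion, Finset.mem_Ico]
    have hint : IsIntegral (ZMod p) z := Algebra.IsIntegral.isIntegral z
    have hd := minpoly.degree_dvd hint
    have hpos := minpoly.natDegree_pos hint
    have hpow := pow_card_pow_natDegree_minpoly (F := ZMod p) z
    rw [Nat.card_zmod] at hpow
    rw [hFK] at hd
    by_cases h1 : (minpoly (ZMod p) z).natDegree = 2 * g
    · exact .inl h1
    have h2 : (minpoly (ZMod p) z).natDegree ≤ g := by
      obtain ⟨k, hk⟩ := hd
      rcases k with _ | _ | k
      · omega
      · omega
      · nlinarith
    rcases h2.eq_or_lt with h2 | h2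
    · right; left
      have := hnorm z hz
      rw [h2] at hpow
      rwa [hpow, ← sq] at this
    · exact .inr (.inr ⟨_, ⟨hpos, h2⟩, hpow⟩)
  have hbound : C.card ≤ S.card + (T.card + ∑ d ∈ Finset.Ico 1 g, p ^ d) := by
    refine (Finset.card_le_card hsub).trans ((Finset.card_union_le _ _).trans ?_)
    gcongr
    refine (Finset.card_union_le _ _).trans ?_
    gcongr
    refine Finset.card_biUnion_le.trans (Finset.sum_le_sum fun d hd => ?_)
    exact card_filter_pow_eq_self_le
      (Nat.one_lt_pow (by have := (Finset.mem_Ico.1 hd).1; omega) hp.one_lt)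
  have hsum : (∑ d ∈ Finset.Ico 1 g, p ^ d) * (p - 1) + p = p ^ g := by
    obtain ⟨m, rfl⟩ : ∃ m, p = m + 1 := ⟨p - 1, by have := hp.pos; omega⟩
    have h := geom_sum_Ico_mul ((m + 1 : ℕ) : ℤ) hg
    push_cast at h
    zify
    simp only [Nat.add_sub_cancel]
    linear_combination h
  have h4 : 4 ≤ 4 ^ g := by simpa using Nat.pow_le_pow_right (show 0 < 4 by norm_num) hg
  rcases hp.two_le.eq_or_lt with h2 | h2
  · have hT1 : T.card ≤ 1 := by
      have : CharP K p := charP_of_injective_algebraMap (algebraMap (ZMod p) K).injective p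
      have : CharP K 2 := h2 ▸ this
      refine Finset.card_le_one.2 fun x hx y hy => ?_
      simp only [hT, Finset.mem_filter, Finset.mem_univ, true_and] at hx hy
      exact CharTwo.sq_injective (hx.trans hy.symm)
    subst h2
    have : 1 ≤ S.card := by omega
    have h3 : 2 ^ g + 1 ≤ 4 ^ g := Nat.pow_lt_pow_left (by norm_num) (by omega)
    calc C.card ≤ 4 ^ g * 1 := by omega
      _ ≤ _ := by gcongr
  · have hT2 : T.card ≤ 2 := by
      have hsubT : T ⊆ {1, -1} := fun z hz => by
        simpa [hT, pow_two, mul_self_eq_one_iff] using hz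
      exact (Finset.card_le_card hsubT).trans Finset.card_le_two
    have : (∑ d ∈ Finset.Ico 1 g, p ^ d) * 2 ≤ (∑ d ∈ Finset.Ico 1 g, p ^ d) * (p - 1) := by
      gcongr; omega
    calc C.card ≤ 2 * S.card := by omega
      _ ≤ _ := by gcongr; omega

theorem card_symplecticGroup_le_mul_card_irreducible (g p : ℕ) (hg : 1 ≤ g) (hp : p.Prime) :
    Nat.card (symplecticGroup (Fin g) (ZMod p)) ≤ 2 * g * 4 ^ g *
      Nat.card {A : symplecticGroup (Fin g) (ZMod p) //
        Irreducible (A : Matrix (Fin g ⊕ Fin g) (Fin g ⊕ Fin g) (ZMod p)).charpoly} := by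
  classical
  have : Fact p.Prime := ⟨hp⟩
  let L := GaloisField p g
  let K := FiniteField.Extension L p 2
  have hL : finrank (ZMod p) L = g := GaloisField.finrank p (by omega)
  have hK : finrank L K = 2 := FiniteField.finrank_extension L p 2
  have hFK : finrank (ZMod p) K = 2 * g := by
    rw [← finrank_mul_finrank (ZMod p) L K, hL, hK, mul_comm]
  have := Fintype.ofFinite K
  obtain ⟨β, hβ⟩ := exists_basis_leftMulMatrix_mem_symplecticGroup_iff (K := K)
    (finBasisOfFinrankEq (ZMod p) L hL) hK
  set C := Finset.univ.filter fun z : K => Algebra.norm L z = 1 with hC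
  set S := Finset.univ.filter fun z : K =>
    Algebra.norm L z = 1 ∧ (minpoly (ZMod p) z).natDegree = 2 * g with hS
  have hCS : C.card ≤ 4 ^ g * S.card := card_norm_eq_one_le_mul_card_primitive hg hL hK
  let G := symplecticGroup (Fin g) (ZMod p)
  let S' : Finset G := Finset.univ.filter fun A => ∃ z ∈ S, Algebra.leftMulMatrix β z = A
  let X : Finset G := Finset.univ.filter fun A =>
    Irreducible (A : Matrix (Fin g ⊕ Fin g) (Fin g ⊕ Fin g) (ZMod p)).charpoly
  have hconj (s h : G) : ((h * s * h⁻¹ : G) : Matrix (Fin g ⊕ Fin g) _ (ZMod p)).charpoly =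
      (s : Matrix (Fin g ⊕ Fin g) _ (ZMod p)).charpoly := by
    rw [Submonoid.coe_mul, Matrix.charpoly_mul_comm, ← Submonoid.coe_mul, inv_mul_cancel_left]
  have hchar {z : K} (hz : z ∈ S) : (Algebra.leftMulMatrix β z).charpoly = minpoly (ZMod p) z :=
    charpoly_leftMulMatrix_eq_minpoly β ((Finset.mem_filter.1 hz).2.2.trans hFK.symm)
  have hSS' : S.card ≤ S'.card := by
    rw [← Finset.card_image_of_injective S (Algebra.leftMulMatrix_injective β)]
    refine (Finset.card_le_card ?_).trans (Finset.card_image_le (f := Subtype.val) (s := S'))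
    intro A hA
    obtain ⟨z, hz, rfl⟩ := Finset.mem_image.1 hA
    refine Finset.mem_image.2 ⟨⟨_, (hβ z).2 (Finset.mem_filter.1 hz).2.1⟩, ?_, rfl⟩
    exact Finset.mem_filter.2 ⟨Finset.mem_univ _, z, hz, rfl⟩
  have hmain : S'.card * Fintype.card G ≤ 2 * g * C.card * X.card := by
    refine card_mul_card_le_mul_card_conjugates S' X _ _ ?_ ?_ ?_
    · intro s hs h
      obtain ⟨-, z, hz, hzs⟩ := Finset.mem_filter.1 hs
      refine Finset.mem_filter.2 ⟨Finset.mem_univ _, ?_⟩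
      rw [hconj, ← hzs, hchar hz]
      exact minpoly.irreducible (Algebra.IsIntegral.isIntegral z)
    · intro y
      set f := (y : Matrix (Fin g ⊕ Fin g) (Fin g ⊕ Fin g) (ZMod p)).charpoly with hf
      have hf0 : f ≠ 0 := (Matrix.charpoly_monic _).ne_zero
      calc _ ≤ ((f.aroots K).toFinset.image (Algebra.leftMulMatrix β)).card := by
            refine Finset.card_le_card_of_injOn Subtype.val ?_ Subtype.val_injective.injOn
            intro s hs
            obtain ⟨hs, hsy⟩ := Finset.mem_filter.1 hs
            obtain ⟨-, z, hz, hzs⟩ := Finset.mem_filter.1 hs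
            obtain ⟨h, rfl⟩ := isConj_iff.1 hsy
            refine Finset.mem_image.2 ⟨z, ?_, hzs⟩
            rw [Multiset.mem_toFinset, Polynomial.mem_aroots, hf, hconj, ← hzs, hchar hz]
            exact ⟨minpoly.ne_zero (Algebra.IsIntegral.isIntegral z), minpoly.aeval _ _⟩
        _ ≤ (f.map (algebraMap (ZMod p) K)).natDegree := Finset.card_image_le.trans
            ((Multiset.toFinset_card_le _).trans (Polynomial.card_roots' _))
        _ = 2 * g := by
            rw [Polynomial.natDegree_map, hf, Matrix.charpoly_natDegree_eq_dim]
            simp [two_mul]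
    · intro s hs
      obtain ⟨-, z, hz, hzs⟩ := Finset.mem_filter.1 hs
      refine (Finset.card_le_card_of_injOn (t := C.image (Algebra.leftMulMatrix β)) Subtype.val
        ?_ Subtype.val_injective.injOn).trans Finset.card_image_le
      intro h hh
      have hh := congrArg Subtype.val (Finset.mem_filter.1 hh).2
      rw [Submonoid.coe_mul, Submonoid.coe_mul, ← hzs] at hh
      obtain ⟨w, hw⟩ := exists_leftMulMatrix_eq_of_commute β
        ((Finset.mem_filter.1 hz).2.2.trans hFK.symm) hh
      refine Finset.mem_image.2 ⟨w, Finset.mem_filter.2 ⟨Finset.mem_univ _, ?_⟩, hw⟩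
      exact (hβ w).1 (hw ▸ h.2)
  have hC0 : 0 < C.card := Finset.card_pos.2 ⟨1, by simp [hC]⟩
  have hS0 : 0 < S.card := Nat.pos_of_ne_zero fun h => by rw [h, mul_zero] at hCS; omega
  have hX : Nat.card {A : G // Irreducible
      (A : Matrix (Fin g ⊕ Fin g) (Fin g ⊕ Fin g) (ZMod p)).charpoly} = X.card := by
    rw [Nat.card_eq_fintype_card, Fintype.card_subtype]
  rw [hX, Nat.card_eq_fintype_card]
  refine le_of_mul_le_mul_left (a := S.card) ?_ hS0
  calc S.card * Fintype.card G ≤ S'.card * Fintype.card G := by gcongr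
    _ ≤ 2 * g * C.card * X.card := hmain
    _ ≤ 2 * g * (4 ^ g * S.card) * X.card := by gcongr
    _ = _ := by ring

theorem chavdarov_reducible_charpoly_bound (g : ℕ) (hg : 1 ≤ g) :
    ∃ c : ℝ, 0 < c ∧ c < 1 ∧ ∀ p : ℕ, p.Prime →
      (Nat.card {A : Matrix.symplecticGroup (Fin g) (ZMod p) //
          ¬ Irreducible ((A : Matrix (Fin g ⊕ Fin g) (Fin g ⊕ Fin g) (ZMod p)).charpoly)} : ℝ) ≤
        c * (Nat.card (Matrix.symplecticGroup (Fin g) (ZMod p)) : ℝ) := by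
  have hpos : (1 : ℝ) < 2 * g * 4 ^ g := by
    have h1 : (1 : ℝ) ≤ g := by exact_mod_cast hg
    have h2 : (1 : ℝ) ≤ 4 ^ g := one_le_pow₀ (by norm_num)
    nlinarith
  refine ⟨1 - (2 * g * 4 ^ g : ℝ)⁻¹, sub_pos.2 (inv_lt_one_of_one_lt₀ hpos),
    sub_lt_self _ (by positivity), fun p hp => ?_⟩
  classical
  have : Fact p.Prime := ⟨hp⟩
  have h := card_symplecticGroup_le_mul_card_irreducible g p hg hp
  have hsplit := Fintype.card_subtype_compl fun A : symplecticGroup (Fin g) (ZMod p) =>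
    Irreducible (A : Matrix (Fin g ⊕ Fin g) (Fin g ⊕ Fin g) (ZMod p)).charpoly
  have hle := Fintype.card_subtype_le fun A : symplecticGroup (Fin g) (ZMod p) =>
    Irreducible (A : Matrix (Fin g ⊕ Fin g) (Fin g ⊕ Fin g) (ZMod p)).charpoly
  simp only [← Nat.card_eq_fintype_card] at hsplit hle
  rw [hsplit, Nat.cast_sub hle, sub_mul, one_mul]
  gcongr
  rw [inv_mul_le_iff₀ (by linarith)]
  exact_mod_cast h
end
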